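/- There exists N such that the following holds for all n ≥ N. Let p₀ ≥ (log n)^{14}/n and p₁ ≥ ((np₀)³(log n)^{10})^{1/4}/n. Let m = log(n²p₁)/log log n, and for 2 ≤ i ≤ 2m+1 let pᵢ = p₁ if i is odd and pᵢ = 10^{10}p₁ if i is even. Let G₀ be a p₀-pseudorandom graph on n vertices. For each 1 ≤ i ≤ 2m+1, let Gᵢ be a pᵢ-pseudorandom spanning subgraph of G₀ and let Hᵢ be an even-regular spanning subgraph of Gᵢ whose degree lies between δ(Gᵢ)−1 and δ(Gᵢ). Suppose the graphs G₁,…,G_{2m+1} are pairwise edge-disjoint, and let H₀ be an even-regular spanning subgraph of G₀ that is edge-disjoint from H₁ ∪ … ∪ H_{2m+1}. Then there exists a collection HC of pairwise edge-disjoint Hamilton cycles such that every edge of H₀ lies in some cycle of HC, and every edge of every cycle of HC lies in H₀ ∪ H₁ ∪ … ∪ H_{2m+1}. -/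

import Mathlib

open scoped Classical
open SimpleGraph

namespace EDHC

/-- Degree of a vertex (as cardinality of its neighbour set). -/
noncomputable def deg {V : Type} (G : SimpleGraph V) (v : V) : ℕ := (G.neighborSet v).ncard

/-- Minimum degree. -/
noncomputable def minDeg {V : Type} (G : SimpleGraph V) : ℕ := sInf (Set.range (deg G))

/-- Maximum degree. -/
noncomputable def maxDeg {V : Type} (G : SimpleGraph V) : ℕ := sSup (Set.range (deg G))

/-- Number of edges of `G` with both endpoints in `S`. -/
noncomputable def eIn {V : Type} (G : SimpleGraph V) (S : Set V) : ℕ :=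
  {e ∈ G.edgeSet | ∀ v ∈ e, v ∈ S}.ncard

/-- Number of edges of `G` with one endpoint in `S` and the other in `T`. -/
noncomputable def eBtw {V : Type} (G : SimpleGraph V) (S T : Set V) : ℕ :=
  {e ∈ G.edgeSet | ∃ a ∈ S, ∃ b ∈ T, e = s(a, b)}.ncard

/-- `G` is `(p, β)`-jumbled. -/
def IsJumbled {V : Type} (G : SimpleGraph V) (p β : ℝ) : Prop :=
  ∀ S : Set V, |(eIn G S : ℝ) - p * ((S.ncard : ℝ) * ((S.ncard : ℝ) - 1) / 2)| ≤ β * S.ncard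

/-- `G` is strongly `2`-jumping. -/
def StronglyTwoJumping (n : ℕ) (G : SimpleGraph (Fin n)) : Prop :=
  ∀ T : Set (Fin n), T.Nonempty →
    (∑ v ∈ (Set.toFinite T).toFinset, (deg G v : ℝ)) / (T.ncard : ℝ) ≥
      (minDeg G : ℝ) + min ((T.ncard : ℝ) - 1) ((Real.log n) ^ 2)

/-- `G` is `p`-pseudorandom. -/
def IsPseudorandom (n : ℕ) (G : SimpleGraph (Fin n)) (p : ℝ) : Prop :=
  IsJumbled G p (2 * Real.sqrt (n * p * (1 - p))) ∧
  (∀ S T : Set (Fin n), Disjoint S T →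
    ((1 / (S.ncard : ℝ) + 1 / (T.ncard : ℝ)) * Real.log n / p ≥ 7 / 2 →
      (eBtw G S T : ℝ) ≤ 2 * ((S.ncard : ℝ) + (T.ncard : ℝ)) * Real.log n) ∧
    ((1 / (S.ncard : ℝ) + 1 / (T.ncard : ℝ)) * Real.log n / p ≤ 7 / 2 →
      (eBtw G S T : ℝ) ≤ 7 * (S.ncard : ℝ) * (T.ncard : ℝ) * p)) ∧
  (∀ S : Set (Fin n),
    (Real.log n / ((S.ncard : ℝ) * p) ≥ 7 / 4 → (eIn G S : ℝ) ≤ 2 * (S.ncard : ℝ) * Real.log n) ∧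
    (Real.log n / ((S.ncard : ℝ) * p) ≤ 7 / 4 → (eIn G S : ℝ) ≤ 7 * (S.ncard : ℝ) ^ 2 * p / 2)) ∧
  ((n : ℝ) * p - 2 * Real.sqrt ((n : ℝ) * p * Real.log n) ≤ (minDeg G : ℝ) ∧
    (minDeg G : ℝ) ≤ (n : ℝ) * p - 200 * Real.sqrt ((n : ℝ) * p * (1 - p)) ∧
    (maxDeg G : ℝ) ≤ (n : ℝ) * p + 2 * Real.sqrt ((n : ℝ) * p * Real.log n)) ∧
  StronglyTwoJumping n G

/-- `G` is `u`-jumping. -/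
def IsJumping (n : ℕ) (G : SimpleGraph (Fin n)) (u : ℝ) : Prop :=
  ∃ x₀ : Fin n, deg G x₀ = minDeg G ∧
    ∀ x : Fin n, x ≠ x₀ → (deg G x : ℝ) ≥ (minDeg G : ℝ) + u

/-- `C` is a Hamilton cycle (on the whole vertex set `Fin n`). -/
def IsHamCycle {n : ℕ} (C : SimpleGraph (Fin n)) : Prop :=
  ∃ (v : Fin n) (w : C.Walk v v), w.IsHamiltonianCycle ∧ C.edgeSet = {e | e ∈ w.edges}

/-- `G` has property `H`. -/
def HasPropertyH (n : ℕ) (G : SimpleGraph (Fin n)) : Prop :=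
  ∃ HC : Fin (minDeg G / 2) → SimpleGraph (Fin n),
    (∀ i, HC i ≤ G ∧ IsHamCycle (HC i)) ∧
    (∀ i j, i ≠ j → Disjoint (HC i).edgeSet (HC j).edgeSet) ∧
    (Odd (minDeg G) →
      ∃ M : SimpleGraph (Fin n), M ≤ G ∧ (∀ v, deg M v ≤ 1) ∧
        M.edgeSet.ncard = n / 2 ∧ ∀ i, Disjoint M.edgeSet (HC i).edgeSet)

/-- Probability of the event `A` under the binomial random graph `G_{n,p}`. -/
noncomputable def gnpProb (n : ℕ) (p : ℝ) (A : SimpleGraph (Fin n) → Prop) : ℝ :=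
  ∑ G : SimpleGraph (Fin n),
    if A G then p ^ G.edgeSet.ncard * (1 - p) ^ (n.choose 2 - G.edgeSet.ncard) else 0


/-- Number of cycles of a 2-regular graph = number of connected components. -/
noncomputable def numCycles {V : Type} (F : SimpleGraph V) : ℕ := Nat.card F.ConnectedComponent

/-- `N` is a perfect matching on the whole vertex set. -/
def IsPerfectMatchingGraph {n : ℕ} (N : SimpleGraph (Fin n)) : Prop :=
  ∀ v, ((N.neighborSet v).ncard) = 1

/-- `N` is a perfect pseudomatching: one vertex of degree 2, all others of degree 1. -/
def IsPerfectPseudomatching {n : ℕ} (N : SimpleGraph (Fin n)) : Prop :=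
  ∃ w, ((N.neighborSet w).ncard) = 2 ∧ ∀ v, v ≠ w → ((N.neighborSet v).ncard) = 1

/-- A set of edges forms a matching (no two distinct edges share a vertex). -/
def IsMatchingSet {n : ℕ} (E : Set (Sym2 (Fin n))) : Prop :=
  ∀ e ∈ E, ∀ f ∈ E, e ≠ f → ∀ v : Fin n, v ∈ e → v ∉ f

/-- Number of cycles (orbits, including fixed points) of a permutation. -/
noncomputable def cycleCount {α : Type} (σ : Equiv.Perm α) : ℕ :=
  Nat.card (Quotient (⟨σ.SameCycle,
    ⟨fun x => Equiv.Perm.SameCycle.refl σ x, fun h => h.symm, fun h h' => h.trans h'⟩⟩ : Setoid α))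

/-- Edges of the bipartite graph given by the relation `R` between `S` and `T`. -/
noncomputable def eBip {n : ℕ} (R : Fin n → Fin n → Prop) (S T : Set (Fin n)) : ℕ :=
  {q : Fin n × Fin n | q.1 ∈ S ∧ q.2 ∈ T ∧ R q.1 q.2}.ncard

/-- One rotation of a path (represented as a list of vertices), with new edge from `H`
and pivot in `Q`. -/
def RotStep {V : Type} (H : SimpleGraph V) (Q : Set V) (l l' : List V) : Prop :=
  ∃ (x : V) (a : List V) (p : V) (b : List V),
    l = (x :: a) ++ p :: b ∧ l' = (x :: a).reverse ++ p :: b ∧ p ∈ Q ∧ H.Adj x p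

/-- `v` is `(H, Q, τ)`-reachable from the path `l`. -/
def ReachableVert {V : Type} (H : SimpleGraph V) (Q : Set V) (τ : ℕ) (l : List V) (v : V) : Prop :=
  ∃ (k : ℕ) (f : ℕ → List V), k ≤ τ ∧ f 0 = l ∧
    (∀ i < k, RotStep H Q (f i) (f (i + 1))) ∧ (f k).head? = some v

/-- External neighbourhood. -/
def extNbhd {V : Type} (H : SimpleGraph V) (S : Set V) : Set V :=
  (⋃ x ∈ S, H.neighborSet x) \ S

end EDHC

namespace HamCover
open Finset

section Lists
variable {V : Type} [DecidableEq V]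

/-- The set of edges joining consecutive vertices of a list. -/
def pathEdges : List V → Finset (Sym2 V)
  | a :: b :: l => insert s(a, b) (pathEdges (b :: l))
  | _ => ∅

/-- The edges of the closed walk obtained by returning from the last vertex to the first one. -/
def cycEdges : List V → Finset (Sym2 V)
  | [] => ∅
  | a :: l => pathEdges (a :: l ++ [a])

@[simp] lemma pathEdges_nil : pathEdges ([] : List V) = ∅ := rfl
@[simp] lemma pathEdges_singleton (a : V) : pathEdges [a] = ∅ := rfl
@[simp] lemma pathEdges_cons_cons (a b : V) (l : List V) :
    pathEdges (a :: b :: l) = insert s(a, b) (pathEdges (b :: l)) := rfl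

lemma pathEdges_append_cons (l₁ : List V) (a : V) (l₂ : List V) :
    pathEdges (l₁ ++ a :: l₂) = pathEdges (l₁ ++ [a]) ∪ pathEdges (a :: l₂) := by
  induction l₁ with
  | nil => simp
  | cons c l₁ ih =>
    cases l₁ with
    | nil => simp
    | cons d l₁ =>
      simp only [List.cons_append, pathEdges_cons_cons] at ih ⊢
      rw [ih, Finset.insert_union]

lemma pathEdges_append_cons_cons (l₁ : List V) (a b : V) (l₂ : List V) :
    pathEdges (l₁ ++ a :: b :: l₂) =
      insert s(a, b) (pathEdges (l₁ ++ [a]) ∪ pathEdges (b :: l₂)) := by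
  rw [pathEdges_append_cons, pathEdges_cons_cons, Finset.union_insert]

lemma pathEdges_reverse (l : List V) : pathEdges l.reverse = pathEdges l := by
  induction l with
  | nil => simp
  | cons a l ih =>
    cases l with
    | nil => simp
    | cons b l =>
      rw [List.reverse_cons, List.reverse_cons, List.append_assoc, List.singleton_append,
        pathEdges_append_cons_cons, ← List.reverse_cons, ih]
      simp [Sym2.eq_swap]

lemma mem_pathEdges_iff {e : Sym2 V} {l : List V} :
    e ∈ pathEdges l ↔ ∃ u a b v, l = u ++ a :: b :: v ∧ e = s(a, b) := by
  constructor
  · induction l with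
    | nil => simp
    | cons a l ih =>
      cases l with
      | nil => simp
      | cons b l =>
        simp only [pathEdges_cons_cons, Finset.mem_insert]
        rintro (h | h)
        · exact ⟨[], a, b, l, rfl, h⟩
        · obtain ⟨u, c, d, v, h1, h2⟩ := ih h
          exact ⟨a :: u, c, d, v, by rw [h1]; rfl, h2⟩
  · rintro ⟨u, a, b, v, rfl, rfl⟩
    rw [pathEdges_append_cons_cons]
    simp

lemma mem_of_mem_pathEdges {e : Sym2 V} {l : List V} (h : e ∈ pathEdges l) {v : V} (hv : v ∈ e) :
    v ∈ l := by
  obtain ⟨u, a, b, w, rfl, rfl⟩ := mem_pathEdges_iff.1 h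
  rcases Sym2.mem_iff.1 hv with rfl | rfl <;> simp

lemma pathEdges_subset_append_left (l₁ l₂ : List V) : pathEdges l₁ ⊆ pathEdges (l₁ ++ l₂) := by
  intro e he
  obtain ⟨u, a, b, v, rfl, rfl⟩ := mem_pathEdges_iff.1 he
  exact mem_pathEdges_iff.2 ⟨u, a, b, v ++ l₂, by simp, rfl⟩

lemma pathEdges_subset_append_right (l₁ l₂ : List V) : pathEdges l₂ ⊆ pathEdges (l₁ ++ l₂) := by
  intro e he
  obtain ⟨u, a, b, v, rfl, rfl⟩ := mem_pathEdges_iff.1 he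
  exact mem_pathEdges_iff.2 ⟨l₁ ++ u, a, b, v, by simp, rfl⟩

lemma pathEdges_mono_infix {l₁ l₂ : List V} (h : l₁ <:+: l₂) : pathEdges l₁ ⊆ pathEdges l₂ := by
  obtain ⟨s, t, rfl⟩ := h
  exact (pathEdges_subset_append_right s l₁).trans (pathEdges_subset_append_left (s ++ l₁) t)

lemma card_pathEdges {l : List V} (hl : l.Nodup) : (pathEdges l).card = l.length - 1 := by
  induction l with
  | nil => simp
  | cons a l ih =>
    cases l with
    | nil => simp
    | cons b l =>
      rw [pathEdges_cons_cons, Finset.card_insert_of_notMem, ih (List.nodup_cons.1 hl).2]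
      · simp
      · intro h
        exact (List.nodup_cons.1 hl).1 (mem_of_mem_pathEdges h (Sym2.mem_mk_left a b))

lemma head_nbr_unique {a : V} {l : List V} (hl : (a :: l).Nodup) {w : V}
    (h : s(a, w) ∈ pathEdges (a :: l)) : l.head? = some w := by
  cases l with
  | nil => simp at h
  | cons b l =>
    rw [pathEdges_cons_cons, Finset.mem_insert] at h
    rcases h with h | h
    · simp only [Sym2.eq_iff, true_and] at h
      rcases h with rfl | ⟨rfl, rfl⟩ <;> simp
    · exact absurd (mem_of_mem_pathEdges h (Sym2.mem_mk_left a w)) (List.nodup_cons.1 hl).1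

lemma exists_path_nbrs {l : List V} (hl : l.Nodup) (v : V) :
    ∃ p q, ∀ w, s(v, w) ∈ pathEdges l → w = p ∨ w = q := by
  induction l with
  | nil => exact ⟨v, v, by simp⟩
  | cons a l ih =>
    cases l with
    | nil => exact ⟨v, v, by simp⟩
    | cons b l =>
      by_cases hva : v = a
      · subst hva
        refine ⟨b, b, fun w hw => ?_⟩
        have := head_nbr_unique hl hw
        simp at this
        simp [this]
      by_cases hvb : v = b
      · subst hvb
        refine ⟨a, l.head?.getD a, fun w hw => ?_⟩
        rw [pathEdges_cons_cons, Finset.mem_insert] at hw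
        rcases hw with h | h
        · simp only [Sym2.eq_iff] at h
          rcases h with ⟨rfl, rfl⟩ | ⟨_, rfl⟩ <;> simp
        · right
          rw [head_nbr_unique (List.nodup_cons.1 hl).2 h]
          rfl
      obtain ⟨p, q, h⟩ := ih (List.nodup_cons.1 hl).2
      refine ⟨p, q, fun w hw => h w ?_⟩
      rw [pathEdges_cons_cons, Finset.mem_insert] at hw
      rcases hw with h | h
      · simp only [Sym2.eq_iff] at h
        tauto
      · exact h

lemma cycEdges_cons_append (a b : V) (l : List V) :
    cycEdges (a :: l ++ [b]) = insert s(b, a) (pathEdges (a :: l ++ [b])) := by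
  have : a :: l ++ [b] = a :: (l ++ [b]) := rfl
  rw [this, cycEdges, ← this, List.append_assoc, List.singleton_append,
    pathEdges_append_cons_cons]
  simp

lemma cycEdges_eq_insert {l : List V} {a b : V} (ha : l.head? = some a) (hb : l.getLast? = some b) :
    cycEdges l = insert s(b, a) (pathEdges l) := by
  cases l with
  | nil => simp at ha
  | cons c l =>
    simp at ha
    subst ha
    rcases List.eq_nil_or_concat l with rfl | ⟨l', d, rfl⟩
    · simp at hb
      subst hb
      simp [cycEdges]
    · have : d = b := by simpa [List.getLast?_cons] using hb
      subst this
      simpa using cycEdges_cons_append c d l'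

lemma pathEdges_subset_cycEdges (l : List V) : pathEdges l ⊆ cycEdges l := by
  cases l with
  | nil => simp
  | cons a l => exact pathEdges_subset_append_left (a :: l) [a]

lemma cycEdges_append_comm (u v : List V) : cycEdges (u ++ v) = cycEdges (v ++ u) := by
  induction u generalizing v with
  | nil => simp
  | cons a u ih =>
    have key : ∀ l : List V, cycEdges (a :: l) = cycEdges (l ++ [a]) := by
      intro l
      cases l with
      | nil => rfl
      | cons b l =>
        rw [cycEdges_cons_append]
        simp [cycEdges]
    rw [List.cons_append, key, List.append_assoc, ih, List.append_assoc, List.singleton_append]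

/-- A closed walk can be opened at any of its edges. -/
lemma exists_open_at {l : List V} {e : Sym2 V} (he : e ∈ cycEdges l) :
    ∃ l₁ : List V, l₁.Perm l ∧ cycEdges l₁ = cycEdges l ∧
      ∃ a b, l₁.head? = some a ∧ l₁.getLast? = some b ∧ e = s(b, a) := by
  cases h : l.head? with
  | none => simp at h; simp [h, cycEdges] at he
  | some a =>
    cases h' : l.getLast? with
    | none => simp at h'; simp [h', cycEdges] at he
    | some b =>
      rw [cycEdges_eq_insert h h', Finset.mem_insert] at he
      rcases he with he | he
      · exact ⟨l, List.Perm.refl l, rfl, a, b, h, h', he⟩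
      · obtain ⟨u, c, d, v, rfl, rfl⟩ := mem_pathEdges_iff.1 he
        refine ⟨d :: v ++ (u ++ [c]), ?_, ?_, d, c, by simp, by simp [List.getLast?_append,
          List.getLast?_cons], rfl⟩
        · have : u ++ c :: d :: v = (u ++ [c]) ++ d :: v := by simp
          rw [this]
          exact List.perm_append_comm
        · rw [cycEdges_append_comm]
          simp

lemma closing_notMem_pathEdges {l : List V} (hl : l.Nodup) (h3 : 3 ≤ l.length) {a b : V}
    (ha : l.head? = some a) (hb : l.getLast? = some b) : s(b, a) ∉ pathEdges l := by
  intro h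
  match l, h3 with
  | c :: d :: f :: l, _ =>
    simp at ha
    subst ha
    rw [Sym2.eq_swap] at h
    have h1 := head_nbr_unique hl h
    simp at h1
    subst h1
    have h2 : d ∈ f :: l := by
      have := List.mem_of_getLast? (l := f :: l) (a := d) (by simpa [List.getLast?_cons] using hb)
      exact this
    simp only [List.nodup_cons] at hl
    exact hl.2.1 h2

lemma card_cycEdges {l : List V} (hl : l.Nodup) (h3 : 3 ≤ l.length) :
    (cycEdges l).card = l.length := by
  cases h : l.head? with
  | none => simp at h; simp [h] at h3
  | some a =>
    cases h' : l.getLast? with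
    | none => simp at h'; simp [h'] at h3
    | some b =>
      rw [cycEdges_eq_insert h h', Finset.card_insert_of_notMem
        (closing_notMem_pathEdges hl h3 h h'), card_pathEdges hl]
      omega

lemma mem_of_mem_cycEdges {e : Sym2 V} {l : List V} (h : e ∈ cycEdges l) {v : V} (hv : v ∈ e) :
    v ∈ l := by
  cases l with
  | nil => simp [cycEdges] at h
  | cons a l => simpa [or_comm] using mem_of_mem_pathEdges h hv

lemma exists_cyc_nbrs {l : List V} (hl : l.Nodup) (v : V) :
    ∃ p q, ∀ w, s(v, w) ∈ cycEdges l → w = p ∨ w = q := by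
  by_cases hv : v ∈ l
  · obtain ⟨s, t, rfl⟩ := List.append_of_mem hv
    rw [cycEdges_append_comm]
    have hl' : (v :: t ++ s).Nodup := List.perm_append_comm.nodup_iff.1 hl
    rcases List.eq_nil_or_concat (t ++ s) with h | ⟨l', d, h⟩
    · refine ⟨v, v, fun w hw => ?_⟩
      simp only [List.cons_append, h, cycEdges] at hw
      simp at hw
      exact Or.inl hw
    · refine ⟨d, (t ++ s).head?.getD v, fun w hw => ?_⟩
      rw [List.cons_append, cycEdges_eq_insert (a := v) (b := d) (by simp)
        (by rw [h]; simp [List.getLast?_cons]), Finset.mem_insert] at hw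
      rcases hw with hw | hw
      · simp only [Sym2.eq_iff] at hw
        rcases hw with ⟨rfl, rfl⟩ | ⟨_, rfl⟩ <;> simp
      · have h0 : (t ++ s).head? = some w := head_nbr_unique hl' hw
        exact Or.inr (by simp [h0])
  · exact ⟨v, v, fun w hw => absurd (mem_of_mem_cycEdges hw (Sym2.mem_mk_left v w)) hv⟩

lemma not_isDiag_of_mem_cycEdges {l : List V} (hl : l.Nodup) (h2 : 2 ≤ l.length) {e : Sym2 V}
    (h : e ∈ cycEdges l) : ¬ e.IsDiag := by
  obtain ⟨l₁, hp, -, a, b, ha, hb, rfl⟩ := exists_open_at h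
  rw [← hp.length_eq] at h2
  have hl₁ := hp.nodup_iff.2 hl
  match l₁, h2 with
  | c :: d :: l, _ =>
    simp at ha
    subst ha
    have h2 : b ∈ d :: l := by
      have := List.mem_of_getLast? (l := d :: l) (a := b) (by simpa [List.getLast?_cons] using hb)
      exact this
    simp only [Sym2.mk_isDiag_iff]
    rintro rfl
    exact (List.nodup_cons.1 hl₁).1 h2

end Lists

section Rotations
variable {V : Type} [DecidableEq V]

/-- `nb R v` is the neighbourhood of `v` as a finset. -/
noncomputable def nb [Fintype V] (R : SimpleGraph V) (v : V) : Finset V := {w | R.Adj v w}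

/-- `nbs R S` is the union of the neighbourhoods of the vertices of `S`. -/
noncomputable def nbs [Fintype V] (R : SimpleGraph V) (S : Finset V) : Finset V := S.biUnion (nb R)

@[simp] lemma mem_nb [Fintype V] {R : SimpleGraph V} {v w : V} : w ∈ nb R v ↔ R.Adj v w := by
  simp [nb]

@[simp] lemma mem_nbs [Fintype V] {R : SimpleGraph V} {S : Finset V} {w : V} :
    w ∈ nbs R S ↔ ∃ v ∈ S, R.Adj v w := by
  simp [nbs]

/-- `l'` lists the same vertices as `l` and its edge set arises from that of `l` by exchanging at
most `k` edges meeting `X` for edges of `R`. -/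
structure Exch (k : ℕ) (X : Finset V) (R : SimpleGraph V) (l l' : List V) : Prop where
  perm : l'.Perm l
  card : (pathEdges l \ pathEdges l').card ≤ k
  drop : ∀ e ∈ pathEdges l \ pathEdges l', ∃ y ∈ X, y ∈ e
  add : ∀ e ∈ pathEdges l' \ pathEdges l, e ∈ R.edgeSet

lemma Exch.refl (k : ℕ) (X : Finset V) (R : SimpleGraph V) (l : List V) : Exch k X R l l :=
  ⟨List.Perm.refl l, by simp, by simp, by simp⟩

lemma Exch.trans {k₁ k₂ : ℕ} {X : Finset V} {R : SimpleGraph V} {l l' l'' : List V}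
    (h₁ : Exch k₁ X R l l') (h₂ : Exch k₂ X R l' l'') : Exch (k₁ + k₂) X R l l'' where
  perm := h₂.perm.trans h₁.perm
  card := by
    refine (Finset.card_le_card (t := (pathEdges l \ pathEdges l') ∪ (pathEdges l' \ pathEdges l''))
      ?_).trans ((Finset.card_union_le _ _).trans (add_le_add h₁.card h₂.card))
    intro e
    simp only [mem_sdiff, mem_union]
    tauto
  drop e he := by
    rw [mem_sdiff] at he
    by_cases h : e ∈ pathEdges l'
    · exact h₂.drop e (mem_sdiff.2 ⟨h, he.2⟩)
    · exact h₁.drop e (mem_sdiff.2 ⟨he.1, h⟩)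
  add e he := by
    rw [mem_sdiff] at he
    by_cases h : e ∈ pathEdges l'
    · exact h₁.add e (mem_sdiff.2 ⟨h, he.2⟩)
    · exact h₂.add e (mem_sdiff.2 ⟨he.1, h⟩)

lemma Exch.mono {k₁ k₂ : ℕ} {X Y : Finset V} {R : SimpleGraph V} {l l' : List V}
    (h : Exch k₁ X R l l') (hk : k₁ ≤ k₂) (hX : X ⊆ Y) : Exch k₂ Y R l l' where
  perm := h.perm
  card := h.card.trans hk
  drop e he := let ⟨y, hy, hye⟩ := h.drop e he; ⟨y, hX hy, hye⟩
  add := h.add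

lemma Exch.reverse_right {k : ℕ} {X : Finset V} {R : SimpleGraph V} {l l' : List V}
    (h : Exch k X R l l') : Exch k X R l l'.reverse where
  perm := (List.reverse_perm l').trans h.perm
  card := by rw [pathEdges_reverse]; exact h.card
  drop := by rw [pathEdges_reverse]; exact h.drop
  add := by rw [pathEdges_reverse]; exact h.add

lemma Exch.reverse_left {k : ℕ} {X : Finset V} {R : SimpleGraph V} {l l' : List V}
    (h : Exch k X R l l') : Exch k X R l.reverse l' where
  perm := h.perm.trans (List.reverse_perm l).symm
  card := by rw [pathEdges_reverse]; exact h.card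
  drop := by rw [pathEdges_reverse]; exact h.drop
  add := by rw [pathEdges_reverse]; exact h.add

lemma pathEdges_append {l₁ l₂ : List V} {a b : V} (ha : l₁.getLast? = some a)
    (hb : l₂.head? = some b) :
    pathEdges (l₁ ++ l₂) = insert s(a, b) (pathEdges l₁ ∪ pathEdges l₂) := by
  rcases List.eq_nil_or_concat l₁ with rfl | ⟨l, c, rfl⟩
  · simp at ha
  · cases l₂ with
    | nil => simp at hb
    | cons d l₂ =>
      simp at ha hb
      subst ha hb
      simp [pathEdges_append_cons_cons]

lemma Exch.append_right {k : ℕ} {X : Finset V} {R : SimpleGraph V} {l l' : List V}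
    (h : Exch k X R l l') (hlast : l'.getLast? = l.getLast?) (l₂ : List V) :
    Exch k X R (l ++ l₂) (l' ++ l₂) := by
  have key : ∀ e, e ∈ pathEdges (l ++ l₂) ∧ e ∉ pathEdges (l' ++ l₂) →
      e ∈ pathEdges l ∧ e ∉ pathEdges l' := by
    rintro e ⟨h1, h2⟩
    refine ⟨?_, fun h => h2 (pathEdges_subset_append_left _ _ h)⟩
    cases ha : l.getLast? with
    | none =>
      simp at ha
      simp [ha] at hlast
      simp [ha, hlast] at h1 h2
      exact absurd h1 h2
    | some a =>
      cases hb : l₂.head? with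
      | none => simp at hb; simpa [hb] using h1
      | some b =>
        rw [pathEdges_append ha hb] at h1
        rw [pathEdges_append (hlast.trans ha) hb] at h2
        simp only [Finset.mem_insert, Finset.mem_union] at h1 h2
        tauto
  have key2 : ∀ e, e ∈ pathEdges (l' ++ l₂) ∧ e ∉ pathEdges (l ++ l₂) →
      e ∈ pathEdges l' ∧ e ∉ pathEdges l := by
    rintro e ⟨h1, h2⟩
    refine ⟨?_, fun h => h2 (pathEdges_subset_append_left _ _ h)⟩
    cases ha : l.getLast? with
    | none =>
      simp at ha
      simp [ha] at hlast
      simp [ha, hlast] at h1 h2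
      exact absurd h1 h2
    | some a =>
      cases hb : l₂.head? with
      | none => simp at hb; simpa [hb] using h1
      | some b =>
        rw [pathEdges_append ha hb] at h2
        rw [pathEdges_append (hlast.trans ha) hb] at h1
        simp only [Finset.mem_insert, Finset.mem_union] at h1 h2
        tauto
  refine ⟨h.perm.append_right l₂, (Finset.card_le_card ?_).trans h.card, fun e he => ?_,
    fun e he => ?_⟩
  · intro e
    simpa only [mem_sdiff] using key e
  · exact h.drop e (by simpa only [mem_sdiff] using key e (mem_sdiff.1 he))
  · exact h.add e (by simpa only [mem_sdiff] using key2 e (mem_sdiff.1 he))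

/-- One rotation along an edge of `R` to a pivot in `U`, dropping an edge of `E`. -/
def Rotates (R : SimpleGraph V) (U : Finset V) (E : Finset (Sym2 V)) (l l' : List V) : Prop :=
  ∃ (a : List V) (x y p : V) (b : List V), l = a ++ y :: p :: b ∧ l.head? = some x ∧
    l' = y :: a.reverse ++ p :: b ∧ p ∈ U ∧ R.Adj x p ∧ s(y, p) ∈ E

/-- Lists reachable from `l₀` by at most `k` rotations. -/
def rotFamily (R : SimpleGraph V) (U : Finset V) (l₀ : List V) : ℕ → Set (List V)
  | 0 => {l₀}
  | k + 1 => rotFamily R U l₀ k ∪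
      {l' | ∃ l ∈ rotFamily R U l₀ k, Rotates R U (pathEdges l₀) l l'}

lemma Rotates.edges {R : SimpleGraph V} {U : Finset V} {E : Finset (Sym2 V)} {l l' : List V}
    (h : Rotates R U E l l') : ∃ x y p, l.head? = some x ∧ l'.head? = some y ∧ p ∈ U ∧
      R.Adj x p ∧ s(y, p) ∈ E ∧ l'.Perm l ∧ l'.getLast? = l.getLast? ∧
      pathEdges l' ⊆ insert s(x, p) (pathEdges l) ∧
      pathEdges l \ pathEdges l' ⊆ {s(y, p)} := by
  obtain ⟨a, x, y, p, b, rfl, hx, rfl, hp, hR, hE⟩ := h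
  have e1 : a ++ y :: p :: b = (a ++ [y]) ++ (p :: b) := by simp
  have e2 : y :: a.reverse ++ p :: b = (a ++ [y]).reverse ++ p :: b := by simp
  have h1 : pathEdges (a ++ y :: p :: b) =
      insert s(y, p) (pathEdges (a ++ [y]) ∪ pathEdges (p :: b)) := by
    rw [e1]; exact pathEdges_append (by simp) (by simp)
  have h2 : pathEdges (y :: a.reverse ++ p :: b) =
      insert s(x, p) (pathEdges (a ++ [y]) ∪ pathEdges (p :: b)) := by
    rw [e2, pathEdges_append (a := x) (b := p) _ (by simp), pathEdges_reverse]
    rw [List.getLast?_reverse]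
    cases a <;> simpa using hx
  refine ⟨x, y, p, hx, by simp, hp, hR, hE, ?_, ?_, ?_, ?_⟩
  · rw [e1, e2]
    exact (List.reverse_perm _).append_right _
  · simp [List.getLast?_append, List.getLast?_cons]
  · rw [h1, h2]
    intro e
    simp only [Finset.mem_insert]
    tauto
  · rw [h1, h2]
    intro e
    simp only [Finset.mem_insert, mem_sdiff, mem_singleton]
    tauto

lemma rotFamily_mono (R : SimpleGraph V) (U : Finset V) (l₀ : List V) (k : ℕ) :
    rotFamily R U l₀ k ⊆ rotFamily R U l₀ (k + 1) := Set.subset_union_left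

lemma rotFamily_exch {R : SimpleGraph V} {U : Finset V} {l₀ : List V} {k : ℕ} {l : List V}
    (h : l ∈ rotFamily R U l₀ k) : Exch k U R l₀ l ∧ l.getLast? = l₀.getLast? := by
  induction k generalizing l with
  | zero =>
    rw [show l = l₀ from h]
    exact ⟨Exch.refl _ _ _ _, rfl⟩
  | succ k ih =>
    rcases h with h | ⟨l₁, h1, h2⟩
    · exact ⟨(ih h).1.mono (Nat.le_succ k) subset_rfl, (ih h).2⟩
    · obtain ⟨x, y, p, hx, hy, hp, hR, hE, hperm, hlast, hadd, hdrop⟩ := h2.edges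
      refine ⟨(ih h1).1.trans ⟨hperm, ?_, ?_, ?_⟩, hlast.trans (ih h1).2⟩
      · simpa using Finset.card_le_card hdrop
      · intro e he
        rw [mem_singleton.1 (hdrop he)]
        exact ⟨p, hp, Sym2.mem_mk_right y p⟩
      · intro e he
        rw [mem_sdiff] at he
        have := hadd he.1
        rw [Finset.mem_insert] at this
        rcases this with rfl | h
        · exact hR
        · exact absurd h he.2

variable [Fintype V]

/-- First vertices of the lists in `rotFamily`. -/
noncomputable def rotHeads (R : SimpleGraph V) (U : Finset V) (l₀ : List V) (k : ℕ) : Finset V :=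
  {x | ∃ l ∈ rotFamily R U l₀ k, l.head? = some x}

lemma mem_rotHeads {R : SimpleGraph V} {U : Finset V} {l₀ : List V} {k : ℕ} {x : V} :
    x ∈ rotHeads R U l₀ k ↔ ∃ l ∈ rotFamily R U l₀ k, l.head? = some x := by
  simp [rotHeads]

lemma rotHeads_mono (R : SimpleGraph V) (U : Finset V) (l₀ : List V) (k : ℕ) :
    rotHeads R U l₀ k ⊆ rotHeads R U l₀ (k + 1) := by
  intro x hx
  obtain ⟨l, hl, h⟩ := mem_rotHeads.1 hx
  exact mem_rotHeads.2 ⟨l, rotFamily_mono _ _ _ _ hl, h⟩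

lemma rotFamily_new_edge {R : SimpleGraph V} {U : Finset V} {l₀ : List V} {k : ℕ} {l : List V}
    (h : l ∈ rotFamily R U l₀ k) {y w : V} (he : s(y, w) ∈ pathEdges l)
    (he' : s(y, w) ∉ pathEdges l₀) :
    y ∈ rotHeads R U l₀ k ∨ ∃ z ∈ rotHeads R U l₀ k, s(z, y) ∈ pathEdges l₀ := by
  induction k generalizing l with
  | zero =>
    rw [show l = l₀ from h] at he
    exact absurd he he'
  | succ k ih =>
    have old : ∀ {l}, l ∈ rotFamily R U l₀ k → s(y, w) ∈ pathEdges l →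
        y ∈ rotHeads R U l₀ (k + 1) ∨ ∃ z ∈ rotHeads R U l₀ (k + 1), s(z, y) ∈ pathEdges l₀ := by
      intro l hl hel
      rcases ih hl hel with h | ⟨z, hz, h⟩
      · exact Or.inl (rotHeads_mono _ _ _ _ h)
      · exact Or.inr ⟨z, rotHeads_mono _ _ _ _ hz, h⟩
    rcases h with h | ⟨l₁, h1, h2⟩
    · exact old h he
    · obtain ⟨x, z, p, hx, hz, hp, hR, hE, hperm, hlast, hadd, hdrop⟩ := h2.edges
      have hxm : x ∈ rotHeads R U l₀ (k + 1) :=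
        rotHeads_mono _ _ _ _ (mem_rotHeads.2 ⟨l₁, h1, hx⟩)
      have hzm : z ∈ rotHeads R U l₀ (k + 1) := mem_rotHeads.2 ⟨l, Or.inr ⟨l₁, h1, h2⟩, hz⟩
      have := hadd he
      rw [Finset.mem_insert] at this
      rcases this with h | h
      · rw [Sym2.eq_iff] at h
        rcases h with ⟨rfl, rfl⟩ | ⟨rfl, rfl⟩
        · exact Or.inl hxm
        · exact Or.inr ⟨z, hzm, hE⟩
      · exact old h1 h

lemma rotHeads_pivots {R : SimpleGraph V} {U : Finset V} {l₀ : List V} (hU : ∀ y ∈ U, y ∈ l₀)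
    {k : ℕ} {p : V} (hp : p ∈ nbs R (rotHeads R U l₀ k) ∩ U) :
    ∃ z ∈ rotHeads R U l₀ (k + 1), p = z ∨ s(z, p) ∈ pathEdges l₀ := by
  rw [mem_inter, mem_nbs] at hp
  obtain ⟨⟨x, hx, hxp⟩, hpU⟩ := hp
  obtain ⟨l, hl, hlx⟩ := mem_rotHeads.1 hx
  have hpl : p ∈ l := (rotFamily_exch hl).1.perm.mem_iff.2 (hU p hpU)
  obtain ⟨a', b, rfl⟩ := List.append_of_mem hpl
  rcases List.eq_nil_or_concat a' with rfl | ⟨a, y, rfl⟩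
  · simp at hlx
    exact absurd hlx.symm hxp.ne
  have e : a.concat y ++ p :: b = a ++ y :: p :: b := by simp
  by_cases hE : s(y, p) ∈ pathEdges l₀
  · refine ⟨y, mem_rotHeads.2 ⟨y :: a.reverse ++ p :: b, Or.inr ⟨_, hl, a, x, y, p, b, e, hlx, rfl,
      hpU, hxp, hE⟩, by simp⟩, Or.inr hE⟩
  · have h1 : s(p, y) ∈ pathEdges (a.concat y ++ p :: b) := by
      rw [e, pathEdges_append_cons_cons, Sym2.eq_swap]; simp
    rw [Sym2.eq_swap] at hE
    rcases rotFamily_new_edge hl h1 hE with h | ⟨z, hz, h⟩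
    · exact ⟨p, rotHeads_mono _ _ _ _ h, Or.inl rfl⟩
    · exact ⟨z, rotHeads_mono _ _ _ _ hz, Or.inr h⟩

lemma card_le_three_mul {l₀ : List V} (hl : l₀.Nodup) (S P : Finset V)
    (h : ∀ p ∈ P, ∃ z ∈ S, p = z ∨ s(z, p) ∈ pathEdges l₀) : P.card ≤ 3 * S.card := by
  choose f g hfg using exists_path_nbrs hl
  have : P ⊆ S.biUnion (fun z => {z, f z, g z}) := by
    intro p hp
    obtain ⟨z, hz, h⟩ := h p hp
    rw [mem_biUnion]
    refine ⟨z, hz, ?_⟩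
    simp only [Finset.mem_insert, mem_singleton]
    rcases h with h | h
    · exact Or.inl h
    · exact Or.inr (hfg z p h)
  calc P.card ≤ _ := Finset.card_le_card this
    _ ≤ S.card * 3 := Finset.card_biUnion_le_card_mul _ _ _ (fun z _ => Finset.card_le_three)
    _ = _ := mul_comm _ _

lemma rotHeads_origin {R : SimpleGraph V} {U : Finset V} {l₀ : List V} {x₀ : V}
    (hx₀ : l₀.head? = some x₀) {k : ℕ} {z : V} (hz : z ∈ rotHeads R U l₀ k) :
    z = x₀ ∨ ∃ y ∈ U, s(z, y) ∈ pathEdges l₀ := by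
  obtain ⟨l, hl, h⟩ := mem_rotHeads.1 hz
  clear hz
  induction k generalizing l with
  | zero =>
    rw [show l = l₀ from hl, hx₀] at h
    exact Or.inl (Option.some.inj h).symm
  | succ k ih =>
    rcases hl with hl | ⟨l₁, h1, h2⟩
    · exact ih l hl h
    · obtain ⟨x, y, p, hx, hy, hp, hR, hE, -⟩ := h2.edges
      rw [hy] at h
      rw [← Option.some.inj h]
      exact Or.inr ⟨p, hp, hE⟩

/-- Under expansion into `U`, logarithmically many rotations produce many possible first vertices. -/
lemma exists_many_heads {R : SimpleGraph V} {U : Finset V} {l₀ : List V} {x₀ : V} (hl : l₀.Nodup)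
    (hx₀ : l₀.head? = some x₀) (hU : ∀ y ∈ U, y ∈ l₀) {m t : ℕ} (hmt : m < 2 ^ t)
    (hexp : ∀ S : Finset V, S.Nonempty → S.card ≤ m →
      (∀ z ∈ S, z = x₀ ∨ ∃ y ∈ U, s(z, y) ∈ pathEdges l₀) → 10 * S.card ≤ (nbs R S ∩ U).card) :
    ∃ S : Finset V, m < S.card ∧ ∀ x ∈ S, ∃ l, Exch t U R l₀ l ∧
      l.getLast? = l₀.getLast? ∧ l.head? = some x := by
  have hne : ∀ k, (rotHeads R U l₀ k).Nonempty := by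
    intro k
    induction k with
    | zero => exact ⟨x₀, mem_rotHeads.2 ⟨l₀, rfl, hx₀⟩⟩
    | succ k ih => exact ih.mono (rotHeads_mono _ _ _ _)
  have hgrow : ∀ k, m < (rotHeads R U l₀ k).card ∨ 2 ^ k ≤ (rotHeads R U l₀ k).card := by
    intro k
    induction k with
    | zero => exact Or.inr (Finset.card_pos.2 (hne 0))
    | succ k ih =>
      have hmono := Finset.card_le_card (rotHeads_mono R U l₀ k)
      by_cases hk : m < (rotHeads R U l₀ k).card
      · exact Or.inl (hk.trans_le hmono)
      · right
        have h1 := hexp _ (hne k) (not_lt.1 hk) (fun z hz => rotHeads_origin hx₀ hz)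
        have h2 := card_le_three_mul hl (rotHeads R U l₀ (k + 1)) _
          (fun p hp => rotHeads_pivots (R := R) hU hp)
        have h3 := ih.resolve_left hk
        rw [pow_succ]
        omega
  refine ⟨rotHeads R U l₀ t, (hgrow t).elim id (fun h => hmt.trans_le h), fun x hx => ?_⟩
  obtain ⟨l, hl, h⟩ := mem_rotHeads.1 hx
  exact ⟨l, (rotFamily_exch hl).1, (rotFamily_exch hl).2, h⟩

end Rotations

section Jumbled
variable {V : Type} [DecidableEq V] [Fintype V]

/-- The number of pairs in `A × Y` adjacent in `R`. -/
noncomputable def adjCount (R : SimpleGraph V) (A Y : Finset V) : ℕ := ∑ a ∈ A, (nb R a ∩ Y).card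

lemma adjCount_union_right (R : SimpleGraph V) (A : Finset V) {Y Z : Finset V} (h : Disjoint Y Z) :
    adjCount R A (Y ∪ Z) = adjCount R A Y + adjCount R A Z := by
  rw [adjCount, adjCount, adjCount, ← Finset.sum_add_distrib]
  refine Finset.sum_congr rfl fun a _ => ?_
  rw [Finset.inter_union_distrib_left, Finset.card_union_of_disjoint]
  exact h.mono Finset.inter_subset_right Finset.inter_subset_right

lemma adjCount_union_left (R : SimpleGraph V) {A B : Finset V} (Y : Finset V) (h : Disjoint A B) :
    adjCount R (A ∪ B) Y = adjCount R A Y + adjCount R B Y := Finset.sum_union h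

lemma adjCount_comm (R : SimpleGraph V) (A Y : Finset V) : adjCount R A Y = adjCount R Y A := by
  have h : ∀ A Y : Finset V, adjCount R A Y = ∑ a ∈ A, ∑ y ∈ Y, if R.Adj a y then 1 else 0 := by
    intro A Y
    refine Finset.sum_congr rfl fun a _ => ?_
    rw [Finset.sum_boole, Finset.inter_comm]
    simp only [Nat.cast_id]
    congr 1
    ext y
    simp
  rw [h, h, Finset.sum_comm]
  simp only [R.adj_comm]

lemma adjCount_mono {R G : SimpleGraph V} (h : R ≤ G) (A Y : Finset V) :
    adjCount R A Y ≤ adjCount G A Y := by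
  refine Finset.sum_le_sum fun a _ => Finset.card_le_card ?_
  intro y
  simp only [mem_inter, mem_nb]
  exact fun hy => ⟨h hy.1, hy.2⟩

lemma adjCount_self (G : SimpleGraph V) (S : Finset V) :
    adjCount G S S = 2 * EDHC.eIn G (S : Set V) := by
  let G' : SimpleGraph V :=
    { Adj := fun a b => G.Adj a b ∧ a ∈ S ∧ b ∈ S
      symm := ⟨fun a b h => ⟨h.1.symm, h.2.2, h.2.1⟩⟩
      loopless := ⟨fun a h => h.1.ne rfl⟩ }
  have hE : {e ∈ G.edgeSet | ∀ v ∈ e, v ∈ (S : Set V)} = G'.edgeSet := by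
    ext e
    induction e with
    | h a b => simp [G']
  have h1 := G'.sum_degrees_eq_twice_card_edges
  rw [EDHC.eIn, hE, ← SimpleGraph.coe_edgeFinset, Set.ncard_coe_finset, ← h1, adjCount,
    ← Finset.sum_subset (Finset.subset_univ S)]
  · refine Finset.sum_congr rfl fun a ha => ?_
    rw [← SimpleGraph.card_neighborFinset_eq_degree]
    congr 1
    ext b
    simp [G', ha]
  · intro a _ ha
    rw [← SimpleGraph.card_neighborFinset_eq_degree, Finset.card_eq_zero]
    ext b
    simp [G', ha]

/-- `R` has about the number of adjacencies between sets of vertices that is expected at density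
`p`, up to a jumbledness error `β` and up to `u` missing adjacencies at each vertex. -/
structure Dense (R : SimpleGraph V) (p β u : ℝ) : Prop where
  upper : ∀ A Y : Finset V, (adjCount R A Y : ℝ) ≤
    p * A.card * (A.card + Y.card) + 4 * β * (A.card + Y.card)
  lower : ∀ A Y : Finset V, Disjoint A Y →
    p * A.card * Y.card - 2 * β * (A.card + Y.card) - u * A.card ≤ adjCount R A Y

lemma Dense.of_isJumbled {G R : SimpleGraph V} {p β u : ℝ} (hp : 0 ≤ p) (hβ : 0 ≤ β)
    (hG : EDHC.IsJumbled G p β) (hR : R ≤ G) (hu : ∀ v, ((nb G v \ nb R v).card : ℝ) ≤ u) :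
    Dense R p β u := by
  have hself : ∀ S : Finset V, |(adjCount G S S : ℝ) - p * (S.card * (S.card - 1))| ≤
      2 * β * S.card := by
    intro S
    have := hG S
    rw [Set.ncard_coe_finset] at this
    rw [adjCount_self, abs_le] at *
    push_cast
    constructor <;> nlinarith [this.1, this.2]
  have hdisj : ∀ A Y : Finset V, Disjoint A Y →
      |(adjCount G A Y : ℝ) - p * A.card * Y.card| ≤ 2 * β * (A.card + Y.card) := by
    intro A Y h
    have h1 := hself (A ∪ Y)
    have h2 := hself A
    have h3 := hself Y
    rw [adjCount_union_right _ _ h, adjCount_union_left _ _ h, adjCount_union_left _ _ h,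
      adjCount_comm G Y A, Finset.card_union_of_disjoint h] at h1
    push_cast at h1
    rw [abs_le] at *
    constructor <;> nlinarith [h1.1, h1.2, h2.1, h2.2, h3.1, h3.2]
  constructor
  · intro A Y
    have h0 : (adjCount R A Y : ℝ) ≤ adjCount G A Y := by exact_mod_cast adjCount_mono hR A Y
    have h1 : adjCount G A Y = adjCount G A (Y \ A) + adjCount G A (Y ∩ A) := by
      rw [← adjCount_union_right, Finset.sdiff_union_inter]
      exact Finset.disjoint_sdiff_inter Y A
    have h2 : (adjCount G A (Y ∩ A) : ℝ) ≤ adjCount G A A := by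
      have : adjCount G A (Y ∩ A) ≤ adjCount G A A :=
        Finset.sum_le_sum fun a _ => Finset.card_le_card
          (Finset.inter_subset_inter subset_rfl Finset.inter_subset_right)
      exact_mod_cast this
    have h3 := (abs_le.1 (hself A)).2
    have h4 := (abs_le.1 (hdisj A (Y \ A) Finset.disjoint_sdiff)).2
    have h5 : ((Y \ A).card : ℝ) ≤ Y.card := by
      exact_mod_cast Finset.card_le_card Finset.sdiff_subset
    have h6 : (0 : ℝ) ≤ p * A.card := by positivity
    have h7 := mul_le_mul_of_nonneg_left h5 h6
    have h8 := mul_le_mul_of_nonneg_left h5 hβ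
    have h9 : (0 : ℝ) ≤ β * Y.card := by positivity
    rw [h1] at h0
    push_cast at h0
    nlinarith
  · intro A Y h
    have h1 := (abs_le.1 (hdisj A Y h)).1
    have h2 : (adjCount G A Y : ℝ) ≤ adjCount R A Y + u * A.card := by
      have : ∀ a ∈ A, ((nb G a ∩ Y).card : ℝ) ≤ (nb R a ∩ Y).card + u := by
        intro a _
        have h3 : (nb G a ∩ Y).card ≤ (nb R a ∩ Y).card + (nb G a \ nb R a).card := by
          refine (Finset.card_le_card ?_).trans (Finset.card_union_le _ _)
          intro y
          simp only [mem_inter, mem_union, mem_sdiff]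
          tauto
        have h4 := hu a
        have h5 : ((nb G a ∩ Y).card : ℝ) ≤ (nb R a ∩ Y).card + (nb G a \ nb R a).card := by
          exact_mod_cast h3
        linarith
      have h3 := Finset.sum_le_sum this
      rw [Finset.sum_add_distrib, Finset.sum_const, nsmul_eq_mul] at h3
      rw [adjCount, adjCount]
      push_cast
      linarith
    linarith

/-- Small sets of vertices with many neighbours in `U` expand into `U`. -/
lemma Dense.expand {R : SimpleGraph V} {p β u D : ℝ} (hR : Dense R p β u) (hp : 0 ≤ p) (hβ : 0 ≤ β)
    {m : ℕ} (hD : 11 * p * m + 44 * β < D) {S U : Finset V} (hS : S.Nonempty) (hm : S.card ≤ m)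
    (hdeg : ∀ v ∈ S, D ≤ (nb R v ∩ U).card) : 10 * S.card ≤ (nbs R S ∩ U).card := by
  by_contra! hlt
  have h1 := hR.upper S (nbs R S ∩ U)
  have h2 : D * S.card ≤ adjCount R S (nbs R S ∩ U) := by
    rw [adjCount]
    push_cast
    rw [mul_comm, ← nsmul_eq_mul]
    refine Finset.card_nsmul_le_sum _ _ _ fun v hv => (hdeg v hv).trans ?_
    have : (nb R v ∩ U).card ≤ (nb R v ∩ (nbs R S ∩ U)).card := by
      refine Finset.card_le_card fun w => ?_
      simp only [mem_inter, mem_nb, mem_nbs]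
      exact fun h => ⟨h.1, ⟨v, hv, h.1⟩, h.2⟩
    exact_mod_cast this
  have hs : (0 : ℝ) < S.card := by exact_mod_cast hS.card_pos
  have hm' : (S.card : ℝ) ≤ m := by exact_mod_cast hm
  have hlt' : ((nbs R S ∩ U).card : ℝ) ≤ 10 * S.card := by exact_mod_cast hlt.le
  have h3 : p * S.card * (S.card + (nbs R S ∩ U).card) ≤ p * S.card * (11 * m) := by
    gcongr
    linarith
  have h4 : 4 * β * (S.card + (nbs R S ∩ U).card) ≤ 4 * β * (11 * S.card) := by
    gcongr
    linarith
  nlinarith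

/-- Outside a small exceptional set `B`, vertices keep many neighbours in `X` even after the set of
vertices assigned to `B` has been removed from `X`. -/
lemma exists_core (R : SimpleGraph V) (X : Finset V) (f : V → Finset V) (D : ℝ) (W : ℕ)
    (hW : ∀ B : Finset V, (∀ b ∈ B, ((nb R b ∩ (X \ B.biUnion f)).card : ℝ) < D) → B.card ≤ W →
      B.card + 1 ≤ W) :
    ∃ B : Finset V, B.card ≤ W ∧ (∀ b ∈ B, ((nb R b ∩ (X \ B.biUnion f)).card : ℝ) < D) ∧
      ∀ v, v ∉ B → D ≤ (nb R v ∩ (X \ B.biUnion f)).card := by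
  let F : Finset (Finset V) :=
    {B | (∀ b ∈ B, ((nb R b ∩ (X \ B.biUnion f)).card : ℝ) < D) ∧ B.card ≤ W}
  have hF : F.Nonempty := ⟨∅, by simp [F]⟩
  obtain ⟨B, hB, hmax⟩ := Finset.exists_max_image F Finset.card hF
  have hB' := (Finset.mem_filter.1 hB).2
  refine ⟨B, hB'.2, hB'.1, fun v hv => ?_⟩
  by_contra! hlt
  have hmono : ∀ w, ((nb R w ∩ (X \ (insert v B).biUnion f)).card : ℝ) ≤
      (nb R w ∩ (X \ B.biUnion f)).card := by
    intro w
    have : (nb R w ∩ (X \ (insert v B).biUnion f)).card ≤ (nb R w ∩ (X \ B.biUnion f)).card := by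
      refine Finset.card_le_card (Finset.inter_subset_inter subset_rfl
        (Finset.sdiff_subset_sdiff subset_rfl ?_))
      exact Finset.biUnion_subset_biUnion_of_subset_left _ (Finset.subset_insert _ _)
    exact_mod_cast this
  have hmem : insert v B ∈ F := by
    refine Finset.mem_filter.2 ⟨Finset.mem_univ _, fun b hb => (hmono b).trans_lt ?_, ?_⟩
    · rcases Finset.mem_insert.1 hb with rfl | hb
      · exact hlt
      · exact hB'.1 b hb
    · rw [Finset.card_insert_of_notMem hv]
      exact hW B hB'.1 hB'.2
  have := hmax _ hmem
  rw [Finset.card_insert_of_notMem hv] at this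
  omega

lemma card_sdiff_biUnion_ge (X B : Finset V) (f : V → Finset V) (hf : ∀ v, (f v).card ≤ 2) :
    X.card ≤ (X \ (B ∪ B.biUnion f)).card + 3 * B.card := by
  have h1 : X.card ≤ (X \ (B ∪ B.biUnion f)).card + (B ∪ B.biUnion f).card := by
    refine (Finset.card_le_card ?_).trans (Finset.card_union_le _ _)
    intro x
    simp only [mem_union, mem_sdiff]
    tauto
  have h2 := Finset.card_union_le B (B.biUnion f)
  have h3 := Finset.card_biUnion_le_card_mul B f 2 (fun v _ => hf v)
  omega

lemma Dense.exists_core {R : SimpleGraph V} {p β u D : ℝ} (hR : Dense R p β u) (hp : 0 < p)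
    (hβ : 0 ≤ β) (X : Finset V) (f : V → Finset V) (hf : ∀ v, (f v).card ≤ 2)
    (hX : 24 * β + 6 * p ≤ p * X.card) (hD : D + u + 2 * β ≤ p * X.card / 4) :
    ∃ B : Finset V, p * B.card ≤ 4 * β + p ∧
      ∀ v, v ∉ B → D ≤ (nb R v ∩ (X \ B.biUnion f)).card := by
  set W : ℕ := ⌊4 * β / p⌋₊ + 1 with hWdef
  have hW1 : p * W ≤ 4 * β + p := by
    have : (⌊4 * β / p⌋₊ : ℝ) ≤ 4 * β / p := Nat.floor_le (by positivity)
    rw [le_div_iff₀ hp] at this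
    rw [hWdef]
    push_cast
    linarith
  have hW : ∀ B : Finset V, (∀ b ∈ B, ((nb R b ∩ (X \ B.biUnion f)).card : ℝ) < D) →
      B.card ≤ W → B.card + 1 ≤ W := by
    intro B hB hBW
    have hBW' : (B.card : ℝ) ≤ W := by exact_mod_cast hBW
    set Y := X \ (B ∪ B.biUnion f) with hY
    have h1 : (X.card : ℝ) ≤ Y.card + 3 * B.card := by
      exact_mod_cast card_sdiff_biUnion_ge X B f hf
    have h2 := hR.lower B Y (Finset.disjoint_left.2 fun b hb hbY =>
      (Finset.mem_sdiff.1 hbY).2 (Finset.mem_union_left _ hb))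
    have h3 : (adjCount R B Y : ℝ) ≤ D * B.card := by
      rw [adjCount]
      push_cast
      rw [mul_comm, ← nsmul_eq_mul]
      refine Finset.sum_le_card_nsmul _ _ _ fun b hb => le_trans ?_ (hB b hb).le
      have : (nb R b ∩ Y).card ≤ (nb R b ∩ (X \ B.biUnion f)).card :=
        Finset.card_le_card (Finset.inter_subset_inter subset_rfl
          (Finset.sdiff_subset_sdiff subset_rfl Finset.subset_union_right))
      exact_mod_cast this
    have h4 : p * B.card ≤ 4 * β + p := le_trans (by gcongr) hW1
    have h5 : p * X.card ≤ 2 * (p * Y.card) := by nlinarith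
    have hb0 : (0 : ℝ) ≤ B.card := Nat.cast_nonneg _
    have h6 : (D + u + 2 * β) * B.card ≤ p * Y.card / 2 * B.card := by
      gcongr
      linarith
    have hYpos : (0 : ℝ) < Y.card := by
      have : 0 < p * X.card := by nlinarith
      by_contra! hle
      nlinarith
    have h7 : p * B.card ≤ 4 * β := by
      have : p * B.card * Y.card ≤ 4 * β * Y.card := by nlinarith
      exact le_of_mul_le_mul_right this hYpos
    have h8 : (B.card : ℝ) ≤ 4 * β / p := by rw [le_div_iff₀ hp]; linarith
    have h9 : B.card ≤ ⌊4 * β / p⌋₊ := Nat.le_floor h8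
    omega
  obtain ⟨B, hB, -, h⟩ := HamCover.exists_core R X f D W hW
  have hB' : (B.card : ℝ) ≤ W := by exact_mod_cast hB
  exact ⟨B, (mul_le_mul_of_nonneg_left hB' hp.le).trans hW1, h⟩

end Jumbled

section Blocks
variable {V : Type} [DecidableEq V]

lemma exists_prefix_countP (P : V → Bool) (c : ℕ) (l : List V) (h : c ≤ l.countP P) :
    ∃ l₁ l₂, l = l₁ ++ l₂ ∧ l₁.countP P = c := by
  induction l generalizing c with
  | nil => exact ⟨[], [], rfl, by simpa using h.antisymm (Nat.zero_le _) |>.symm⟩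
  | cons a l ih =>
    cases c with
    | zero => exact ⟨[], a :: l, rfl, rfl⟩
    | succ c =>
      rw [List.countP_cons] at h
      by_cases ha : P a
      · obtain ⟨l₁, l₂, rfl, h2⟩ := ih c (by simpa [ha] using h)
        exact ⟨a :: l₁, l₂, rfl, by simp [ha, h2]⟩
      · obtain ⟨l₁, l₂, rfl, h2⟩ := ih (c + 1) (by simpa [ha] using h)
        exact ⟨a :: l₁, l₂, rfl, by simp [ha, h2]⟩

lemma exists_blocks (P : V → Bool) (c K : ℕ) (l : List V) (h : K * c ≤ l.countP P) :
    ∃ bs : List (List V), bs.length = K ∧ bs.flatten <+: l ∧ ∀ b ∈ bs, b.countP P = c := by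
  induction K generalizing l with
  | zero => exact ⟨[], rfl, by simp, by simp⟩
  | succ K ih =>
    rw [Nat.succ_mul] at h
    obtain ⟨l₁, l₂, rfl, h1⟩ := exists_prefix_countP P c l (by omega)
    rw [List.countP_append, h1] at h
    obtain ⟨bs, h2, h3, h4⟩ := ih l₂ (by omega)
    refine ⟨l₁ :: bs, by simp [h2], ?_, ?_⟩
    · simpa using h3
    · intro b hb
      rcases List.mem_cons.1 hb with rfl | hb
      · exact h1
      · exact h4 b hb

/-- A path avoiding the cut edge stays on one side of the cut. -/
lemma subset_or_subset_of_pathEdges {A B β : List V} (hAB : (A ++ B).Nodup)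
    (hβ : ∀ v ∈ β, v ∈ A ++ B)
    (h : ∀ e ∈ pathEdges β, e ∈ pathEdges A ∪ pathEdges B) :
    (∀ v ∈ β, v ∈ A) ∨ ∀ v ∈ β, v ∈ B := by
  induction β with
  | nil => simp
  | cons a β ih =>
    cases β with
    | nil => simpa using hβ a
    | cons b β =>
      have hab : s(a, b) ∈ pathEdges A ∪ pathEdges B := h _ (by simp)
      have hd := (List.nodup_append.1 hAB).2.2
      rcases ih (fun v hv => hβ v (List.mem_cons_of_mem _ hv))
        (fun e he => h e (by rw [pathEdges_cons_cons]; exact Finset.mem_insert_of_mem he)) with h1 | h1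
      · left
        intro v hv
        rcases List.mem_cons.1 hv with rfl | hv
        · rcases Finset.mem_union.1 hab with h2 | h2
          · exact mem_of_mem_pathEdges h2 (Sym2.mem_mk_left _ _)
          · exact absurd rfl (hd b (h1 b (by simp)) b
              (mem_of_mem_pathEdges h2 (Sym2.mem_mk_right _ _)))
        · exact h1 v hv
      · right
        intro v hv
        rcases List.mem_cons.1 hv with rfl | hv
        · rcases Finset.mem_union.1 hab with h2 | h2
          · exact absurd rfl (hd b (mem_of_mem_pathEdges h2 (Sym2.mem_mk_right _ _)) b
              (h1 b (by simp)))
          · exact mem_of_mem_pathEdges h2 (Sym2.mem_mk_left _ _)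
        · exact h1 v hv

lemma pathEdges_append_subset {A B : List V} {z : V} (hz : A.getLast? = some z) {e : Sym2 V}
    (he : e ∈ pathEdges (A ++ B)) (hze : z ∉ e) : e ∈ pathEdges A ∪ pathEdges B := by
  cases hB : B.head? with
  | none => simp at hB; simpa [hB] using he
  | some b =>
    rw [pathEdges_append hz hB, Finset.mem_insert] at he
    rcases he with rfl | he
    · exact absurd (Sym2.mem_mk_left z b) hze
    · exact he

/-- Two disjoint subpaths of a path can be separated by cutting the path once. -/
lemma exists_separating_cut {l β₁ β₂ : List V} (hl : l.Nodup) (h1 : ∀ v ∈ β₁, v ∈ l)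
    (h2 : ∀ v ∈ β₂, v ∈ l) (hE1 : pathEdges β₁ ⊆ pathEdges l) (hE2 : pathEdges β₂ ⊆ pathEdges l)
    (hd : ∀ v ∈ β₁, v ∉ β₂) (hn1 : β₁ ≠ []) (hn2 : β₂ ≠ []) :
    ∃ A B, l = A ++ B ∧ (((∀ v ∈ β₁, v ∈ A) ∧ ∀ v ∈ β₂, v ∈ B) ∨
      ((∀ v ∈ β₂, v ∈ A) ∧ ∀ v ∈ β₁, v ∈ B)) := by
  have hex : ∃ k, (∀ v ∈ β₁, v ∈ l.take k) ∨ (∀ v ∈ β₂, v ∈ l.take k) :=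
    ⟨l.length, Or.inl (by simpa using h1)⟩
  set k := Nat.find hex with hk
  have hk1 := Nat.find_spec hex
  have hk0 : k ≠ 0 := by
    intro h0
    rw [← hk, h0] at hk1
    rcases hk1 with h | h
    · exact hn1 (List.eq_nil_iff_forall_not_mem.2 fun v hv => by simpa using h v hv)
    · exact hn2 (List.eq_nil_iff_forall_not_mem.2 fun v hv => by simpa using h v hv)
  obtain ⟨j, hj⟩ := Nat.exists_eq_succ_of_ne_zero hk0
  have hmin := Nat.find_min hex (m := j) (by omega)
  push Not at hmin
  rw [← hk, hj] at hk1
  refine ⟨l.take (j + 1), l.drop (j + 1), (List.take_append_drop _ _).symm, ?_⟩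
  have key : ∀ γ₁ γ₂ : List V, (∀ v ∈ γ₂, v ∈ l) → (pathEdges γ₂ ⊆ pathEdges l) →
      (∀ v ∈ γ₁, v ∉ γ₂) → (∀ v ∈ γ₁, v ∈ l.take (j + 1)) → (∃ v ∈ γ₁, v ∉ l.take j) →
      (∃ v ∈ γ₂, v ∉ l.take j) → ∀ v ∈ γ₂, v ∈ l.drop (j + 1) := by
    intro γ₁ γ₂ g2 gE gd g1 ⟨z, hz, hz'⟩ ⟨w, hw, hw'⟩
    have hjl : j < l.length := by
      by_contra hlt
      rw [List.take_of_length_le (by omega)] at hz' 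
      exact hz' (by have := g1 z hz; exact List.mem_of_mem_take this)
    have htake : l.take (j + 1) = l.take j ++ [l[j]] := by simp
    have hzj : z = l[j] := by
      have := g1 z hz
      rw [htake, List.mem_append, List.mem_singleton] at this
      exact this.resolve_left hz'
    have hsplit : ∀ e ∈ pathEdges γ₂, e ∈ pathEdges (l.take (j + 1)) ∪
        pathEdges (l.drop (j + 1)) := by
      intro e he
      refine pathEdges_append_subset (z := z) (by rw [htake, hzj, List.getLast?_append]; rfl) (by simpa using gE he) ?_
      intro hze
      exact gd z hz (mem_of_mem_pathEdges he hze)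
    rcases subset_or_subset_of_pathEdges (A := l.take (j + 1)) (B := l.drop (j + 1)) (β := γ₂)
      (by simpa using hl) (by simpa using g2) hsplit with h | h
    · exfalso
      have h3 := h w hw
      rw [htake, List.mem_append, List.mem_singleton] at h3
      have h4 : w = l[j] := h3.resolve_left hw'
      exact gd z hz (by rw [hzj, ← h4]; exact hw)
    · exact h
  rcases hk1 with h | h
  · exact Or.inl ⟨h, key β₁ β₂ h2 hE2 hd h hmin.1 hmin.2⟩
  · exact Or.inr ⟨h, key β₂ β₁ h1 hE1 (fun v hv hv' => hd v hv' hv) h hmin.2 hmin.1⟩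

/-- At an inner vertex of a subpath all edges belong to the subpath. -/
lemma mem_pathEdges_of_inner {l β : List V} (hl : l.Nodup) (hβ : β.Nodup)
    (hE : pathEdges β ⊆ pathEdges l) {y w : V} (hy : y ∈ β) (hh : β.head? ≠ some y)
    (ht : β.getLast? ≠ some y) (hw : s(y, w) ∈ pathEdges l) : s(y, w) ∈ pathEdges β := by
  obtain ⟨a, b, rfl⟩ := List.append_of_mem hy
  rcases List.eq_nil_or_concat a with rfl | ⟨a, c, rfl⟩
  · simp at hh
  cases b with
  | nil => simp at ht
  | cons d b =>
    have h1 : s(y, c) ∈ pathEdges (a.concat c ++ y :: d :: b) :=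
      mem_pathEdges_iff.2 ⟨a, c, y, d :: b, by simp, Sym2.eq_swap⟩
    have h2 : s(y, d) ∈ pathEdges (a.concat c ++ y :: d :: b) :=
      mem_pathEdges_iff.2 ⟨a.concat c, y, d, b, by simp, rfl⟩
    have hcd : c ≠ d := by
      rintro rfl
      simp [List.nodup_append] at hβ
    obtain ⟨p, q, hpq⟩ := exists_path_nbrs hl y
    rcases hpq c (hE h1) with rfl | rfl <;> rcases hpq d (hE h2) with rfl | rfl <;>
      rcases hpq w hw with rfl | rfl <;> first | assumption | exact absurd rfl hcd

variable [Fintype V]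

/-- The neighbours of `v` along the path `l`. -/
def pnb (l : List V) (v : V) : Finset V := {w | s(v, w) ∈ pathEdges l}

lemma mem_pnb {l : List V} {v w : V} : w ∈ pnb l v ↔ s(v, w) ∈ pathEdges l := by simp [pnb]

lemma card_pnb_le {l : List V} (hl : l.Nodup) (v : V) : (pnb l v).card ≤ 2 := by
  obtain ⟨p, q, h⟩ := exists_path_nbrs hl v
  refine (Finset.card_le_card (t := {p, q}) fun w hw => ?_).trans Finset.card_le_two
  simpa using h w (mem_pnb.1 hw)

/-- The vertices of `X` that are inner vertices of the path `β`. -/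
def innerVerts (X : Finset V) (β : List V) : Finset V :=
  {y ∈ X | y ∈ β ∧ β.head? ≠ some y ∧ β.getLast? ≠ some y}

lemma countP_le_card_innerVerts {X : Finset V} {β : List V} (hβ : β.Nodup) :
    β.countP (· ∈ X) ≤ (innerVerts X β).card + 2 := by
  have h1 : β.countP (· ∈ X) = ((β.filter (· ∈ X)).toFinset).card := by
    rw [List.toFinset_card_of_nodup (hβ.filter _), List.countP_eq_length_filter]
  rw [h1]
  rcases List.eq_nil_or_concat β with rfl | ⟨β', d, rfl⟩
  · simp
  have h2 : ((β'.concat d).filter (· ∈ X)).toFinset ⊆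
      innerVerts X (β'.concat d) ∪ {(β'.concat d).head?.getD d, d} := by
    intro y hy
    simp only [List.mem_toFinset, List.mem_filter, decide_eq_true_eq] at hy
    simp only [mem_union, innerVerts, mem_filter, Finset.mem_insert, mem_singleton]
    by_cases h3 : (β'.concat d).head? = some y
    · rw [h3]
      exact Or.inr (Or.inl rfl)
    by_cases h4 : (β'.concat d).getLast? = some y
    · have : d = y := by simpa using h4
      simp [this]
    · exact Or.inl ⟨hy.2, hy.1, h3, h4⟩
  exact (Finset.card_le_card h2).trans ((Finset.card_union_le _ _).trans
    (Nat.add_le_add_left Finset.card_le_two _))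

end Blocks

section Closing
variable {V : Type} [DecidableEq V] [Fintype V]

/-- Numerical conditions under which paths on `N` vertices can be closed by few rotations. -/
structure Params (N : ℕ) (p β u : ℝ) (t : ℕ) : Prop where
  p_pos : 0 < p
  p_le : p ≤ β
  one_le : 1 ≤ β
  beta_le : 7500 * (2 * t + 2) ^ 2 * β ≤ p * N
  u_le : u ≤ p * N / (2000 * (2 * t + 2))
  lt_pow : N < 2 ^ t

lemma Dense.exists_many_heads {R : SimpleGraph V} {p β u D : ℝ} (hR : Dense R p β u) (hp : 0 ≤ p)
    (hβ : 0 ≤ β) {U : Finset V} {l₀ : List V} {x₀ : V} (hl : l₀.Nodup)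
    (hx₀ : l₀.head? = some x₀) (hU : ∀ y ∈ U, y ∈ l₀) {m t : ℕ} (hmt : m < 2 ^ t)
    (hD : 11 * p * m + 44 * β < D)
    (hdeg : ∀ z, (z = x₀ ∨ ∃ y ∈ U, s(z, y) ∈ pathEdges l₀) → D ≤ (nb R z ∩ U).card) :
    ∃ S : Finset V, m < S.card ∧ ∀ x ∈ S, ∃ l, Exch t U R l₀ l ∧
      l.getLast? = l₀.getLast? ∧ l.head? = some x :=
  HamCover.exists_many_heads hl hx₀ hU hmt fun _ hS hm hz =>
    hR.expand hp hβ hD hS hm fun v hv => hdeg v (hz v hv)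

lemma Dense.exists_good_head {R : SimpleGraph V} {p β u D : ℝ} (hR : Dense R p β u) (hp : 0 ≤ p)
    (hβ : 0 ≤ β) {U : Finset V} {l₀ : List V} {x₀ : V} (hl : l₀.Nodup)
    (hx₀ : l₀.head? = some x₀) (hU : ∀ y ∈ U, y ∈ l₀) {t : ℕ} (B : Finset V) (hmt : B.card < 2 ^ t)
    (hD : 11 * p * B.card + 44 * β < D)
    (hdeg : ∀ z, (z = x₀ ∨ ∃ y ∈ U, s(z, y) ∈ pathEdges l₀) → D ≤ (nb R z ∩ U).card) :
    ∃ l x, Exch t U R l₀ l ∧ l.getLast? = l₀.getLast? ∧ l.head? = some x ∧ x ∉ B := by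
  obtain ⟨S, hS, h⟩ := hR.exists_many_heads hp hβ hl hx₀ hU hmt hD hdeg
  obtain ⟨x, hxS, hxB⟩ := Finset.exists_mem_notMem_of_card_lt_card hS
  obtain ⟨l, h1, h2, h3⟩ := h x hxS
  exact ⟨l, x, h1, h2, h3, hxB⟩

/-- A subpath `b` together with a set `U` of pivots inside it that stay usable, with neighbours
outside `B`, in every path containing `b`. -/
structure Block (R : SimpleGraph V) (D : ℝ) (X : Finset V) (b : List V) (U B : Finset V) :
    Prop where
  ne_nil : b ≠ []
  subset : U ⊆ X
  mem : ∀ y ∈ U, y ∈ b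
  deg : ∀ v, v ∉ B → D ≤ (nb R v ∩ U).card
  nbr : ∀ l : List V, l.Nodup → pathEdges b ⊆ pathEdges l → ∀ y ∈ U, ∀ z,
    s(z, y) ∈ pathEdges l → z ∉ B

lemma Dense.exists_block {R : SimpleGraph V} {p β u D : ℝ} (hR : Dense R p β u) (hp : 0 < p)
    (hβ : 0 ≤ β) {X : Finset V} {b : List V} (hb : b.Nodup)
    (hX : 24 * β + 6 * p ≤ p * (innerVerts X b).card)
    (hD : D + u + 2 * β ≤ p * (innerVerts X b).card / 4) :
    ∃ U B : Finset V, Block R D X b U B ∧ p * B.card ≤ 4 * β + p := by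
  obtain ⟨B, hB, h⟩ := hR.exists_core hp hβ (innerVerts X b) (pnb b) (card_pnb_le hb) hX hD
  refine ⟨innerVerts X b \ B.biUnion (pnb b), B, ⟨?_, ?_, ?_, h, ?_⟩, hB⟩
  · rintro rfl
    have : innerVerts X ([] : List V) = ∅ := by simp [innerVerts]
    rw [this] at hX
    simp at hX
    nlinarith
  · intro y hy
    exact (Finset.mem_filter.1 (Finset.mem_sdiff.1 hy).1).1
  · intro y hy
    exact (Finset.mem_filter.1 (Finset.mem_sdiff.1 hy).1).2.1
  · intro l hl hE y hy z hz hzB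
    obtain ⟨h1, h2⟩ := Finset.mem_sdiff.1 hy
    obtain ⟨-, h3, h4, h5⟩ := Finset.mem_filter.1 h1
    rw [Sym2.eq_swap] at hz
    have h6 := mem_pathEdges_of_inner hl hb hE h3 h4 h5 hz
    rw [Sym2.eq_swap] at h6
    exact h2 (Finset.mem_biUnion.2 ⟨z, hzB, mem_pnb.2 h6⟩)

lemma Params.facts {N : ℕ} {p β u : ℝ} {t : ℕ} (h : Params N p β u t) :
    ∃ q : ℝ, q * (2 * t + 2) = p * N ∧ 7500 * (2 * t + 2) * β ≤ q ∧ u ≤ q / 2000 ∧ 0 < q := by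
  have hK : (0 : ℝ) < 2 * t + 2 := by positivity
  have h1 := h.beta_le
  have h2 := h.u_le
  have h3 := h.one_le
  refine ⟨p * N / (2 * t + 2), by field_simp, ?_, ?_, ?_⟩
  · rw [le_div_iff₀ hK]; nlinarith
  · convert h2 using 1; field_simp
  · refine div_pos (lt_of_lt_of_le ?_ h1) hK
    positivity

lemma Params.exists_blocks {R : SimpleGraph V} {p β u : ℝ} {t : ℕ}
    (hP : Params (Fintype.card V) p β u t) (hR : Dense R p β u) {ℓ : List V} (hℓ : ℓ.Nodup)
    (hall : ∀ v, v ∈ ℓ) {X : Finset V} (hX : Fintype.card V ≤ 2 * X.card) :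
    ∃ (b : Fin (2 * t + 2) → List V) (U B : Fin (2 * t + 2) → Finset V),
      (∀ i, b i <:+: ℓ) ∧ (∀ i j, i ≠ j → ∀ v ∈ b i, v ∉ b j) ∧
      ∀ i, Block R (p * Fintype.card V / (32 * (2 * t + 2))) X (b i) (U i) (B i) ∧
        p * (B i).card ≤ 5 * β := by
  obtain ⟨q, hq1, hq2, hq3, hq0⟩ := hP.facts
  have hp := hP.p_pos
  have hpβ := hP.p_le
  have hβ1 := hP.one_le
  set N := Fintype.card V with hN
  set K := 2 * t + 2 with hK
  have hKr : (2 * t + 2 : ℝ) = K := by rw [hK]; push_cast; ring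
  rw [hKr] at hq1 hq2 ⊢
  have hK2 : (2 : ℝ) ≤ K := by rw [← hKr]; have : (0 : ℝ) ≤ t := Nat.cast_nonneg t; linarith
  have hcount : K * (X.card / K) ≤ ℓ.countP (· ∈ X) := by
    refine (Nat.mul_div_le _ _).trans ?_
    rw [List.countP_eq_length_filter, ← List.toFinset_card_of_nodup (hℓ.filter _)]
    refine Finset.card_le_card fun x hx => ?_
    simp [hx, hall]
  obtain ⟨bs, hlen, hpre, hcnt⟩ := HamCover.exists_blocks _ _ _ _ hcount
  have hnd : bs.flatten.Nodup := hℓ.sublist hpre.sublist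
  rw [List.nodup_flatten] at hnd
  have hblock : ∀ i : Fin K, ∃ U B : Finset V,
      Block R (p * N / (32 * K)) X (bs.get (i.cast hlen.symm)) U B ∧ p * B.card ≤ 5 * β := by
    intro i
    have hmem : bs.get (i.cast hlen.symm) ∈ bs := List.get_mem _ _
    have h1 := countP_le_card_innerVerts (X := X) (hnd.1 _ hmem)
    rw [hcnt _ hmem] at h1
    set I := innerVerts X (bs.get (i.cast hlen.symm))
    have h2 : (X.card : ℝ) ≤ K * ((X.card / K : ℕ) + 1) := by
      have : X.card < K * (X.card / K + 1) := by
        have := Nat.lt_mul_div_succ X.card (b := K) (by omega)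
        simpa using this
      exact_mod_cast this.le
    have h3 : ((X.card / K : ℕ) : ℝ) ≤ I.card + 2 := by exact_mod_cast h1
    have h4 : (N : ℝ) ≤ 2 * X.card := by exact_mod_cast hX
    have h5 : (N : ℝ) ≤ 2 * K * (I.card + 3) := by nlinarith
    have h6 : q ≤ 2 * (p * I.card + 3 * p) := by
      have : q * K ≤ 2 * (p * I.card + 3 * p) * K := by
        rw [hq1]; nlinarith
      exact le_of_mul_le_mul_right this (by linarith)
    have h7 : 15000 * β ≤ q := by nlinarith
    have h8 : p * N / (32 * K) = q / 32 := by
      rw [← hq1]; field_simp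
    rw [h8]
    obtain ⟨U, B, h9, h10⟩ := hR.exists_block (D := q / 32) hp (by linarith) (hnd.1 _ hmem)
      (by linarith) (by linarith)
    exact ⟨U, B, h9, by linarith⟩
  choose U B hUB using hblock
  refine ⟨fun i => bs.get (i.cast hlen.symm), U, B, fun i => ?_, fun i j hij v hv hv' => ?_, hUB⟩
  · exact (List.infix_of_mem_flatten (List.get_mem _ _)).trans hpre.isInfix
  · have hne : i.cast hlen.symm ≠ j.cast hlen.symm := by simpa using hij
    have h2 := hnd.2
    rw [List.pairwise_iff_get] at h2
    rcases lt_or_gt_of_ne hne with h | h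
    · exact h2 _ _ h hv hv'
    · exact h2 _ _ h hv' hv

end Closing

section Closing
variable {V : Type} [DecidableEq V] [Fintype V]

/-- `l` can be closed to a cycle by an edge of `R`. -/
def Closes (R : SimpleGraph V) (l : List V) : Prop :=
  ∃ a b, l.head? = some a ∧ l.getLast? = some b ∧ R.Adj b a

lemma Params.join {R : SimpleGraph V} {p β u : ℝ} {t : ℕ}
    (hP : Params (Fintype.card V) p β u t) (hR : Dense R p β u) {L M b₁ b₂ : List V}
    {X U₁ B₁ U₂ B₂ : Finset V} (hnd : (L ++ M).Nodup)
    (h₁ : Block R (p * Fintype.card V / (32 * (2 * t + 2))) X b₁ U₁ B₁)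
    (h₂ : Block R (p * Fintype.card V / (32 * (2 * t + 2))) X b₂ U₂ B₂)
    (hL : ∀ v ∈ b₁, v ∈ L) (hM : ∀ v ∈ b₂, v ∈ M) (hE₁ : pathEdges b₁ ⊆ pathEdges (L ++ M))
    (hE₂ : pathEdges b₂ ⊆ pathEdges (L ++ M)) {x y : V} (hx : (L ++ M).head? = some x)
    (hy : (L ++ M).getLast? = some y) (hxB : x ∉ B₁) (hyB : y ∉ B₂) :
    ∃ l, Exch (2 * t) X R (L ++ M) l ∧ Closes R l := by
  obtain ⟨q, hq1, hq2, hq3, hq0⟩ := hP.facts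
  have hp := hP.p_pos
  have hpβ := hP.p_le
  have hβ1 := hP.one_le
  set N := Fintype.card V with hN
  set K : ℝ := 2 * t + 2 with hK
  have hK2 : 2 ≤ K := by have : (0 : ℝ) ≤ t := Nat.cast_nonneg t; linarith
  have hβq : 15000 * β ≤ q := by nlinarith
  have hD : p * N / (32 * K) = q / 32 := by rw [← hq1]; field_simp
  rw [hD] at h₁ h₂
  have hLne : L ≠ [] := by
    rintro rfl
    exact h₁.ne_nil (List.eq_nil_iff_forall_not_mem.2 fun v hv => by simpa using hL v hv)
  have hMne : M ≠ [] := by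
    rintro rfl
    exact h₂.ne_nil (List.eq_nil_iff_forall_not_mem.2 fun v hv => by simpa using hM v hv)
  have hxL : L.head? = some x := by
    cases L with
    | nil => exact absurd rfl hLne
    | cons a L => simpa using hx
  have hyM : M.reverse.head? = some y := by
    rw [List.getLast?_append] at hy
    cases hM' : M.getLast? with
    | none => simp at hM'; exact absurd hM' hMne
    | some z => simpa [hM'] using hy
  set m : ℕ := ⌊(N : ℝ) / (400 * K)⌋₊ with hm
  have hmle : p * m ≤ q / 400 := by
    have : (m : ℝ) ≤ N / (400 * K) := Nat.floor_le (by positivity)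
    calc p * m ≤ p * (N / (400 * K)) := by gcongr
      _ = q / 400 := by rw [mul_div_assoc', ← hq1]; field_simp
  have hmge : ∀ s : ℕ, m < s → q / 400 ≤ p * s := by
    intro s hs
    have h1 : (N : ℝ) / (400 * K) < m + 1 := Nat.lt_floor_add_one _
    have h2 : (m : ℝ) + 1 ≤ s := by exact_mod_cast hs
    calc q / 400 = p * (N / (400 * K)) := by rw [mul_div_assoc', ← hq1]; field_simp
      _ ≤ p * s := by gcongr; linarith
  have hmt : m < 2 ^ t := by
    refine lt_of_le_of_lt ?_ hP.lt_pow
    rw [hm]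
    refine (Nat.floor_le_floor (div_le_self (Nat.cast_nonneg _) (by linarith))).trans ?_
    rw [Nat.floor_natCast]
  have hDm : 11 * p * m + 44 * β < q / 32 := by nlinarith
  have hLnd := (List.nodup_append.1 hnd).1
  have hMnd := (List.nodup_append.1 hnd).2.1
  obtain ⟨S₁, hS₁, hS₁'⟩ := hR.exists_many_heads hp.le (by linarith) hLnd hxL
    (fun y hy => hL y (h₁.mem y hy)) hmt hDm (by
      rintro z (rfl | ⟨y, hy, hz⟩)
      · exact h₁.deg z hxB
      · exact h₁.deg z (h₁.nbr _ hnd hE₁ y hy z (pathEdges_subset_append_left _ _ hz)))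
  obtain ⟨S₂, hS₂, hS₂'⟩ := hR.exists_many_heads hp.le (by linarith) (l₀ := M.reverse)
    (by simpa using hMnd) hyM (fun y hy => by simpa using hM y (h₂.mem y hy)) hmt hDm (by
      rintro z (rfl | ⟨y, hy, hz⟩)
      · exact h₂.deg z hyB
      · rw [pathEdges_reverse] at hz
        exact h₂.deg z (h₂.nbr _ hnd hE₂ y hy z (pathEdges_subset_append_right _ _ hz)))
  have hdisj : Disjoint S₁ S₂ := by
    rw [Finset.disjoint_left]
    intro a ha ha'
    obtain ⟨l, h1, -, h2⟩ := hS₁' a ha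
    obtain ⟨l', h1', -, h2'⟩ := hS₂' a ha'
    have h3 : a ∈ L := h1.perm.mem_iff.1 (List.mem_of_mem_head? h2)
    have h4 : a ∈ M.reverse := h1'.perm.mem_iff.1 (List.mem_of_mem_head? h2')
    exact (List.nodup_append.1 hnd).2.2 a h3 a (by simpa using h4) rfl
  obtain ⟨a, ha, b, hb, hab⟩ : ∃ a ∈ S₁, ∃ b ∈ S₂, R.Adj a b := by
    by_contra! hno
    have h0 : adjCount R S₁ S₂ = 0 := by
      rw [adjCount]
      refine Finset.sum_eq_zero fun a ha => ?_
      rw [Finset.card_eq_zero]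
      ext b
      simp only [mem_inter, mem_nb, Finset.notMem_empty, iff_false, not_and]
      exact fun h hb => hno a ha b hb h
    have h1 := hR.lower S₁ S₂ hdisj
    rw [h0] at h1
    have h2 := hmge _ hS₁
    have h3 := hmge _ hS₂
    have h4 : (0 : ℝ) < S₁.card := by exact_mod_cast (Nat.zero_le _).trans_lt hS₁
    have h5 : (0 : ℝ) < S₂.card := by exact_mod_cast (Nat.zero_le _).trans_lt hS₂
    have h6 : 0 < S₁.card * (p * S₂.card / 2 - 2 * β - u) := by
      apply mul_pos h4; linarith
    have h7 : 0 < S₂.card * (p * S₁.card / 2 - 2 * β) := by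
      apply mul_pos h5; linarith
    push_cast at h1
    nlinarith
  obtain ⟨L', hL1, hL2, hL3⟩ := hS₁' a ha
  obtain ⟨M', hM1, hM2, hM3⟩ := hS₂' b hb
  refine ⟨L' ++ M'.reverse, ?_, a, b, ?_, ?_, hab.symm⟩
  · have h1 := (hL1.append_right hL2 M).mono le_rfl h₁.subset
    have h2 := ((hM1.append_right hM2 L'.reverse).mono le_rfl h₂.subset).reverse_left.reverse_right
    simp only [List.reverse_append, List.reverse_reverse] at h2
    exact (h1.trans h2).mono (by omega) subset_rfl
  · cases L' with
    | nil => simp at hL3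
    | cons c L' => simpa using hL3
  · rw [List.getLast?_append, List.getLast?_reverse, hM3]
    rfl

end Closing

section Closing
variable {V : Type} [DecidableEq V] [Fintype V]

lemma Exch.card_add {k : ℕ} {X : Finset V} {R : SimpleGraph V} {l l' : List V}
    (h : Exch k X R l l') (hl : l.Nodup) : (pathEdges l' \ pathEdges l).card ≤ k := by
  rw [Finset.card_sdiff_comm]
  · exact h.card
  · rw [card_pathEdges hl, card_pathEdges (h.perm.nodup_iff.2 hl), h.perm.length_eq]

/-- All but few of the blocks of a path survive a small change of the path. -/
lemma exists_two_unbroken {ι : Type} [Fintype ι] [DecidableEq ι] {b : ι → List V} {l l' : List V}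
    {k : ℕ} (hb : ∀ i, pathEdges (b i) ⊆ pathEdges l) (hd : ∀ i j, i ≠ j → ∀ v ∈ b i, v ∉ b j)
    (hk : (pathEdges l \ pathEdges l').card ≤ k) (hι : k + 2 ≤ Fintype.card ι) :
    ∃ i j, i ≠ j ∧ pathEdges (b i) ⊆ pathEdges l' ∧ pathEdges (b j) ⊆ pathEdges l' := by
  have h1 : (Finset.univ.filter fun i => ¬ pathEdges (b i) ⊆ pathEdges l').card ≤ k := by
    refine (Finset.card_le_card_biUnion (f := fun i => pathEdges (b i) \ pathEdges l')
      ?_ ?_).trans ((Finset.card_le_card ?_).trans hk)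
    · intro i _ j _ hij
      refine Finset.disjoint_left.2 fun e he he' => ?_
      have h2 := (Finset.mem_sdiff.1 he).1
      have h3 := (Finset.mem_sdiff.1 he').1
      induction e with
      | h x y =>
        exact hd i j hij x (mem_of_mem_pathEdges h2 (Sym2.mem_mk_left x y))
          (mem_of_mem_pathEdges h3 (Sym2.mem_mk_left x y))
    · intro i hi
      exact Finset.sdiff_nonempty.2 (Finset.mem_filter.1 hi).2
    · refine Finset.biUnion_subset.2 fun i _ => Finset.sdiff_subset_sdiff (hb i) subset_rfl
  have h2 := Finset.card_filter_add_card_filter_not (s := (Finset.univ : Finset ι))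
    (fun i => pathEdges (b i) ⊆ pathEdges l')
  rw [Finset.card_univ] at h2
  obtain ⟨i, hi, j, hj, hij⟩ := Finset.one_lt_card.1
    (show 1 < (Finset.univ.filter fun i => pathEdges (b i) ⊆ pathEdges l').card by omega)
  exact ⟨i, j, hij, (Finset.mem_filter.1 hi).2, (Finset.mem_filter.1 hj).2⟩

/-- A Hamilton path whose ends and path-neighbours of `U` have many `R`-neighbours in `U ⊆ X` can
be turned into a Hamilton cycle by exchanging few edges meeting `X` for edges of `R`. -/
theorem Params.close {R : SimpleGraph V} {p β u : ℝ} {t : ℕ}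
    (hP : Params (Fintype.card V) p β u t) (hR : Dense R p β u) {ℓ : List V} (hℓ : ℓ.Nodup)
    (hall : ∀ v, v ∈ ℓ) {X U : Finset V} (hX : Fintype.card V ≤ 2 * X.card) (hUX : U ⊆ X)
    (hdeg : ∀ z, (ℓ.head? = some z ∨ ℓ.getLast? = some z ∨ ∃ y ∈ U, s(z, y) ∈ pathEdges ℓ) →
      p * Fintype.card V / 4 ≤ (nb R z ∩ U).card) :
    ∃ l, Exch (4 * t) X R ℓ l ∧ Closes R l := by
  obtain ⟨b, Us, Bs, hinf, hdisj, hblock⟩ := hP.exists_blocks hR hℓ hall hX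
  obtain ⟨q, hq1, hq2, hq3, hq0⟩ := hP.facts
  have hp := hP.p_pos
  have hpβ := hP.p_le
  have hβ1 := hP.one_le
  have hβle := hP.beta_le
  set N := Fintype.card V with hN
  have ht0 : (0 : ℝ) ≤ t := Nat.cast_nonneg t
  set Bd : Finset V := Finset.univ.biUnion Bs with hBd
  have hBdcard : p * Bd.card ≤ (2 * t + 2) * (5 * β) := by
    have h1 : (Bd.card : ℝ) ≤ ∑ i, ((Bs i).card : ℝ) := by exact_mod_cast Finset.card_biUnion_le
    calc p * Bd.card ≤ p * ∑ i, ((Bs i).card : ℝ) := by gcongr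
      _ = ∑ i, p * ((Bs i).card : ℝ) := Finset.mul_sum _ _ _
      _ ≤ ∑ i : Fin (2 * t + 2), 5 * β := Finset.sum_le_sum fun i _ => (hblock i).2
      _ = _ := by simp
  have hBdpow : Bd.card < 2 ^ t := (Finset.card_le_univ Bd).trans_lt hP.lt_pow
  have hBdN : 11 * p * Bd.card + 44 * β < p * N / 5 := by nlinarith
  have hnotB : ∀ i v, v ∉ Bd → v ∉ Bs i := fun i v hv h =>
    hv (Finset.mem_biUnion.2 ⟨i, Finset.mem_univ _, h⟩)
  have hNpos : 0 < Fintype.card V := by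
    rw [← hN]
    by_contra! h0
    have h0' : (N : ℝ) = 0 := by exact_mod_cast Nat.le_zero.1 h0
    rw [h0'] at hβle
    nlinarith [sq_nonneg (t : ℝ)]
  have hℓne : ℓ ≠ [] := by
    obtain ⟨v⟩ := Fintype.card_pos_iff.1 hNpos
    rintro rfl
    simpa using hall v
  obtain ⟨x₀, hx₀⟩ : ∃ x₀, ℓ.head? = some x₀ := ⟨_, List.head?_eq_some_head hℓne⟩
  obtain ⟨y₀, hy₀⟩ : ∃ y₀, ℓ.getLast? = some y₀ := ⟨_, List.getLast?_eq_some_getLast hℓne⟩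
  obtain ⟨l₁, x₁, hl₁, hlast₁, hx₁, hxB⟩ := hR.exists_good_head (D := p * N / 4) (U := U) hp.le
    (by linarith) hℓ hx₀ (fun y _ => hall y) Bd hBdpow (by nlinarith)
    (fun z hz => hdeg z (hz.elim (fun h => Or.inl (h ▸ hx₀)) (fun h => Or.inr (Or.inr h))))
  have hl₁nd : l₁.Nodup := hl₁.perm.nodup_iff.2 hℓ
  set T : Finset V := (pathEdges l₁ \ pathEdges ℓ).biUnion Sym2.toFinset with hT
  have hTcard : T.card ≤ 2 * t := by
    refine (Finset.card_biUnion_le_card_mul _ _ 2 fun e _ => ?_).trans ?_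
    · rw [Sym2.card_toFinset]; split_ifs <;> omega
    · have := hl₁.card_add hℓ
      omega
  have hTreal : (T.card : ℝ) ≤ 2 * t := by exact_mod_cast hTcard
  obtain ⟨l₂, x₂, hl₂, hlast₂, hx₂, hx₂B⟩ := hR.exists_good_head (D := p * N / 5) (U := U \ T)
    (l₀ := l₁.reverse) (x₀ := y₀) hp.le (by linarith) (by simpa using hl₁nd)
    (by simpa [hlast₁] using hy₀) (fun y _ => by simpa using hl₁.perm.mem_iff.2 (hall y)) Bd
    hBdpow hBdN (by
      intro z hz
      have h1 : p * N / 4 ≤ (nb R z ∩ U).card := by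
        refine hdeg z (hz.elim (fun h => Or.inr (Or.inl (h ▸ hy₀))) ?_)
        rintro ⟨y, hy, hzy⟩
        rw [pathEdges_reverse] at hzy
        obtain ⟨hyU, hyT⟩ := Finset.mem_sdiff.1 hy
        refine Or.inr (Or.inr ⟨y, hyU, ?_⟩)
        by_contra hcon
        exact hyT (Finset.mem_biUnion.2 ⟨_, Finset.mem_sdiff.2 ⟨hzy, hcon⟩, by simp⟩)
      have h2 : (nb R z ∩ U).card ≤ (nb R z ∩ (U \ T)).card + T.card := by
        refine (Finset.card_le_card fun w => ?_).trans (Finset.card_union_le _ _)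
        simp only [mem_inter, mem_union, mem_sdiff]
        tauto
      have h3 : ((nb R z ∩ U).card : ℝ) ≤ (nb R z ∩ (U \ T)).card + T.card := by exact_mod_cast h2
      nlinarith)
  have hl₂' : Exch t X R l₁ l₂ := by
    simpa using (hl₂.mono le_rfl (Finset.sdiff_subset.trans hUX)).reverse_left
  have hex : Exch (2 * t) X R ℓ l₂ :=
    ((hl₁.mono le_rfl hUX).trans hl₂').mono (by omega) subset_rfl
  have hl₂nd : l₂.Nodup := hex.perm.nodup_iff.2 hℓ
  have hlast : l₂.getLast? = some x₁ := by rw [hlast₂]; simpa using hx₁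
  have hall₂ : ∀ v, v ∈ l₂ := fun v => hex.perm.mem_iff.2 (hall v)
  obtain ⟨i, j, hij, hi, hj⟩ := exists_two_unbroken (fun i => pathEdges_mono_infix (hinf i)) hdisj
    hex.card (by simp)
  obtain ⟨L, M, rfl, h⟩ := exists_separating_cut hl₂nd (fun v _ => hall₂ v) (fun v _ => hall₂ v)
    hi hj (hdisj i j hij) (hblock i).1.ne_nil (hblock j).1.ne_nil
  have main : ∃ l, Exch (2 * t) X R (L ++ M) l ∧ Closes R l := by
    rcases h with h | h
    · exact hP.join hR hl₂nd (hblock i).1 (hblock j).1 h.1 h.2 hi hj hx₂ hlast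
        (hnotB _ _ hx₂B) (hnotB _ _ hxB)
    · exact hP.join hR hl₂nd (hblock j).1 (hblock i).1 h.1 h.2 hj hi hx₂ hlast
        (hnotB _ _ hx₂B) (hnotB _ _ hxB)
  obtain ⟨l, hl, hclose⟩ := main
  exact ⟨l, (hex.trans hl).mono (by omega) subset_rfl, hclose⟩

end Closing

section Levels
variable {V : Type} [DecidableEq V] [Fintype V]

/-- `l` lists every vertex exactly once. -/
def Spans (l : List V) : Prop := l.Nodup ∧ ∀ v, v ∈ l

lemma Spans.of_perm {l l' : List V} (h : Spans l) (hp : l'.Perm l) : Spans l' :=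
  ⟨hp.nodup_iff.2 h.1, fun v => hp.mem_iff.2 (h.2 v)⟩

lemma Spans.length {l : List V} (h : Spans l) : l.length = Fintype.card V := by
  rw [← List.toFinset_card_of_nodup h.1, ← Finset.card_univ]
  congr 1
  ext v
  simp [h.2 v]

/-- Every spanning cycle has at most `w` bad vertices such that, opened at an edge without bad
ends, it can be closed again with at most `τ` exchanges, none of which drops an edge of `T`. -/
def Level (R : SimpleGraph V) (τ w : ℕ) (T : Set (Sym2 V)) : Prop :=
  ∀ l, Spans l → ∃ B : Finset V, B.card ≤ w ∧
    ∀ l₁, Spans l₁ → cycEdges l₁ = cycEdges l → (∀ a, l₁.head? = some a → a ∉ B) →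
      (∀ b, l₁.getLast? = some b → b ∉ B) →
      ∃ X l₂, Exch τ X R l₁ l₂ ∧ Closes R l₂ ∧
        ∀ y ∈ X, ∀ e ∈ pathEdges l₁, y ∈ e → e ∉ T

/-- The edges of the cycle `l` outside `M` and `R`. -/
noncomputable def virtualEdges (R : SimpleGraph V) (M : Finset (Sym2 V)) (l : List V) :
    Finset (Sym2 V) := {e ∈ cycEdges l | e ∉ M ∧ e ∉ R.edgeSet}

lemma card_le_of_all_meet {l : List V} (hl : l.Nodup) (B : Finset V) (F : Finset (Sym2 V))
    (hF : F ⊆ cycEdges l) (h : ∀ e ∈ F, ∃ v ∈ B, v ∈ e) : F.card ≤ 2 * B.card := by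
  choose f g hfg using exists_cyc_nbrs hl
  have : F ⊆ B.biUnion (fun z => {s(z, f z), s(z, g z)}) := by
    intro e he
    obtain ⟨z, hz, hze⟩ := h e he
    rw [mem_biUnion]
    refine ⟨z, hz, ?_⟩
    obtain ⟨w, rfl⟩ := hze
    simp only [Finset.mem_insert, mem_singleton]
    rcases hfg z w (hF he) with rfl | rfl
    · exact Or.inl rfl
    · exact Or.inr rfl
  calc F.card ≤ _ := Finset.card_le_card this
    _ ≤ B.card * 2 := Finset.card_biUnion_le_card_mul _ _ _ (fun z _ => Finset.card_le_two)
    _ = _ := mul_comm _ _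

/-- If every level of a hierarchy allows closing steps, all edges outside `M` and `R` can be
removed from a spanning cycle while few edges of `M` in the protected sets `T k` are dropped. -/
theorem exists_cycle_of_levels {R : SimpleGraph V} {M : Finset (Sym2 V)} {τ K : ℕ} {w : ℕ → ℕ}
    {T : ℕ → Set (Sym2 V)} (hT : Antitone T) (hV : 3 ≤ Fintype.card V)
    (hlev : ∀ k ≤ K, Level R τ (w k) (T k)) (hwK : w K = 0) {l : List V} (hl : Spans l) :
    ∃ l', Spans l' ∧ (∀ e ∈ cycEdges l', e ∈ M ∨ e ∈ R.edgeSet) ∧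
      ∀ k ≤ K, ({e ∈ cycEdges l \ cycEdges l' | e ∈ M ∧ e ∈ T k} : Finset (Sym2 V)).card ≤
        τ * min (virtualEdges R M l).card (2 * w k) := by
  induction hν : (virtualEdges R M l).card using Nat.strong_induction_on generalizing l with
  | _ ν ih =>
  rcases Nat.eq_zero_or_pos ν with rfl | hpos
  · refine ⟨l, hl, fun e he => ?_, by simp⟩
    by_contra! h
    have : e ∈ virtualEdges R M l := Finset.mem_filter.2 ⟨he, h⟩
    rw [Finset.card_eq_zero.1 hν] at this
    simp at this
  choose! B hBw hB using fun k (hk : k ≤ K) => hlev k hk l hl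
  have hex : ∃ k, k ≤ K ∧ ∃ e ∈ virtualEdges R M l, ∀ v ∈ B k, v ∉ e := by
    obtain ⟨e, he⟩ := Finset.card_pos.1 (hν ▸ hpos)
    refine ⟨K, le_rfl, e, he, ?_⟩
    have h0 : B K = ∅ := Finset.card_eq_zero.1 (by have := hBw K le_rfl; omega)
    rw [h0]
    simp
  obtain ⟨hkK, e, he, heB⟩ := Nat.find_spec hex
  have hmin : ∀ j < Nat.find hex, ν ≤ 2 * w j := by
    intro j hj
    have h1 := Nat.find_min hex hj
    push Not at h1
    have hjK : j ≤ K := hj.le.trans hkK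
    rw [← hν]
    exact (card_le_of_all_meet hl.1 (B j) _ (Finset.filter_subset _ _) (h1 hjK)).trans
      (Nat.mul_le_mul_left _ (hBw j hjK))
  set k := Nat.find hex
  obtain ⟨he1, he2, he3⟩ := Finset.mem_filter.1 he
  obtain ⟨l₁, hp₁, hc₁, a, b, ha, hb, rfl⟩ := exists_open_at he1
  have hl₁ := hl.of_perm hp₁
  obtain ⟨X, l₂, hex₂, hcl₂, hXT⟩ := hB k hkK l₁ hl₁ hc₁
    (fun a' ha' hm => heB _ hm (by rw [ha] at ha'; cases ha'; exact Sym2.mem_mk_right b _))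
    (fun b' hb' hm => heB _ hm (by rw [hb] at hb'; cases hb'; exact Sym2.mem_mk_left _ a))
  have hl₂ := hl₁.of_perm hex₂.perm
  obtain ⟨a₂, b₂, ha₂, hb₂, hR₂⟩ := hcl₂
  have hnotin := closing_notMem_pathEdges hl₁.1 (by rw [hl₁.length]; exact hV) ha hb
  rw [cycEdges_eq_insert ha hb] at hc₁
  have hsub : virtualEdges R M l₂ ⊆ (virtualEdges R M l).erase s(b, a) := by
    intro f hf
    obtain ⟨hf1, hf2, hf3⟩ := Finset.mem_filter.1 hf
    rw [cycEdges_eq_insert ha₂ hb₂, Finset.mem_insert] at hf1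
    have hf4 : f ∈ pathEdges l₂ := hf1.resolve_left (by rintro rfl; exact hf3 hR₂)
    have hf5 : f ∈ pathEdges l₁ := by
      by_contra h
      exact hf3 (hex₂.add f (Finset.mem_sdiff.2 ⟨hf4, h⟩))
    refine Finset.mem_erase.2 ⟨fun h => hnotin (h ▸ hf5), Finset.mem_filter.2 ⟨?_, hf2, hf3⟩⟩
    rw [← hc₁]
    exact Finset.mem_insert_of_mem hf5
  have hlt : (virtualEdges R M l₂).card < ν := by
    rw [← hν]
    refine (Finset.card_le_card hsub).trans_lt (Finset.card_erase_lt_of_mem he)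
  obtain ⟨l', hl', hM', hcount⟩ := ih _ hlt hl₂ rfl
  refine ⟨l', hl', hM', fun j hj => ?_⟩
  have hdrop : ({f ∈ cycEdges l \ cycEdges l₂ | f ∈ M ∧ f ∈ T j} : Finset (Sym2 V)) ⊆
      {f ∈ pathEdges l₁ \ pathEdges l₂ | f ∈ T j} := by
    intro f hf
    obtain ⟨hf1, hf2, hf3⟩ := Finset.mem_filter.1 hf
    obtain ⟨hf4, hf5⟩ := Finset.mem_sdiff.1 hf1
    rw [← hc₁, Finset.mem_insert] at hf4
    refine Finset.mem_filter.2 ⟨Finset.mem_sdiff.2 ⟨hf4.resolve_left ?_, fun h => hf5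
      (pathEdges_subset_cycEdges _ h)⟩, hf3⟩
    rintro rfl
    exact he2 hf2
  have htotal : ({f ∈ cycEdges l \ cycEdges l' | f ∈ M ∧ f ∈ T j} : Finset (Sym2 V)).card ≤
      ({f ∈ pathEdges l₁ \ pathEdges l₂ | f ∈ T j} : Finset (Sym2 V)).card +
      ({f ∈ cycEdges l₂ \ cycEdges l' | f ∈ M ∧ f ∈ T j} : Finset (Sym2 V)).card := by
    refine le_trans (Finset.card_le_card ?_) ((Finset.card_union_le _ _).trans
      (Nat.add_le_add_right (Finset.card_le_card hdrop) _))
    intro f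
    simp only [mem_filter, mem_sdiff, mem_union]
    tauto
  refine htotal.trans ?_
  have h2 := hcount j hj
  rcases lt_or_ge j k with hjk | hjk
  · have h1 : ({f ∈ pathEdges l₁ \ pathEdges l₂ | f ∈ T j} : Finset (Sym2 V)).card ≤ τ :=
      (Finset.card_le_card (Finset.filter_subset _ _)).trans hex₂.card
    have h3 := hmin j hjk
    rw [min_eq_left h3]
    calc _ ≤ τ + τ * (virtualEdges R M l₂).card :=
          add_le_add h1 (h2.trans (Nat.mul_le_mul_left _ (min_le_left _ _)))
      _ = τ * ((virtualEdges R M l₂).card + 1) := by ring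
      _ ≤ τ * ν := Nat.mul_le_mul_left _ hlt
  · have h1 : ({f ∈ pathEdges l₁ \ pathEdges l₂ | f ∈ T j} : Finset (Sym2 V)) = ∅ := by
      refine Finset.filter_eq_empty_iff.2 fun f hf hfT => ?_
      obtain ⟨y, hy, hyf⟩ := hex₂.drop f hf
      exact hXT y hy f (Finset.mem_sdiff.1 hf).1 hyf (hT hjk hfT)
    rw [h1, Finset.card_empty, zero_add]
    refine h2.trans (Nat.mul_le_mul_left _ (min_le_min_right _ hlt.le))

end Levels

section LevelInstances
variable {V : Type} [DecidableEq V] [Fintype V]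

lemma Level.mono {R : SimpleGraph V} {τ w w' : ℕ} {T : Set (Sym2 V)} (h : Level R τ w T)
    (hw : w ≤ w') : Level R τ w' T := by
  intro l hl
  obtain ⟨B, hB, h'⟩ := h l hl
  exact ⟨B, hB.trans hw, h'⟩

lemma level_univ [Nonempty V] (R : SimpleGraph V) (τ : ℕ) (T : Set (Sym2 V)) :
    Level R τ (Fintype.card V) T := by
  refine fun l _ => ⟨univ, Finset.card_univ.le, fun l₁ hl₁ _ ha _ => ?_⟩
  obtain ⟨v⟩ := ‹Nonempty V›
  cases l₁ with
  | nil => simpa using hl₁.2 v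
  | cons a l => exact absurd (mem_univ a) (ha a rfl)

lemma level_of_avoid {R : SimpleGraph V} {p β u : ℝ} {t : ℕ}
    (hP : Params (Fintype.card V) p β u t) (hR : Dense R p β u) {X : Finset V}
    (hX : Fintype.card V ≤ 2 * X.card)
    (hdeg : ∀ z, p * Fintype.card V / 4 ≤ (nb R z ∩ X).card) {T : Set (Sym2 V)}
    (hT : ∀ y ∈ X, ∀ e ∈ T, y ∉ e) : Level R (4 * t) 0 T := by
  refine fun l _ => ⟨∅, by simp, fun l₁ hl₁ _ _ _ => ?_⟩
  obtain ⟨l₂, h1, h2⟩ := hP.close hR hl₁.1 hl₁.2 hX subset_rfl (fun z _ => hdeg z)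
  exact ⟨X, l₂, h1, h2, fun y hy e _ hye he => hT y hy e he hye⟩

theorem level_of_touching {R : SimpleGraph V} {p β u : ℝ} {t : ℕ}
    (hP : Params (Fintype.card V) p β u t) (hR : Dense R p β u)
    (hdeg : ∀ z, 3 / 4 * (p * Fintype.card V) ≤ (nb R z).card) (Z : Finset V)
    (hZ : 100 * Z.card ≤ Fintype.card V) :
    Level R (4 * t) ⌊30 * β * Z.card / (p * Fintype.card V)⌋₊ {e | ∃ z ∈ Z, z ∈ e} := by
  intro l hl
  choose f g hfg using exists_cyc_nbrs hl.1
  set N := Fintype.card V with hN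
  have hp := hP.p_pos
  have hpβ := hP.p_le
  have hβ1 := hP.one_le
  have hβle : 7500 * β ≤ p * N := by
    refine le_trans ?_ hP.beta_le
    have : (1 : ℝ) ≤ (2 * t + 2) ^ 2 := by
      have : (0 : ℝ) ≤ t := Nat.cast_nonneg _
      nlinarith
    nlinarith
  have hN1 : (7500 : ℝ) ≤ N := by
    by_contra! h
    nlinarith
  have hpN : 0 < p * N := by positivity
  set nbr : V → Finset V := fun v => {f v, g v} with hnbr
  have hnbr2 : ∀ v, (nbr v).card ≤ 2 := fun v => Finset.card_le_two
  have hmem : ∀ z y, s(z, y) ∈ cycEdges l → y ∈ nbr z := by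
    intro z y h
    rcases hfg z y h with rfl | rfl <;> simp [hnbr]
  set X : Finset V := univ \ (Z ∪ Z.biUnion nbr) with hX
  have hXc : N ≤ X.card + 3 * Z.card := by
    have := card_sdiff_biUnion_ge univ Z nbr hnbr2
    rwa [Finset.card_univ] at this
  set W : ℕ := ⌊30 * β * Z.card / (p * N)⌋₊ + 1 with hWdef
  have hZ' : 100 * (Z.card : ℝ) ≤ N := by exact_mod_cast hZ
  have hW : (W : ℝ) ≤ N / 100 := by
    have h1 : (⌊30 * β * Z.card / (p * N)⌋₊ : ℝ) ≤ 30 * β * Z.card / (p * N) :=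
      Nat.floor_le (by positivity)
    have h2 : 30 * β * Z.card / (p * N) ≤ Z.card / 250 := by
      rw [div_le_div_iff₀ hpN (by norm_num)]
      nlinarith [(Nat.cast_nonneg Z.card : (0 : ℝ) ≤ Z.card)]
    rw [hWdef]
    push_cast
    linarith
  have key : ∀ B : Finset V,
      (∀ b ∈ B, ((nb R b ∩ (X \ B.biUnion nbr)).card : ℝ) < p * N / 4) → B.card ≤ W →
      B.card + 1 ≤ W := by
    intro B hB hBW
    have hBW' : (B.card : ℝ) ≤ W := by exact_mod_cast hBW
    set U := X \ B.biUnion nbr with hU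
    have h1 : Uᶜ.card ≤ 3 * Z.card + 2 * B.card := by
      have h2 := Finset.card_biUnion_le_card_mul B nbr 2 (fun v _ => hnbr2 v)
      have h3 : X.card ≤ U.card + (B.biUnion nbr).card := by
        refine (Finset.card_le_card ?_).trans (Finset.card_union_le _ _)
        intro x
        simp only [hU, mem_union, mem_sdiff]
        tauto
      have h4 := Finset.card_add_card_compl U
      omega
    have h1' : (Uᶜ.card : ℝ) ≤ 3 * Z.card + 2 * B.card := by exact_mod_cast h1
    have h5 : p * N / 2 * B.card ≤ adjCount R B Uᶜ := by
      rw [adjCount]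
      push_cast
      rw [mul_comm, ← nsmul_eq_mul]
      refine Finset.card_nsmul_le_sum _ _ _ fun v hv => ?_
      have h6 : ((nb R v).card : ℝ) = (nb R v ∩ U).card + (nb R v ∩ Uᶜ).card := by
        have : (nb R v).card = (nb R v ∩ U).card + (nb R v ∩ Uᶜ).card := by
          rw [← Finset.sdiff_eq_inter_compl, Finset.card_inter_add_card_sdiff]
        exact_mod_cast this
      have := hB v hv
      have := hdeg v
      linarith
    have h7 := hR.upper B Uᶜ
    have hb0 : (0 : ℝ) ≤ B.card := Nat.cast_nonneg _
    have hz0 : (0 : ℝ) ≤ Z.card := Nat.cast_nonneg _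
    have h8 : p * B.card * (B.card + Uᶜ.card) ≤ p * B.card * (6 / 100 * N) := by
      gcongr
      linarith
    have h9 : 4 * β * (B.card + Uᶜ.card) ≤ 4 * β * (3 * Z.card + 3 * B.card) :=
      mul_le_mul_of_nonneg_left (by linarith) (by positivity)
    have h10 : β * B.card ≤ p * N / 7500 * B.card := by
      gcongr
      linarith
    have h11 : (B.card : ℝ) ≤ 30 * β * Z.card / (p * N) := by
      rw [le_div_iff₀ hpN]
      nlinarith
    have h12 : B.card ≤ ⌊30 * β * Z.card / (p * N)⌋₊ := Nat.le_floor h11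
    omega
  obtain ⟨B, hBW, hbad, hgood⟩ := exists_core R X nbr (p * N / 4) W key
  have hB := key B hbad hBW
  refine ⟨B, by omega, fun l₁ hl₁ hc ha hb => ?_⟩
  have hsub : ∀ e ∈ pathEdges l₁, e ∈ cycEdges l := fun e he => hc ▸ pathEdges_subset_cycEdges _ he
  have hclose := hP.close hR hl₁.1 hl₁.2 (X := X) (U := X \ B.biUnion nbr) (by omega)
    Finset.sdiff_subset ?_
  · obtain ⟨l₂, h1, h2⟩ := hclose
    refine ⟨X, l₂, h1, h2, ?_⟩
    rintro y hy e he hye ⟨z, hz, hze⟩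
    have hy' := (Finset.mem_sdiff.1 hy).2
    have hyz : z ≠ y := by
      rintro rfl
      exact hy' (Finset.mem_union_left _ hz)
    obtain rfl := (Sym2.mem_and_mem_iff hyz).1 ⟨hze, hye⟩
    exact hy' (Finset.mem_union_right _ (Finset.mem_biUnion.2 ⟨z, hz, hmem z y (hsub _ he)⟩))
  · intro z hz
    refine hgood z fun hzB => ?_
    rcases hz with h | h | ⟨y, hy, h⟩
    · exact ha z h hzB
    · exact hb z h hzB
    · exact (Finset.mem_sdiff.1 hy).2 (Finset.mem_biUnion.2 ⟨z, hzB, hmem z y (hsub _ h)⟩)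

end LevelInstances

section Matrices
variable {α : Type} [DecidableEq α] [Fintype α]

lemma exists_injective_support {M : α → α → ℕ} {d : ℕ} (hd : 0 < d) (hr : ∀ v, ∑ w, M v w = d)
    (hc : ∀ w, ∑ v, M v w = d) : ∃ σ : α → α, Function.Injective σ ∧ ∀ v, 0 < M v (σ v) := by
  let t : α → Finset α := fun v => {w | 0 < M v w}
  obtain ⟨σ, hσ, h⟩ := (Finset.all_card_le_biUnion_card_iff_exists_injective t).1 (by
    intro S
    have h1 : d * S.card = ∑ v ∈ S, ∑ w ∈ S.biUnion t, M v w := by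
      rw [mul_comm, ← smul_eq_mul, ← Finset.sum_const]
      refine Finset.sum_congr rfl fun v hv => ?_
      rw [← hr v]
      refine (Finset.sum_subset (Finset.subset_univ _) fun w _ hw => ?_).symm
      by_contra hne
      exact hw (Finset.mem_biUnion.2 ⟨v, hv, by simp [t, Nat.pos_of_ne_zero hne]⟩)
    have h2 : ∑ v ∈ S, ∑ w ∈ S.biUnion t, M v w ≤ d * (S.biUnion t).card := by
      rw [Finset.sum_comm, mul_comm, ← smul_eq_mul, ← Finset.sum_const]
      refine Finset.sum_le_sum fun w _ => ?_
      rw [← hc w]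
      exact Finset.sum_le_sum_of_subset (Finset.subset_univ _)
    exact Nat.le_of_mul_le_mul_left (h1 ▸ h2) hd)
  exact ⟨σ, hσ, fun v => by simpa [t] using h v⟩

/-- The support of a matrix with constant row and column sums is covered by permutations. -/
lemma exists_permutations_cover {d : ℕ} : ∀ {M : α → α → ℕ}, (∀ v, ∑ w, M v w = d) →
    (∀ w, ∑ v, M v w = d) → ∃ σ : ℕ → α → α, (∀ k, Function.Injective (σ k)) ∧
      ∀ v w, 0 < M v w → ∃ k < d, σ k v = w := by
  induction d with
  | zero =>
    intro M hr _
    refine ⟨fun _ => id, fun _ => Function.injective_id, fun v w h => ?_⟩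
    have := Finset.single_le_sum (f := fun w => M v w) (fun _ _ => Nat.zero_le _) (mem_univ w)
    have := hr v
    omega
  | succ d ih =>
    intro M hr hc
    obtain ⟨σ, hσ, hpos⟩ := exists_injective_support d.succ_pos hr hc
    have hbij := Finite.injective_iff_bijective.1 hσ
    let e := Equiv.ofBijective σ hbij
    have hM : ∀ v w, M v w = (M v w - if σ v = w then 1 else 0) + if σ v = w then 1 else 0 := by
      intro v w
      have := hpos v
      split_ifs with h
      · subst h
        omega
      · omega
    obtain ⟨ρ, hρ, hcov⟩ := ih (M := fun v w => M v w - if σ v = w then 1 else 0) (by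
        intro v
        have h1 := hr v
        rw [Finset.sum_congr rfl fun w _ => hM v w, Finset.sum_add_distrib] at h1
        simpa using h1) (by
        intro w
        have h1 := hc w
        rw [Finset.sum_congr rfl fun v _ => hM v w, Finset.sum_add_distrib] at h1
        have h2 : (∑ v, if σ v = w then 1 else 0) = 1 := by
          obtain ⟨v₀, rfl⟩ := hbij.2 w
          simp [hσ.eq_iff]
        omega)
    refine ⟨fun k => if k = d then σ else ρ k, fun k => ?_, fun v w hvw => ?_⟩
    · dsimp only
      split_ifs
      exacts [hσ, hρ k]
    · by_cases h : σ v = w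
      · exact ⟨d, by omega, by simpa using h⟩
      · obtain ⟨k, hk, h'⟩ := hcov v w (by simpa [h] using hvw)
        exact ⟨k, by omega, by simpa [hk.ne] using h'⟩

/-- A relation with at most `d` entries in each row and column is a union of `d` partial
injections. -/
lemma exists_colouring {A : α → α → Prop} {d : ℕ} (hr : ∀ v, #{w | A v w} ≤ d)
    (hc : ∀ w, #{v | A v w} ≤ d) : ∃ c : α → α → ℕ, (∀ v w, A v w → c v w < d) ∧
      (∀ v w w', A v w → A v w' → c v w = c v w' → w = w') ∧
      ∀ v v' w, A v w → A v' w → c v w = c v' w → v = v' := by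
  let M : α ⊕ α → α ⊕ α → ℕ := fun x y => match x, y with
    | .inl v, .inl w => if A v w then 1 else 0
    | .inl v, .inr w => if v = w then d - #{w | A v w} else 0
    | .inr v, .inl w => if v = w then d - #{v | A v w} else 0
    | .inr v, .inr w => if A w v then 1 else 0
  obtain ⟨σ, hσ, hcov⟩ := exists_permutations_cover (M := M) (d := d) (by
      rintro (v | v)
      · have := hr v
        simp [M, Fintype.sum_sum_type]
        omega
      · have := hc v
        simp [M, Fintype.sum_sum_type]
        omega) (by
      rintro (v | v)
      · have := hc v
        simp [M, Fintype.sum_sum_type]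
        omega
      · have := hr v
        simp [M, Fintype.sum_sum_type]
        omega)
  have h1 : ∀ v w, ∃ k, A v w → k < d ∧ σ k (.inl v) = .inl w := by
    intro v w
    by_cases h : A v w
    · obtain ⟨k, hk, h'⟩ := hcov (.inl v) (.inl w) (by simp [M, h])
      exact ⟨k, fun _ => ⟨hk, h'⟩⟩
    · exact ⟨0, fun h' => absurd h' h⟩
  choose c h using h1
  refine ⟨c, fun v w hvw => (h v w hvw).1, fun v w w' h1 h2 he => ?_, fun v v' w h1 h2 he => ?_⟩
  · have := (h v w h1).2
    rw [he, (h v w' h2).2] at this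
    exact (Sum.inl.inj this).symm
  · have h3 := (h v w h1).2
    rw [he, ← (h v' w h2).2] at h3
    exact Sum.inl.inj (hσ _ h3)

end Matrices

section LinearForests
variable {V : Type} [DecidableEq V] [Fintype V]

lemma infix_insert_after {s t : List V} {u a x y : V} (h : [x, y] <:+: s ++ u :: t) (hx : x ≠ u) :
    [x, y] <:+: s ++ u :: a :: t := by
  obtain ⟨s', t', h⟩ := h
  simp only [List.append_assoc, List.cons_append, List.nil_append] at h
  rcases List.append_eq_append_iff.1 h with ⟨as, rfl, h2⟩ | ⟨bs, rfl, h2⟩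
  · rcases as with _ | ⟨a1, _ | ⟨a2, as⟩⟩
    · simp at h2
      exact absurd h2.1 hx
    · simp at h2
      obtain ⟨rfl, rfl, rfl⟩ := h2
      exact ⟨s', a :: t', by simp⟩
    · simp at h2
      obtain ⟨rfl, rfl, rfl⟩ := h2
      exact ⟨s', as ++ u :: a :: t, by simp⟩
  · rcases bs with _ | ⟨b1, bs⟩
    · simp at h2
      exact absurd h2.1.symm hx
    · simp at h2
      obtain ⟨rfl, rfl⟩ := h2
      exact ⟨s ++ u :: a :: bs, t', by simp⟩

/-- A partial injection that increases a rank is contained in a Hamilton path. -/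
lemma exists_list_of_injection {A : V → V → Prop} (rank : V → ℕ)
    (hrank : ∀ v w, A v w → rank v < rank w) (hfun : ∀ v w w', A v w → A v w' → w = w')
    (hinj : ∀ v v' w, A v w → A v' w → v = v') :
    ∃ l, Spans l ∧ ∀ v w, A v w → s(v, w) ∈ pathEdges l := by
  have key : ∀ S : Finset V, ∃ l : List V, l.Nodup ∧ (∀ v, v ∈ l ↔ v ∈ S) ∧
      ∀ v ∈ S, ∀ w ∈ S, A v w → [v, w] <:+: l := by
    intro S
    induction S using Finset.induction_on_max_value rank with
    | empty => exact ⟨[], by simp⟩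
    | insert a S ha hmax ih =>
      obtain ⟨l, hl, hm, hA⟩ := ih
      have haout : ∀ w ∈ insert a S, ¬ A a w := by
        intro w hw h
        have := hrank a w h
        rcases Finset.mem_insert.1 hw with rfl | hw
        · omega
        · have := hmax w hw
          omega
      have hal : a ∉ l := fun h => ha ((hm a).1 h)
      by_cases hu : ∃ u ∈ S, A u a
      · obtain ⟨u, huS, hua⟩ := hu
        obtain ⟨s, t, rfl⟩ := List.append_of_mem ((hm u).2 huS)
        have hp : (s ++ u :: a :: t).Perm (a :: (s ++ u :: t)) := by
          have := List.perm_middle (a := a) (l₁ := s ++ [u]) (l₂ := t)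
          simpa using this
        refine ⟨s ++ u :: a :: t, hp.nodup_iff.2 (List.nodup_cons.2 ⟨hal, hl⟩), fun v => ?_, ?_⟩
        · rw [hp.mem_iff, List.mem_cons, hm, Finset.mem_insert]
        · intro v hv w hw hvw
          have hva : v ≠ a := by
            rintro rfl
            exact haout w hw hvw
          have hvS := Finset.mem_of_mem_insert_of_ne hv hva
          rcases Finset.mem_insert.1 hw with rfl | hwS
          · obtain rfl := hinj _ _ _ hvw hua
            exact ⟨s, t, by simp⟩
          · refine infix_insert_after (hA v hvS w hwS hvw) ?_
            rintro rfl
            exact ha (hfun _ _ _ hvw hua ▸ hwS)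
      · refine ⟨a :: l, List.nodup_cons.2 ⟨hal, hl⟩, fun v => ?_, ?_⟩
        · rw [List.mem_cons, hm, Finset.mem_insert]
        · intro v hv w hw hvw
          have hva : v ≠ a := by
            rintro rfl
            exact haout w hw hvw
          have hvS := Finset.mem_of_mem_insert_of_ne hv hva
          rcases Finset.mem_insert.1 hw with rfl | hwS
          · exact absurd ⟨v, hvS, hvw⟩ hu
          · exact (hA v hvS w hwS hvw).trans (List.suffix_cons a l).isInfix
  obtain ⟨l, hl, hm, hA⟩ := key univ
  refine ⟨l, ⟨hl, fun v => (hm v).2 (mem_univ v)⟩, fun v w h => ?_⟩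
  obtain ⟨s, t, h⟩ := hA v (mem_univ v) w (mem_univ w) h
  exact mem_pathEdges_iff.2 ⟨s, v, w, t, by rw [← h]; simp, rfl⟩

/-- A rank-increasing relation with at most `d` entries in each row and column decomposes into `d`
edge sets contained in Hamilton paths. -/
theorem exists_linear_forests {A : V → V → Prop} (rank : V → ℕ) {d : ℕ}
    (hrank : ∀ v w, A v w → rank v < rank w) (hr : ∀ v, #{w | A v w} ≤ d)
    (hc : ∀ w, #{v | A v w} ≤ d) :
    ∃ (l : ℕ → List V) (M : ℕ → Finset (Sym2 V)), (∀ k, Spans (l k)) ∧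
      (∀ k, M k ⊆ pathEdges (l k)) ∧ (∀ k k', k ≠ k' → Disjoint (M k) (M k')) ∧
      (∀ k, ∀ e ∈ M k, ∃ v w, A v w ∧ e = s(v, w)) ∧
      ∀ v w, A v w → ∃ k < d, s(v, w) ∈ M k := by
  obtain ⟨c, hc1, hc2, hc3⟩ := exists_colouring hr hc
  have h1 : ∀ k, ∃ l, Spans l ∧ ∀ v w, (A v w ∧ c v w = k) → s(v, w) ∈ pathEdges l := fun k =>
    exists_list_of_injection rank (fun v w h => hrank v w h.1)
      (fun v w w' h h' => hc2 v w w' h.1 h'.1 (h.2.trans h'.2.symm))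
      (fun v v' w h h' => hc3 v v' w h.1 h'.1 (h.2.trans h'.2.symm))
  choose l hl hlA using h1
  have hM : ∀ k (e : Sym2 V), e ∈ ({e | ∃ v w, (A v w ∧ c v w = k) ∧ e = s(v, w)} :
      Finset (Sym2 V)) ↔ ∃ v w, (A v w ∧ c v w = k) ∧ e = s(v, w) := fun k e => by simp
  refine ⟨l, fun k => {e | ∃ v w, (A v w ∧ c v w = k) ∧ e = s(v, w)}, hl, fun k e he => ?_,
    fun k k' hk => Finset.disjoint_left.2 fun e he he' => ?_, fun k e he => ?_, fun v w h => ?_⟩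
  · obtain ⟨v, w, h, rfl⟩ := (hM k e).1 he
    exact hlA k v w h
  · obtain ⟨v, w, h, rfl⟩ := (hM k e).1 he
    obtain ⟨v', w', h', he⟩ := (hM k' _).1 he'
    rcases Sym2.eq_iff.1 he with ⟨rfl, rfl⟩ | ⟨rfl, rfl⟩
    · exact hk (h.2.symm.trans h'.2)
    · have := hrank _ _ h.1
      have := hrank _ _ h'.1
      omega
  · obtain ⟨v, w, h, rfl⟩ := (hM k e).1 he
    exact ⟨v, w, h.1, rfl⟩
  · exact ⟨c v w, hc1 v w h, (hM _ _).2 ⟨v, w, ⟨h, rfl⟩, rfl⟩⟩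

end LinearForests

section Colouring
variable {V : Type} [DecidableEq V] [Fintype V]

/-- Sets of size at most `d` can be split almost evenly by a single colouring with `s` colours. -/
theorem exists_balanced_colouring [Nonempty V] (N : V → Finset V) {d x : ℝ} {s : ℕ} (hs : 0 < s)
    (hd : ∀ v, ((N v).card : ℝ) ≤ d) (hx : 0 < x) (hx1 : x ≤ 1) :
    ∃ f : V → Fin s, ∀ v i, (#{w ∈ N v | f w = i} : ℝ) ≤
      (1 + x) * d / s + 2 * Real.log (Fintype.card V * s) / x := by
  have hs' : (0 : ℝ) < s := by exact_mod_cast hs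
  have hn' : (0 : ℝ) < Fintype.card V := by exact_mod_cast Fintype.card_pos
  set E : ℝ := Real.exp (x * d / s) with hE
  have hcount : ∀ (f : V → Fin s) v i,
      ∏ w, (1 + if w ∈ N v ∧ f w = i then x else 0) = (1 + x) ^ #{w ∈ N v | f w = i} := by
    intro f v i
    rw [← Finset.prod_const, Finset.prod_filter, ← Finset.prod_subset (Finset.subset_univ (N v))]
    · refine Finset.prod_congr rfl fun w hw => ?_
      by_cases h : f w = i <;> simp [hw, h]
    · intro w _ hw
      simp [hw]
  have hsum : ∀ v i, ∑ f : V → Fin s, ∏ w, (1 + if w ∈ N v ∧ f w = i then x else 0) ≤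
      (s : ℝ) ^ Fintype.card V * E := by
    intro v i
    have h1 := Finset.prod_univ_sum (fun _ : V => (univ : Finset (Fin s)))
      (fun w c => (1 + if w ∈ N v ∧ c = i then x else 0 : ℝ))
    rw [Fintype.piFinset_univ] at h1
    rw [← h1]
    have h2 : ∀ w, ∑ c : Fin s, (1 + if w ∈ N v ∧ c = i then x else 0 : ℝ) =
        s * (1 + if w ∈ N v then x / s else 0) := by
      intro w
      by_cases h : w ∈ N v
      · simp [h, Finset.sum_add_distrib]
        field_simp
      · simp [h]
    rw [Finset.prod_congr rfl fun w _ => h2 w, Finset.prod_mul_distrib, Finset.prod_const,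
      Finset.card_univ]
    gcongr
    rw [← Finset.prod_subset (Finset.subset_univ (N v)) (fun w _ hw => by simp [hw]),
      Finset.prod_congr rfl (g := fun _ => 1 + x / s) (fun w hw => by simp [hw]),
      Finset.prod_const]
    calc (1 + x / s) ^ #(N v) ≤ Real.exp (x / s) ^ #(N v) := by
          gcongr
          rw [add_comm]
          exact Real.add_one_le_exp _
      _ = Real.exp (#(N v) * (x / s)) := (Real.exp_nat_mul _ _).symm
      _ ≤ E := by
          rw [hE]
          gcongr
          rw [mul_div_assoc', mul_comm]
          gcongr
          exact hd v
  have htot : ∑ f : V → Fin s, ∑ v, ∑ i, ∏ w, (1 + if w ∈ N v ∧ f w = i then x else 0) ≤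
      ∑ _f : V → Fin s, Fintype.card V * s * E := by
    rw [Finset.sum_comm, Finset.sum_congr rfl fun v _ => Finset.sum_comm]
    refine (Finset.sum_le_sum fun v _ => Finset.sum_le_sum fun i _ => hsum v i).trans ?_
    simp
    exact le_of_eq (by ring)
  obtain ⟨f, -, hf⟩ := Finset.exists_le_of_sum_le ⟨fun _ => ⟨0, hs⟩, mem_univ _⟩ htot
  refine ⟨f, fun v i => ?_⟩
  have h1 : (1 + x) ^ #{w ∈ N v | f w = i} ≤ Fintype.card V * s * E := by
    refine le_trans ?_ hf
    rw [← hcount]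
    have hnn : ∀ v i, (0 : ℝ) ≤ ∏ w, (1 + if w ∈ N v ∧ f w = i then x else 0) := by
      intro v i
      rw [hcount]
      positivity
    refine le_trans ?_ (Finset.single_le_sum (f := fun v =>
      ∑ i, ∏ w, (1 + if w ∈ N v ∧ f w = i then x else 0))
      (fun v _ => Finset.sum_nonneg fun i _ => hnn v i) (mem_univ v))
    exact Finset.single_le_sum (f := fun i => ∏ w, (1 + if w ∈ N v ∧ f w = i then x else 0))
      (fun i _ => hnn v i) (mem_univ i)
  have h2 := Real.log_le_log (by positivity) h1
  rw [Real.log_pow, Real.log_mul (by positivity) (by positivity), hE, Real.log_exp] at h2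
  have h3 : x / (1 + x) ≤ Real.log (1 + x) := by
    have := Real.one_sub_inv_le_log_of_pos (show 0 < 1 + x by linarith)
    refine le_trans (le_of_eq ?_) this
    field_simp
    ring
  set c : ℝ := (#{w ∈ N v | f w = i} : ℝ) with hc
  have hc0 : 0 ≤ c := Nat.cast_nonneg _
  have h4 : c * (x / (1 + x)) ≤ Real.log (Fintype.card V * s) + x * d / s :=
    (mul_le_mul_of_nonneg_left h3 hc0).trans h2
  have h5 : c ≤ (Real.log (Fintype.card V * s) + x * d / s) * ((1 + x) / x) := by
    have := mul_le_mul_of_nonneg_right h4 (show 0 ≤ (1 + x) / x by positivity)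
    refine le_trans (le_of_eq ?_) this
    field_simp
  refine h5.trans ?_
  have h6 : 0 ≤ Real.log (Fintype.card V * s) := by
    apply Real.log_nonneg
    have h7 : (1 : ℝ) ≤ Fintype.card V := by exact_mod_cast Fintype.card_pos
    have h8 : (1 : ℝ) ≤ s := by exact_mod_cast hs
    nlinarith
  have h9 : (Real.log (Fintype.card V * s) + x * d / s) * ((1 + x) / x) =
      (1 + x) * d / s + (1 + x) * Real.log (Fintype.card V * s) / x := by
    field_simp
    ring
  rw [h9]
  gcongr
  linarith

end Colouring

section Zigzag

/-- Position of the colour `x` on the `c`-th zigzag Hamilton path of the complete graph on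
`ℤ / 2h`. -/
def zigzagPos (h c x : ℕ) : ℕ :=
  if (x + 2 * h - c) % (2 * h) = 0 then 0
  else if (x + 2 * h - c) % (2 * h) ≤ h then 2 * ((x + 2 * h - c) % (2 * h)) - 1
  else 2 * (2 * h - (x + 2 * h - c) % (2 * h))

/-- The zigzag Hamilton path containing the edge between two colours. -/
def zigzagIndex (h x y : ℕ) : ℕ := (x + y) % (2 * h) / 2

lemma zigzag_offset {h c x : ℕ} (hc : c < h) (hx : x < 2 * h) :
    (x + 2 * h - c) % (2 * h) = if c ≤ x then x - c else x + 2 * h - c := by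
  split_ifs with hcx
  · have : x + 2 * h - c = (x - c) + 2 * h := by omega
    rw [this, Nat.add_mod_right, Nat.mod_eq_of_lt (by omega)]
  · exact Nat.mod_eq_of_lt (by omega)

lemma zigzag_sum {h x y : ℕ} (hx : x < 2 * h) (hy : y < 2 * h) :
    (x + y) % (2 * h) = if x + y < 2 * h then x + y else x + y - 2 * h := by
  split_ifs with hxy
  · exact Nat.mod_eq_of_lt hxy
  · rw [Nat.mod_eq_sub_mod (by omega), Nat.mod_eq_of_lt (by omega)]

lemma zigzagIndex_lt {h x y : ℕ} (hx : x < 2 * h) (hy : y < 2 * h) : zigzagIndex h x y < h := by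
  rw [zigzagIndex, zigzag_sum hx hy]
  split_ifs <;> omega

lemma zigzagIndex_comm (h x y : ℕ) : zigzagIndex h x y = zigzagIndex h y x := by
  rw [zigzagIndex, zigzagIndex, add_comm]

lemma zigzagPos_injOn {h c x y : ℕ} (hc : c < h) (hx : x < 2 * h) (hy : y < 2 * h)
    (hxy : zigzagPos h c x = zigzagPos h c y) : x = y := by
  simp only [zigzagPos, zigzag_offset hc hx, zigzag_offset hc hy] at hxy
  split_ifs at hxy <;> omega

lemma zigzagPos_consecutive {h x y : ℕ} (hx : x < 2 * h) (hy : y < 2 * h) (hxy : x ≠ y) :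
    zigzagPos h (zigzagIndex h x y) y = zigzagPos h (zigzagIndex h x y) x + 1 ∨
      zigzagPos h (zigzagIndex h x y) x = zigzagPos h (zigzagIndex h x y) y + 1 := by
  have hc := zigzagIndex_lt hx hy
  generalize hcdef : zigzagIndex h x y = c at *
  rw [zigzagIndex, zigzag_sum hx hy] at hcdef
  simp only [zigzagPos, zigzag_offset hc hx, zigzag_offset hc hy]
  split_ifs at * <;> omega

end Zigzag

section ForestCover
variable {V : Type} [DecidableEq V] [Fintype V]

/-- A graph with a colouring into `2h` classes, each with at most `d` neighbours of each vertex, has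
all edges between distinct classes covered by `h * d` linear forests. -/
theorem exists_forest_cover (H : SimpleGraph V) {h d : ℕ} (f : V → ℕ) (hf : ∀ v, f v < 2 * h)
    (hd : ∀ v i, #{w ∈ nb H v | f w = i} ≤ d) :
    ∃ (l : ℕ → List V) (M : ℕ → Finset (Sym2 V)), (∀ j, Spans (l j)) ∧
      (∀ j, M j ⊆ pathEdges (l j)) ∧ (∀ j j', j ≠ j' → Disjoint (M j) (M j')) ∧
      (∀ j, ∀ e ∈ M j, e ∈ H.edgeSet) ∧
      ∀ v w, H.Adj v w → f v ≠ f w → ∃ j < h * d, s(v, w) ∈ M j := by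
  obtain ⟨A, hAdef⟩ : ∃ A : ℕ → V → V → Prop, ∀ c v w, A c v w ↔ c < h ∧ H.Adj v w ∧
      zigzagIndex h (f v) (f w) = c ∧ zigzagPos h c (f w) = zigzagPos h c (f v) + 1 :=
    ⟨_, fun _ _ _ => Iff.rfl⟩
  have hA : ∀ c, ∃ (l : ℕ → List V) (M : ℕ → Finset (Sym2 V)), (∀ k, Spans (l k)) ∧
      (∀ k, M k ⊆ pathEdges (l k)) ∧ (∀ k k', k ≠ k' → Disjoint (M k) (M k')) ∧
      (∀ k, ∀ e ∈ M k, ∃ v w, A c v w ∧ e = s(v, w)) ∧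
      ∀ v w, A c v w → ∃ k < d, s(v, w) ∈ M k := by
    intro c
    refine exists_linear_forests (fun v => zigzagPos h c (f v)) (fun v w hvw => ?_) ?_ ?_
    · rw [((hAdef _ _ _).1 hvw).2.2.2]
      omega
    · intro v
      rcases Finset.eq_empty_or_nonempty ({w | A c v w} : Finset V) with h0 | ⟨w₀, hw₀⟩
      · rw [h0]
        simp
      · have hw₀ := (hAdef _ _ _).1 (Finset.mem_filter.1 hw₀).2
        refine (Finset.card_le_card fun w hw => ?_).trans (hd v (f w₀))
        have hw := (hAdef _ _ _).1 (Finset.mem_filter.1 hw).2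
        exact Finset.mem_filter.2 ⟨mem_nb.2 hw.2.1, zigzagPos_injOn hw.1 (hf _) (hf _)
          (hw.2.2.2.trans hw₀.2.2.2.symm)⟩
    · intro w
      rcases Finset.eq_empty_or_nonempty ({v | A c v w} : Finset V) with h0 | ⟨v₀, hv₀⟩
      · rw [h0]
        simp
      · have hv₀ := (hAdef _ _ _).1 (Finset.mem_filter.1 hv₀).2
        refine (Finset.card_le_card fun v hv => ?_).trans (hd w (f v₀))
        have hv := (hAdef _ _ _).1 (Finset.mem_filter.1 hv).2
        exact Finset.mem_filter.2 ⟨mem_nb.2 hv.2.1.symm, zigzagPos_injOn hv.1 (hf _) (hf _)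
          (Nat.succ_injective (hv.2.2.2.symm.trans hv₀.2.2.2))⟩
  choose l M h1 h2 h3 h4 h5 using hA
  refine ⟨fun j => l (j / d) (j % d), fun j => M (j / d) (j % d), fun j => h1 _ _, fun j => h2 _ _,
    fun j j' hj => ?_, fun j e he => ?_, fun v w hvw hne => ?_⟩
  · by_cases hc : j / d = j' / d
    · dsimp only
      rw [hc]
      refine h3 _ _ _ fun hm => hj ?_
      rw [← Nat.div_add_mod j d, ← Nat.div_add_mod j' d, hc, hm]
    · refine Finset.disjoint_left.2 fun e he he' => hc ?_
      obtain ⟨v, w, h6, rfl⟩ := h4 _ _ e he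
      obtain ⟨v', w', h7, h8⟩ := h4 _ _ _ he'
      rw [hAdef] at h6 h7
      rw [← h6.2.2.1, ← h7.2.2.1]
      rcases Sym2.eq_iff.1 h8 with ⟨rfl, rfl⟩ | ⟨rfl, rfl⟩
      · rfl
      · exact zigzagIndex_comm _ _ _
  · obtain ⟨v, w, h6, rfl⟩ := h4 _ _ e he
    exact ((hAdef _ _ _).1 h6).2.1
  · have hlt := zigzagIndex_lt (hf v) (hf w)
    obtain ⟨k, hk, hkM⟩ : ∃ k < d, s(v, w) ∈ M (zigzagIndex h (f v) (f w)) k := by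
      rcases zigzagPos_consecutive (hf v) (hf w) hne with h6 | h6
      · exact h5 _ v w ((hAdef _ _ _).2 ⟨hlt, hvw, rfl, h6⟩)
      · rw [Sym2.eq_swap]
        exact h5 _ w v ((hAdef _ _ _).2 ⟨hlt, hvw.symm, zigzagIndex_comm _ _ _, h6⟩)
    refine ⟨zigzagIndex h (f v) (f w) * d + k, ?_, ?_⟩
    · nlinarith
    · have hd0 : 0 < d := by omega
      have e1 : (zigzagIndex h (f v) (f w) * d + k) / d = zigzagIndex h (f v) (f w) := by
        rw [mul_comm, Nat.mul_add_div hd0, Nat.div_eq_of_lt hk, add_zero]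
      have e2 : (zigzagIndex h (f v) (f w) * d + k) % d = k := by
        rw [mul_comm, Nat.mul_add_mod, Nat.mod_eq_of_lt hk]
      dsimp only
      rw [e1, e2]
      exact hkM

end ForestCover

section Incidence
variable {V : Type} [DecidableEq V] [Fintype V]

/-- The number of edges of `E` at the vertex `v`. -/
noncomputable def inc (E : Finset (Sym2 V)) (v : V) : ℕ := #{e ∈ E | v ∈ e}

lemma inc_mono {E F : Finset (Sym2 V)} (h : E ⊆ F) (v : V) : inc E v ≤ inc F v :=
  Finset.card_le_card (Finset.filter_subset_filter _ h)

lemma card_nbrs_le_inc (E : Finset (Sym2 V)) (v : V) : #{w | s(v, w) ∈ E} ≤ inc E v := by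
  refine Finset.card_le_card_of_injOn (fun w => s(v, w)) (fun w hw => ?_) fun w _ w' _ h => ?_
  · simp only [coe_filter, mem_univ, true_and, Set.mem_ofPred_eq] at hw
    simp only [coe_filter, Set.mem_ofPred_eq]
    exact ⟨hw, Sym2.mem_mk_left v w⟩
  · exact Sym2.congr_right.1 h

lemma inc_sdiff_add_inc_inter (E F : Finset (Sym2 V)) (v : V) :
    inc (E \ F) v + inc (E ∩ F) v = inc E v := by
  rw [inc, inc, inc, ← Finset.card_union_of_disjoint, ← Finset.filter_union,
    Finset.sdiff_union_inter]
  exact Finset.disjoint_filter_filter (Finset.disjoint_sdiff_inter E F)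

lemma inc_cycEdges_le {l : List V} (hl : l.Nodup) (v : V) : inc (cycEdges l) v ≤ 2 := by
  obtain ⟨p, q, h⟩ := exists_cyc_nbrs hl v
  refine (Finset.card_le_card fun e he => ?_).trans (Finset.card_le_two (a := s(v, p)) (b := s(v, q)))
  obtain ⟨he, w, rfl⟩ := Finset.mem_filter.1 he
  rcases h w he with rfl | rfl <;> simp

lemma sum_inc_le (E : Finset (Sym2 V)) (Z : Finset V) :
    ∑ v ∈ Z, inc E v ≤ 2 * #{e ∈ E | ∃ z ∈ Z, z ∈ e} := by
  have h := Finset.sum_card_bipartiteAbove_eq_sum_card_bipartiteBelow (s := Z) (t := E)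
    (fun v e => v ∈ e)
  simp only [Finset.bipartiteAbove, Finset.bipartiteBelow] at h
  simp only [inc]
  rw [h, mul_comm, ← smul_eq_mul, ← Finset.sum_const, Finset.sum_filter]
  refine Finset.sum_le_sum fun e _ => ?_
  split_ifs with h0
  · induction e with
    | h a b =>
      refine (Finset.card_le_card fun v hv => ?_).trans (Finset.card_le_two (a := a) (b := b))
      simpa using (Finset.mem_filter.1 hv).2
  · rw [Nat.le_zero, Finset.card_eq_zero, Finset.filter_eq_empty_iff]
    exact fun v hv hve => h0 ⟨v, hv, hve⟩

lemma sum_le_sum_sub_add {load d : V → ℕ} (hd : ∀ v, d v ≤ 2) (m : ℕ) :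
    ∑ v, (load v + d v - (m + 1)) ≤ ∑ v, (load v - (m + 1)) + ∑ v with m ≤ load v, d v := by
  rw [Finset.sum_filter, ← Finset.sum_add_distrib]
  refine Finset.sum_le_sum fun v _ => ?_
  have := hd v
  split_ifs <;> omega

lemma card_filter_mul_le_sum_sub (load : V → ℕ) (m D : ℕ) :
    #{v | m + D ≤ load v} * (D - 1) ≤ ∑ v, (load v - (m + 1)) := by
  rw [← smul_eq_mul, ← Finset.sum_const]
  refine (Finset.sum_le_sum (g := fun v => load v - (m + 1)) fun v hv => ?_).trans
    (Finset.sum_le_sum_of_subset (Finset.subset_univ _))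
  have := (Finset.mem_filter.1 hv).2
  omega

lemma card_virtualEdges_le (R : SimpleGraph V) {M : Finset (Sym2 V)} {l : List V} (hl : Spans l)
    (hV : 3 ≤ Fintype.card V) (hM : M ⊆ pathEdges l) :
    (virtualEdges R M l).card ≤ Fintype.card V - M.card := by
  have h1 : virtualEdges R M l ⊆ cycEdges l \ M := by
    intro e he
    obtain ⟨h1, h2, -⟩ := Finset.mem_filter.1 he
    exact Finset.mem_sdiff.2 ⟨h1, h2⟩
  refine (Finset.card_le_card h1).trans ?_
  rw [Finset.card_sdiff_of_subset (hM.trans (pathEdges_subset_cycEdges _)),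
    card_cycEdges hl.1 (by rw [hl.length]; exact hV), hl.length]

/-- The number of neighbours lost when the edges of the cycles `c j` are deleted from `R`. -/
lemma card_nb_sdiff_deleteEdges_le {ι : Type} {R : SimpleGraph V} {M : ι → Finset (Sym2 V)}
    {c : ι → List V} {S : Finset ι} (hM : ∀ j ∈ S, ∀ e ∈ M j, e ∉ R.edgeSet) (v : V) :
    (nb R v \ nb (R.deleteEdges {e | ∃ j ∈ S, e ∈ cycEdges (c j)}) v).card ≤
      ∑ j ∈ S, inc (cycEdges (c j) \ M j) v := by
  have h1 : nb R v \ nb (R.deleteEdges {e | ∃ j ∈ S, e ∈ cycEdges (c j)}) v ⊆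
      S.biUnion fun j => ({w | s(v, w) ∈ cycEdges (c j) \ M j} : Finset V) := by
    intro w hw
    simp only [mem_sdiff, mem_nb, SimpleGraph.deleteEdges_adj, Set.mem_ofPred_eq, not_and,
      not_not] at hw
    obtain ⟨j, hj, he⟩ := hw.2 hw.1
    simp only [mem_biUnion, mem_filter, mem_univ, true_and, mem_sdiff]
    exact ⟨j, hj, he, fun h => hM j hj _ h hw.1⟩
  exact ((Finset.card_le_card h1).trans Finset.card_biUnion_le).trans
    (Finset.sum_le_sum fun j _ => card_nbrs_le_inc _ v)

lemma card_nb_le_sdiff_add (G R : SimpleGraph V) (v : V) :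
    ((nb G v).card : ℝ) ≤ (nb G v \ nb R v).card + (nb R v).card := by
  have h1 : (nb G v).card ≤ (nb G v \ nb R v).card + (nb R v).card := by
    refine (Finset.card_le_card ?_).trans (Finset.card_union_le _ _)
    intro x
    simp only [mem_union, mem_sdiff]
    tauto
  exact_mod_cast h1

lemma card_nb_sdiff_triangle (G R R' : SimpleGraph V) (v : V) :
    ((nb G v \ nb R' v).card : ℝ) ≤ (nb G v \ nb R v).card + (nb R v \ nb R' v).card := by
  have h1 : (nb G v \ nb R' v).card ≤ (nb G v \ nb R v).card + (nb R v \ nb R' v).card := by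
    refine (Finset.card_le_card ?_).trans (Finset.card_union_le _ _)
    intro x
    simp only [mem_union, mem_sdiff]
    tauto
  exact_mod_cast h1

end Incidence

section ForestCompletion
variable {V : Type} [DecidableEq V] [Fintype V]

/-- `inc (cyc \ M)` is controlled by the deficit of `M` and the dropped edges. -/
lemma sum_inc_cycEdges_sdiff_le {M : ℕ → Finset (Sym2 V)} {c : ℕ → List V} {i B : ℕ} {v : V}
    (hc : ∀ j < i, Spans (c j)) (hB : 2 * i ≤ ∑ j ∈ range i, inc (M j) v + B) :
    ∑ j ∈ range i, inc (cycEdges (c j) \ M j) v ≤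
      B + ∑ j ∈ range i, inc (M j \ cycEdges (c j)) v := by
  have h1 : ∑ j ∈ range i, (inc (cycEdges (c j) \ M j) v + inc (M j) v) ≤
      ∑ j ∈ range i, (2 + inc (M j \ cycEdges (c j)) v) := by
    refine Finset.sum_le_sum fun j hj => ?_
    have h2 := inc_cycEdges_le (hc j (Finset.mem_range.1 hj)).1 v
    have h3 := inc_sdiff_add_inc_inter (cycEdges (c j)) (M j) v
    have h4 := inc_sdiff_add_inc_inter (M j) (cycEdges (c j)) v
    rw [Finset.inter_comm] at h4
    omega
  rw [Finset.sum_add_distrib, Finset.sum_add_distrib] at h1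
  simp at h1
  omega

/-- Sizes of the bad sets at the levels of the hierarchy in the completion of linear forests. -/
noncomputable def levelWidth (N : ℕ) (p β : ℝ) (k : ℕ) : ℕ :=
  if k = 0 then N else ⌊30 * β * (N / 100 / 2 ^ (k - 1)) / (p * N)⌋₊

/-- The state after `i` linear forests have been completed to Hamilton cycles. -/
structure Progress (R : SimpleGraph V) (M : ℕ → Finset (Sym2 V)) (w : ℕ → ℕ) (t D i : ℕ)
    (c : ℕ → List V) : Prop where
  spans : ∀ j < i, Spans (c j)
  edges : ∀ j < i, ∀ e ∈ cycEdges (c j), e ∈ M j ∨ e ∈ R.edgeSet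
  disj : ∀ j < i, ∀ j' < j, Disjoint (cycEdges (c j)) (cycEdges (c j'))
  excess : ∀ k ≤ t + 1, ∑ v, (∑ j ∈ range i, inc (M j \ cycEdges (c j)) v - (k * D + 1)) ≤
    ∑ j ∈ range i, 8 * t * min (Fintype.card V - (M j).card) (2 * w k)

lemma sum_card_compl_le {M : ℕ → Finset (Sym2 V)} {F B : ℕ} {l : ℕ → List V}
    (hl : ∀ j, Spans (l j)) (hV : 3 ≤ Fintype.card V) (hM : ∀ j, M j ⊆ pathEdges (l j))
    (hB : ∀ v, 2 * F ≤ ∑ j ∈ range F, inc (M j) v + B) {i : ℕ} (hi : i ≤ F) :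
    2 * ∑ j ∈ range i, (Fintype.card V - (M j).card) ≤ Fintype.card V * B := by
  have hMc : ∀ j, (M j).card ≤ Fintype.card V := by
    intro j
    have := Finset.card_le_card ((hM j).trans (pathEdges_subset_cycEdges _))
    rwa [card_cycEdges (hl j).1 (by rw [(hl j).length]; exact hV), (hl j).length] at this
  have h1 : ∑ j ∈ range i, (Fintype.card V - (M j).card) ≤
      ∑ j ∈ range F, (Fintype.card V - (M j).card) :=
    Finset.sum_le_sum_of_subset (Finset.range_mono hi)
  have h2 : ∑ _v : V, 2 * F ≤ ∑ v, (∑ j ∈ range F, inc (M j) v + B) :=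
    Finset.sum_le_sum fun v _ => hB v
  rw [Finset.sum_add_distrib, Finset.sum_comm] at h2
  have h3 : ∑ j ∈ range F, ∑ v, inc (M j) v ≤ ∑ j ∈ range F, 2 * (M j).card :=
    Finset.sum_le_sum fun j _ => (sum_inc_le (M j) univ).trans
      (Nat.mul_le_mul_left _ (Finset.card_filter_le _ _))
  have h4 : ∑ j ∈ range F, (Fintype.card V - (M j).card) + ∑ j ∈ range F, (M j).card =
      F * Fintype.card V := by
    rw [← Finset.sum_add_distrib, Finset.sum_congr rfl fun j _ => Nat.sub_add_cancel (hMc j)]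
    simp
  rw [← Finset.mul_sum] at h3
  simp only [Finset.sum_const, Finset.card_univ, smul_eq_mul] at h2
  nlinarith

lemma Progress.card_le {R : SimpleGraph V} {M : ℕ → Finset (Sym2 V)} {p β : ℝ} {t D F B i : ℕ}
    {c : ℕ → List V} (h : Progress R M (levelWidth (Fintype.card V) p β) t D i c)
    (hp : 0 < p) (hβ : 0 ≤ β) (hN : 0 < Fintype.card V) (hi : i ≤ F)
    (hsum : 2 * ∑ j ∈ range i, (Fintype.card V - (M j).card) ≤ Fintype.card V * B)
    (hD1 : 400 * t * B + 2 ≤ D) (hD2 : 960 * t * F * β ≤ p * Fintype.card V * (D - 1)) {k : ℕ}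
    (hk : k ≤ t) :
    (#{v | (k + 1) * D ≤ ∑ j ∈ range i, inc (M j \ cycEdges (c j)) v} : ℝ) ≤
      Fintype.card V / 100 / 2 ^ k := by
  set N := Fintype.card V with hNdef
  have h1 := card_filter_mul_le_sum_sub
    (fun v => ∑ j ∈ range i, inc (M j \ cycEdges (c j)) v) (k * D) D
  have h2 := h1.trans (h.excess k (by omega))
  have hk1 : k * D + D = (k + 1) * D := by ring
  rw [hk1] at h2
  set Z := #{v | (k + 1) * D ≤ ∑ j ∈ range i, inc (M j \ cycEdges (c j)) v} with hZ
  have hD0 : (0 : ℝ) < D - 1 := by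
    have : (2 : ℝ) ≤ D := by exact_mod_cast (show 2 ≤ D by omega)
    linarith
  have hcast : ((D - 1 : ℕ) : ℝ) = D - 1 := by
    rw [Nat.cast_sub (by omega), Nat.cast_one]
  rcases Nat.eq_zero_or_pos k with rfl | hk0
  · have h3 : ∑ j ∈ range i, 8 * t * min (N - (M j).card) (2 * levelWidth N p β 0) ≤
        8 * t * ∑ j ∈ range i, (N - (M j).card) := by
      rw [Finset.mul_sum]
      exact Finset.sum_le_sum fun j _ => Nat.mul_le_mul_left _ (min_le_left _ _)
    have h4 : Z * (D - 1) ≤ 4 * t * (N * B) := by nlinarith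
    have h5 : 100 * Z * (D - 1) ≤ N * (D - 1) := by
      have h6 : 400 * t * B ≤ D - 1 := by omega
      nlinarith
    have h7 : 100 * Z ≤ N := Nat.le_of_mul_le_mul_right h5 (by omega)
    have h8 : (100 * Z : ℝ) ≤ N := by exact_mod_cast h7
    simp
    linarith
  · have hpN : 0 < p * N := mul_pos hp (by exact_mod_cast hN)
    have h3 : ∑ j ∈ range i, 8 * t * min (N - (M j).card) (2 * levelWidth N p β k) ≤
        F * (16 * t * levelWidth N p β k) := by
      calc _ ≤ ∑ j ∈ range i, 16 * t * levelWidth N p β k := by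
            refine Finset.sum_le_sum fun j _ => ?_
            have := min_le_right (N - (M j).card) (2 * levelWidth N p β k)
            nlinarith
        _ = i * (16 * t * levelWidth N p β k) := by simp
        _ ≤ _ := Nat.mul_le_mul_right _ hi
    have h4 : (Z * (D - 1) : ℝ) ≤ F * (16 * t * levelWidth N p β k) := by
      have := h2.trans h3
      rw [← hcast]
      exact_mod_cast this
    obtain ⟨k, rfl⟩ : ∃ k', k = k' + 1 := ⟨k - 1, by omega⟩
    have h5 : (levelWidth N p β (k + 1) : ℝ) ≤ 30 * β * (N / 100 / 2 ^ k) / (p * N) := by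
      rw [levelWidth, if_neg (by omega)]
      exact Nat.floor_le (by positivity)
    set q : ℝ := N / 100 / 2 ^ k with hq
    have hq0 : 0 ≤ q := by positivity
    have h6 : (F * (16 * t * levelWidth N p β (k + 1)) : ℝ) ≤ q / 2 * (D - 1) := by
      calc (F * (16 * t * levelWidth N p β (k + 1)) : ℝ)
          ≤ F * (16 * t * (30 * β * q / (p * N))) := by gcongr
        _ = (960 * t * F * β) * q / 2 / (p * N) := by ring
        _ ≤ (p * N * (D - 1)) * q / 2 / (p * N) := by gcongr
        _ = q / 2 * (D - 1) := by field_simp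
    have h7 : (Z : ℝ) ≤ q / 2 := le_of_mul_le_mul_right (h4.trans h6) hD0
    refine h7.trans (le_of_eq ?_)
    rw [hq, pow_succ]
    ring

lemma two_mul_le_sum_inc {M : ℕ → Finset (Sym2 V)} {F B : ℕ} {l : ℕ → List V}
    (hl : ∀ j, Spans (l j)) (hM : ∀ j, M j ⊆ pathEdges (l j)) {v : V}
    (hB : 2 * F ≤ ∑ j ∈ range F, inc (M j) v + B) {i : ℕ} (hi : i ≤ F) :
    2 * i ≤ ∑ j ∈ range i, inc (M j) v + B := by
  induction F, hi using Nat.le_induction with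
  | base => exact hB
  | succ F _ ih =>
    rw [Finset.sum_range_succ] at hB
    have h1 := inc_mono ((hM F).trans (pathEdges_subset_cycEdges _)) v
    have h2 := inc_cycEdges_le (hl F).1 v
    exact ih (by omega)

section
variable {G R : SimpleGraph V} {p β u u₀ : ℝ} {t F B D : ℕ} {l : ℕ → List V}
  {M : ℕ → Finset (Sym2 V)}

lemma Progress.load_lt {i : ℕ} {c : ℕ → List V}
    (h : Progress R M (levelWidth (Fintype.card V) p β) t D i c)
    (hP : Params (Fintype.card V) p β u t) (hi : i ≤ F)
    (hsum : 2 * ∑ j ∈ range i, (Fintype.card V - (M j).card) ≤ Fintype.card V * B)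
    (hD1 : 400 * t * B + 2 ≤ D) (hD2 : 960 * t * F * β ≤ p * Fintype.card V * (D - 1)) (v : V) :
    ∑ j ∈ range i, inc (M j \ cycEdges (c j)) v < (t + 1) * D := by
  have hN : 0 < Fintype.card V := Fintype.card_pos_iff.2 ⟨v⟩
  have h1 := h.card_le hP.p_pos (by linarith [hP.one_le]) hN hi hsum hD1 hD2 le_rfl
  have h2 : (Fintype.card V : ℝ) < 2 ^ t := by exact_mod_cast hP.lt_pow
  have h3 : (Fintype.card V / 100 / 2 ^ t : ℝ) < 1 := by
    rw [div_lt_one (by positivity)]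
    have : (0 : ℝ) ≤ Fintype.card V := Nat.cast_nonneg _
    linarith
  have h4 : #{v | (t + 1) * D ≤ ∑ j ∈ range i, inc (M j \ cycEdges (c j)) v} = 0 := by
    have : (#{v | (t + 1) * D ≤ ∑ j ∈ range i, inc (M j \ cycEdges (c j)) v} : ℝ) < 1 :=
      h1.trans_lt h3
    exact Nat.lt_one_iff.1 (by exact_mod_cast this)
  by_contra! hv
  exact Finset.notMem_empty v (Finset.card_eq_zero.1 h4 ▸ by simpa using hv)

lemma Progress.used_le {i : ℕ} {c : ℕ → List V}
    (h : Progress R M (levelWidth (Fintype.card V) p β) t D i c)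
    (hP : Params (Fintype.card V) p β u t) (hi : i ≤ F) (hl : ∀ j, Spans (l j))
    (hM : ∀ j, M j ⊆ pathEdges (l j)) (hV : 3 ≤ Fintype.card V)
    (hB : ∀ v, 2 * F ≤ ∑ j ∈ range F, inc (M j) v + B)
    (hD1 : 400 * t * B + 2 ≤ D) (hD2 : 960 * t * F * β ≤ p * Fintype.card V * (D - 1)) (v : V) :
    ∑ j ∈ range i, inc (cycEdges (c j) \ M j) v ≤ B + (t + 1) * D := by
  have h1 := sum_inc_cycEdges_sdiff_le h.spans (two_mul_le_sum_inc hl hM (hB v) hi)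
  have h2 := h.load_lt hP hi (sum_card_compl_le hl hV hM hB hi) hD1 hD2 v
  omega

lemma Progress.step {i : ℕ} {c : ℕ → List V}
    (h : Progress R M (levelWidth (Fintype.card V) p β) t D i c)
    (hP : Params (Fintype.card V) p β u t) (hG : EDHC.IsJumbled G p β) (hRG : R ≤ G)
    (hdeg : ∀ v, 3 / 4 * (p * Fintype.card V) + u ≤ (nb G v).card)
    (hu₀ : ∀ v, ((nb G v \ nb R v).card : ℝ) ≤ u₀) (hu : u₀ + B + (t + 1) * D ≤ u)
    (hl : ∀ j, Spans (l j)) (hM : ∀ j, M j ⊆ pathEdges (l j))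
    (hMR : ∀ j, ∀ e ∈ M j, e ∉ R.edgeSet) (hMM : ∀ j j', j ≠ j' → Disjoint (M j) (M j'))
    (hV : 3 ≤ Fintype.card V) (hB : ∀ v, 2 * F ≤ ∑ j ∈ range F, inc (M j) v + B)
    (hD1 : 400 * t * B + 2 ≤ D) (hD2 : 960 * t * F * β ≤ p * Fintype.card V * (D - 1))
    (hi : i < F) :
    ∃ c', Progress R M (levelWidth (Fintype.card V) p β) t D (i + 1) c' := by
  set w := levelWidth (Fintype.card V) p β with hw
  have hsum := sum_card_compl_le hl hV hM hB hi.le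
  have hused := h.used_le hP hi.le hl hM hV hB hD1 hD2
  set load : V → ℕ := fun v => ∑ j ∈ range i, inc (M j \ cycEdges (c j)) v with hload
  set R' := R.deleteEdges {e | ∃ j ∈ range i, e ∈ cycEdges (c j)} with hR'
  have hR'R : R' ≤ R := SimpleGraph.deleteEdges_le _
  have hlost : ∀ v, ((nb G v \ nb R' v).card : ℝ) ≤ u := by
    intro v
    have h1 := card_nb_sdiff_triangle G R R' v
    have h2 := card_nb_sdiff_deleteEdges_le (c := c) (S := range i) (fun j _ => hMR j) v
    have h3 : ((nb R v \ nb R' v).card : ℝ) ≤ B + (t + 1) * D := by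
      exact_mod_cast h2.trans (hused v)
    linarith [hu₀ v]
  have hdeg' : ∀ v, 3 / 4 * (p * Fintype.card V) ≤ ((nb R' v).card : ℝ) := by
    intro v
    have h1 := card_nb_le_sdiff_add G R' v
    linarith [hdeg v, hlost v]
  have hdense : Dense R' p β u := Dense.of_isJumbled hP.p_pos.le (by linarith [hP.one_le]) hG
    (hR'R.trans hRG) hlost
  let Z : ℕ → Finset V := fun k => {v | k * D ≤ load v}
  obtain ⟨T, hTdef⟩ : ∃ T : ℕ → Set (Sym2 V), ∀ k, T k = {e | ∃ z ∈ Z k, z ∈ e} :=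
    ⟨_, fun _ => rfl⟩
  have hT : Antitone T := by
    intro k k' hk
    rw [hTdef, hTdef]
    rintro e ⟨z, hz, hze⟩
    refine ⟨z, ?_, hze⟩
    have hz := (Finset.mem_filter.1 hz).2
    exact Finset.mem_filter.2 ⟨mem_univ _, (Nat.mul_le_mul_right D hk).trans hz⟩
  have hN : 0 < Fintype.card V := by omega
  have : Nonempty V := Fintype.card_pos_iff.1 hN
  have hpN : 0 < p * Fintype.card V := mul_pos hP.p_pos (by exact_mod_cast hN)
  have hlev : ∀ k ≤ t + 1, Level R' (4 * t) (w k) (T k) := by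
    intro k hk
    rcases Nat.eq_zero_or_pos k with rfl | hk0
    · rw [hw, levelWidth, if_pos rfl]
      exact level_univ _ _ _
    · obtain ⟨k, rfl⟩ : ∃ k', k = k' + 1 := ⟨k - 1, by omega⟩
      have h1 : ((Z (k + 1)).card : ℝ) ≤ Fintype.card V / 100 / 2 ^ k :=
        h.card_le hP.p_pos (by linarith [hP.one_le]) hN hi.le hsum hD1 hD2 (by omega)
      have h2 : 100 * (Z (k + 1)).card ≤ Fintype.card V := by
        have h3 : (Fintype.card V / 100 / 2 ^ k : ℝ) ≤ Fintype.card V / 100 :=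
          div_le_self (by positivity) (one_le_pow₀ (by norm_num))
        have h4 : (100 * (Z (k + 1)).card : ℝ) ≤ Fintype.card V := by linarith
        exact_mod_cast h4
      rw [hTdef]
      refine (level_of_touching hP hdense hdeg' (Z (k + 1)) h2).mono ?_
      rw [hw, levelWidth, if_neg (by omega)]
      refine Nat.floor_le_floor ?_
      have := hP.one_le
      simp only [Nat.add_sub_cancel]
      gcongr
  have hwK : w (t + 1) = 0 := by
    rw [hw, levelWidth, if_neg (by omega), Nat.floor_eq_zero, div_lt_one hpN]
    have h2 : (Fintype.card V : ℝ) < 2 ^ t := by exact_mod_cast hP.lt_pow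
    have h3 : (Fintype.card V / 100 / 2 ^ t : ℝ) ≤ 1 := by
      rw [div_le_one (by positivity)]
      have : (0 : ℝ) ≤ Fintype.card V := Nat.cast_nonneg _
      linarith
    have h4 := hP.beta_le
    have h5 := hP.one_le
    have h6 : (1 : ℝ) ≤ (2 * t + 2) ^ 2 := by
      have : (0 : ℝ) ≤ t := Nat.cast_nonneg _
      nlinarith
    calc 30 * β * (Fintype.card V / 100 / 2 ^ t) ≤ 30 * β * 1 := by gcongr
      _ < 7500 * (2 * t + 2) ^ 2 * β := by nlinarith
      _ ≤ _ := h4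
  obtain ⟨l', hl', he', hdrop⟩ := exists_cycle_of_levels (M := M i) hT hV hlev hwK (hl i)
  have hnew : ∀ j < i, Function.update c i l' j = c j := fun j hj =>
    Function.update_of_ne hj.ne _ _
  refine ⟨Function.update c i l', ⟨fun j hj => ?_, fun j hj e he => ?_, fun j hj j' hj' => ?_,
    fun k hk => ?_⟩⟩
  · rcases Nat.lt_succ_iff_lt_or_eq.1 hj with hj | rfl
    · rw [hnew j hj]
      exact h.spans j hj
    · rwa [Function.update_self]
  · rcases Nat.lt_succ_iff_lt_or_eq.1 hj with hj | rfl
    · rw [hnew j hj] at he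
      exact h.edges j hj e he
    · rw [Function.update_self] at he
      exact (he' e he).imp_right fun h => SimpleGraph.edgeSet_mono hR'R h
  · rcases Nat.lt_succ_iff_lt_or_eq.1 hj with hj | rfl
    · rw [hnew j hj, hnew j' (hj'.trans hj)]
      exact h.disj j hj j' hj'
    · rw [Function.update_self, hnew j' hj', Finset.disjoint_left]
      intro e he hec
      rcases he' e he with h1 | h1
      · rcases h.edges j' hj' e hec with h2 | h2
        · exact Finset.disjoint_left.1 (hMM j j' hj'.ne') h1 h2
        · exact hMR j e h1 h2
      · rw [hR', SimpleGraph.edgeSet_deleteEdges] at h1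
        exact h1.2 ⟨j', Finset.mem_range.2 hj', hec⟩
  · have hs : ∀ v, ∑ j ∈ range (i + 1), inc (M j \ cycEdges (Function.update c i l' j)) v =
        load v + inc (M i \ cycEdges l') v := by
      intro v
      rw [Finset.sum_range_succ, Function.update_self]
      congr 1
      exact Finset.sum_congr rfl fun j hj => by rw [hnew j (Finset.mem_range.1 hj)]
    simp only [hs]
    have hsub : M i ⊆ cycEdges (l i) := (hM i).trans (pathEdges_subset_cycEdges _)
    refine (sum_le_sum_sub_add (fun v => ?_) (k * D)).trans ?_
    · exact (inc_mono (Finset.sdiff_subset.trans hsub) v).trans (inc_cycEdges_le (hl i).1 v)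
    · rw [Finset.sum_range_succ]
      refine Nat.add_le_add (h.excess k hk) ?_
      refine (sum_inc_le _ (Z k)).trans ?_
      have h1 : ({e ∈ M i \ cycEdges l' | ∃ z ∈ Z k, z ∈ e} : Finset (Sym2 V)).card ≤
          4 * t * min (virtualEdges R' (M i) (l i)).card (2 * w k) := by
        refine (Finset.card_le_card fun e he => ?_).trans (hdrop k hk)
        obtain ⟨h1, h2⟩ := Finset.mem_filter.1 he
        obtain ⟨h3, h4⟩ := Finset.mem_sdiff.1 h1
        exact Finset.mem_filter.2 ⟨Finset.mem_sdiff.2 ⟨hsub h3, h4⟩, h3, by rwa [hTdef]⟩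
      have h2 : min (virtualEdges R' (M i) (l i)).card (2 * w k) ≤
          min (Fintype.card V - (M i).card) (2 * w k) :=
        min_le_min_right _ (card_virtualEdges_le R' (hl i) hV (hM i))
      have h3 := Nat.mul_le_mul_left (4 * t) h2
      nlinarith

/-- Edge-disjoint linear forests with small total deficit can be completed to edge-disjoint Hamilton
cycles using edges of `R`, dropping only few edges at every vertex. -/
theorem exists_cycles_of_forests
    (hP : Params (Fintype.card V) p β u t) (hG : EDHC.IsJumbled G p β) (hRG : R ≤ G)
    (hdeg : ∀ v, 3 / 4 * (p * Fintype.card V) + u ≤ (nb G v).card)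
    (hu₀ : ∀ v, ((nb G v \ nb R v).card : ℝ) ≤ u₀) (hu : u₀ + B + (t + 1) * D ≤ u)
    (hl : ∀ j, Spans (l j)) (hM : ∀ j, M j ⊆ pathEdges (l j))
    (hMR : ∀ j, ∀ e ∈ M j, e ∉ R.edgeSet) (hMM : ∀ j j', j ≠ j' → Disjoint (M j) (M j'))
    (hV : 3 ≤ Fintype.card V) (hB : ∀ v, 2 * F ≤ ∑ j ∈ range F, inc (M j) v + B)
    (hD1 : 400 * t * B + 2 ≤ D) (hD2 : 960 * t * F * β ≤ p * Fintype.card V * (D - 1)) :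
    ∃ c : ℕ → List V, (∀ j < F, Spans (c j)) ∧
      (∀ j < F, ∀ e ∈ cycEdges (c j), e ∈ M j ∨ e ∈ R.edgeSet) ∧
      (∀ j < F, ∀ j' < j, Disjoint (cycEdges (c j)) (cycEdges (c j'))) ∧
      (∀ v, ∑ j ∈ range F, inc (M j \ cycEdges (c j)) v ≤ (t + 1) * D) ∧
      ∀ v, ∑ j ∈ range F, inc (cycEdges (c j) \ M j) v ≤ B + (t + 1) * D := by
  have key : ∀ i ≤ F, ∃ c, Progress R M (levelWidth (Fintype.card V) p β) t D i c := by
    intro i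
    induction i with
    | zero => exact fun _ => ⟨fun _ => [], ⟨by simp, by simp, by simp, by simp⟩⟩
    | succ i ih =>
      intro hi
      obtain ⟨c, hc⟩ := ih (by omega)
      exact hc.step hP hG hRG hdeg hu₀ hu hl hM hMR hMM hV hB hD1 hD2 hi
  obtain ⟨c, hc⟩ := key F le_rfl
  exact ⟨c, hc.spans, hc.edges, hc.disj,
    fun v => (hc.load_lt hP le_rfl (sum_card_compl_le hl hV hM hB le_rfl) hD1 hD2 v).le,
    hc.used_le hP le_rfl hl hM hV hB hD1 hD2⟩

end

end ForestCompletion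

section AvoidingForests
variable {V : Type} [DecidableEq V] [Fintype V]

/-- Few linear forests, each missing a large set of vertices, can be completed to edge-disjoint
Hamilton cycles containing them. -/
theorem exists_cycles_containing {ι : Type} [Fintype ι] {G R : SimpleGraph V} {p β u u₀ : ℝ} {t : ℕ}
    {l : ι → List V} {M : ι → Finset (Sym2 V)} {X : ι → Finset V}
    (hP : Params (Fintype.card V) p β u t) (hG : EDHC.IsJumbled G p β) (hRG : R ≤ G)
    (hV : 3 ≤ Fintype.card V)
    (hdeg : ∀ i v, p * Fintype.card V / 4 + u ≤ (nb G v ∩ X i).card)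
    (hu₀ : ∀ v, ((nb G v \ nb R v).card : ℝ) ≤ u₀) (hu : u₀ + 2 * Fintype.card ι ≤ u)
    (hl : ∀ i, Spans (l i)) (hM : ∀ i, M i ⊆ pathEdges (l i))
    (hMR : ∀ i, ∀ e ∈ M i, e ∉ R.edgeSet) (hMM : ∀ i j, i ≠ j → Disjoint (M i) (M j))
    (hX : ∀ i, Fintype.card V ≤ 2 * (X i).card) (hXM : ∀ i, ∀ y ∈ X i, ∀ e ∈ M i, y ∉ e) :
    ∃ c : ι → List V, (∀ i, Spans (c i)) ∧ (∀ i, M i ⊆ cycEdges (c i)) ∧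
      (∀ i, ∀ e ∈ cycEdges (c i), e ∈ M i ∨ e ∈ R.edgeSet) ∧
      ∀ i j, i ≠ j → Disjoint (cycEdges (c i)) (cycEdges (c j)) := by
  have key : ∀ S : Finset ι, ∃ c : ι → List V, (∀ i ∈ S, Spans (c i)) ∧
      (∀ i ∈ S, M i ⊆ cycEdges (c i)) ∧
      (∀ i ∈ S, ∀ e ∈ cycEdges (c i), e ∈ M i ∨ e ∈ R.edgeSet) ∧
      ∀ i ∈ S, ∀ j ∈ S, i ≠ j → Disjoint (cycEdges (c i)) (cycEdges (c j)) := by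
    intro S
    induction S using Finset.induction_on with
    | empty => exact ⟨fun _ => [], by simp⟩
    | insert i S hi ih =>
      obtain ⟨c, h1, h2, h3, h4⟩ := ih
      set R' := R.deleteEdges {e | ∃ j ∈ S, e ∈ cycEdges (c j)} with hR'
      have hR'R : R' ≤ R := SimpleGraph.deleteEdges_le _
      have hlost : ∀ v, ((nb G v \ nb R' v).card : ℝ) ≤ u := by
        intro v
        have h5 := card_nb_sdiff_triangle G R R' v
        have h6 := card_nb_sdiff_deleteEdges_le (R := R) (M := fun _ => ∅) (c := c) (S := S)
          (by simp) v
        have h7 : ∑ j ∈ S, inc (cycEdges (c j) \ ∅) v ≤ ∑ j ∈ S, 2 :=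
          Finset.sum_le_sum fun j hj => by
            rw [Finset.sdiff_empty]
            exact inc_cycEdges_le (h1 j hj).1 v
        have h8 : S.card ≤ Fintype.card ι := Finset.card_le_univ S
        rw [Finset.sum_const, smul_eq_mul] at h7
        have h9 : ((nb R v \ nb R' v).card : ℝ) ≤ 2 * Fintype.card ι := by
          have : (nb R v \ nb R' v).card ≤ 2 * Fintype.card ι := by
            refine h6.trans (h7.trans ?_)
            omega
          exact_mod_cast this
        linarith [hu₀ v]
      have hdeg' : ∀ v, p * Fintype.card V / 4 ≤ ((nb R' v ∩ X i).card : ℝ) := by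
        intro v
        have h5 : (nb G v ∩ X i).card ≤ (nb G v \ nb R' v).card + (nb R' v ∩ X i).card := by
          refine (Finset.card_le_card ?_).trans (Finset.card_union_le _ _)
          intro x
          simp only [mem_union, mem_sdiff, mem_inter]
          tauto
        have h6 : ((nb G v ∩ X i).card : ℝ) ≤
            (nb G v \ nb R' v).card + (nb R' v ∩ X i).card := by exact_mod_cast h5
        linarith [hlost v, hdeg i v]
      have hdense : Dense R' p β u := Dense.of_isJumbled hP.p_pos.le (by linarith [hP.one_le]) hG
        (hR'R.trans hRG) hlost
      obtain ⟨T, hT⟩ : ∃ T : ℕ → Set (Sym2 V), ∀ k e, e ∈ T k ↔ e ∈ M i :=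
        ⟨fun _ => {e | e ∈ M i}, fun _ _ => Iff.rfl⟩
      obtain ⟨l', hl', he', hdrop⟩ := exists_cycle_of_levels (R := R') (M := M i) (τ := 4 * t)
        (K := 0) (w := fun _ => 0) (T := T) (fun _ _ _ e he => (hT _ _).2 ((hT _ _).1 he)) hV
        (fun _ _ => level_of_avoid hP hdense (hX i) hdeg'
          fun y hy e he => hXM i y hy e ((hT _ _).1 he)) rfl (hl i)
      have hM' : M i ⊆ cycEdges l' := by
        intro e he
        by_contra hne
        have h5 := hdrop 0 le_rfl
        rw [Nat.mul_zero, min_eq_right (Nat.zero_le _), Nat.mul_zero, Nat.le_zero,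
          Finset.card_eq_zero, Finset.filter_eq_empty_iff] at h5
        exact h5 (Finset.mem_sdiff.2 ⟨pathEdges_subset_cycEdges _ (hM i he), hne⟩) ⟨he, (hT _ _).2 he⟩
      have hdisj : ∀ j ∈ S, Disjoint (cycEdges l') (cycEdges (c j)) := by
        intro j hj
        rw [Finset.disjoint_left]
        intro e he hec
        rcases he' e he with h5 | h5
        · rcases h3 j hj e hec with h6 | h6
          · exact Finset.disjoint_left.1 (hMM i j (by rintro rfl; exact hi hj)) h5 h6
          · exact hMR i e h5 h6
        · rw [hR', SimpleGraph.edgeSet_deleteEdges] at h5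
          exact h5.2 ⟨j, hj, hec⟩
      have hnew : ∀ j ∈ S, Function.update c i l' j = c j := fun j hj =>
        Function.update_of_ne (by rintro rfl; exact hi hj) _ _
      refine ⟨Function.update c i l', fun j hj => ?_, fun j hj => ?_, fun j hj => ?_,
        fun j hj k hk hjk => ?_⟩
      · rcases Finset.mem_insert.1 hj with rfl | hj
        · rwa [Function.update_self]
        · rw [hnew j hj]
          exact h1 j hj
      · rcases Finset.mem_insert.1 hj with rfl | hj
        · rwa [Function.update_self]
        · rw [hnew j hj]
          exact h2 j hj
      · rcases Finset.mem_insert.1 hj with rfl | hj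
        · rw [Function.update_self]
          exact fun e he => (he' e he).imp_right fun h => SimpleGraph.edgeSet_mono hR'R h
        · rw [hnew j hj]
          exact h3 j hj
      · rcases Finset.mem_insert.1 hj with h5 | h5 <;> rcases Finset.mem_insert.1 hk with h6 | h6
        · exact absurd (h5.trans h6.symm) hjk
        · rw [h5, Function.update_self, hnew k h6]
          exact hdisj k h6
        · rw [h6, Function.update_self, hnew j h5]
          exact (hdisj j h5).symm
        · rw [hnew j h5, hnew k h6]
          exact h4 j h5 k h6 hjk
  obtain ⟨c, h1, h2, h3, h4⟩ := key univ
  exact ⟨c, fun i => h1 i (mem_univ i), fun i => h2 i (mem_univ i), fun i => h3 i (mem_univ i),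
    fun i j => h4 i (mem_univ i) j (mem_univ j)⟩

/-- A sparse graph has its edges covered by edge-disjoint Hamilton cycles whose other edges are
taken from `R`. -/
theorem exists_cycles_of_sparse {G R L : SimpleGraph V} {p β u u₀ : ℝ} {t d : ℕ}
    (hP : Params (Fintype.card V) p β u t) (hG : EDHC.IsJumbled G p β) (hRG : R ≤ G)
    (hV : 3 ≤ Fintype.card V) (hlow : ∀ v, 15 / 16 * (p * Fintype.card V) ≤ (nb G v).card)
    (hupp : ∀ v, ((nb G v).card : ℝ) ≤ 17 / 16 * (p * Fintype.card V))
    (hlog : 2 * Real.log (Fintype.card V * 16) ≤ p * Fintype.card V / 200)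
    (hu₀ : ∀ v, ((nb G v \ nb R v).card : ℝ) ≤ u₀) (hu : u₀ + 512 * d ≤ u)
    (hLR : ∀ e ∈ L.edgeSet, e ∉ R.edgeSet) (hL : ∀ v, (nb L v).card ≤ d) :
    ∃ (ι : Type) (c : ι → List V), (∀ i, Spans (c i)) ∧
      (∀ e ∈ L.edgeSet, ∃ i, e ∈ cycEdges (c i)) ∧
      (∀ i, ∀ e ∈ cycEdges (c i), e ∈ L.edgeSet ∨ e ∈ R.edgeSet) ∧
      ∀ i j, i ≠ j → Disjoint (cycEdges (c i)) (cycEdges (c j)) := by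
  have : Nonempty V := Fintype.card_pos_iff.1 (by omega)
  set N := Fintype.card V with hN
  have hNpos : (0 : ℝ) < N := by exact_mod_cast (show 0 < N by omega)
  have hpN : 0 < p * N := mul_pos hP.p_pos hNpos
  obtain ⟨g, hg⟩ := exists_balanced_colouring (fun v => nb G v) (s := 16) (by norm_num) hupp
    one_pos le_rfl
  have hg' : ∀ v i, (#{w ∈ nb G v | g w = i} : ℝ) ≤ p * N / 7 := by
    intro v i
    have := hg v i
    norm_num at this ⊢
    linarith
  have hclass : ∀ i, (#{w | g w = i} : ℝ) ≤ 16 / 105 * N := by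
    intro i
    have h1 := adjCount_comm G {w | g w = i} univ
    have h2 : (#{w | g w = i} : ℝ) * (15 / 16 * (p * N)) ≤ adjCount G {w | g w = i} univ := by
      rw [adjCount]
      push_cast
      rw [← nsmul_eq_mul]
      refine Finset.card_nsmul_le_sum _ _ _ fun v _ => ?_
      rw [Finset.inter_univ]
      exact hlow v
    have h3 : (adjCount G univ {w | g w = i} : ℝ) ≤ N * (p * N / 7) := by
      rw [adjCount]
      push_cast
      have : ∑ a, ((nb G a ∩ ({w | g w = i} : Finset V)).card : ℝ) ≤ (univ : Finset V).card • (p * N / 7) := by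
        refine Finset.sum_le_card_nsmul _ _ _ fun v _ => ?_
        rw [← Finset.filter_mem_eq_inter]
        simpa using hg' v i
      rwa [Finset.card_univ, nsmul_eq_mul] at this
    rw [← h1] at h3
    have h4 : (#{w | g w = i} : ℝ) * (15 / 16 * (p * N)) ≤ 16 / 105 * N * (15 / 16 * (p * N)) := by
      nlinarith
    exact le_of_mul_le_mul_right h4 (by positivity)
  let ρ := Fintype.equivFin V
  obtain ⟨A, hA⟩ : ∃ A : Fin 16 × Fin 16 → V → V → Prop, ∀ q v w, A q v w ↔
      L.Adj v w ∧ ρ v < ρ w ∧ g v = q.1 ∧ g w = q.2 := ⟨_, fun _ _ _ => Iff.rfl⟩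
  have hforest := fun q => exists_linear_forests (A := A q) (d := d) (fun v => (ρ v : ℕ))
    (fun v w h => ((hA _ _ _).1 h).2.1)
    (fun v => (Finset.card_le_card fun w hw => mem_nb.2
      ((hA _ _ _).1 (Finset.mem_filter.1 hw).2).1).trans (hL v))
    (fun w => (Finset.card_le_card fun v hv => mem_nb.2
      ((hA _ _ _).1 (Finset.mem_filter.1 hv).2).1.symm).trans (hL w))
  choose l M h1 h2 h3 h4 h5 using hforest
  have hML : ∀ q k, ∀ e ∈ M q k, e ∈ L.edgeSet := by
    intro q k e he
    obtain ⟨v, w, h, rfl⟩ := h4 q k e he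
    exact ((hA _ _ _).1 h).1
  refine Exists.elim (exists_cycles_containing
    (ι := (Fin 16 × Fin 16) × Fin d) (l := fun i => l i.1 i.2) (M := fun i => M i.1 i.2)
    (X := fun i => {v | g v ≠ i.1.1 ∧ g v ≠ i.1.2}) hP hG hRG hV ?_ hu₀ ?_ (fun i => h1 _ _)
    (fun i => h2 _ _) (fun i e he => hLR e (hML _ _ e he)) ?_ ?_ ?_) ?_
  · rintro ⟨⟨a, b⟩, k⟩ v
    have h6 : (nb G v).card ≤ (nb G v ∩ ({v | g v ≠ a ∧ g v ≠ b} : Finset V)).card +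
        (#{w ∈ nb G v | g w = a} + #{w ∈ nb G v | g w = b}) := by
      refine (Finset.card_le_card ?_).trans ((Finset.card_union_le _ _).trans
        (Nat.add_le_add_left (Finset.card_union_le _ _) _))
      intro x
      simp only [mem_union, mem_inter, mem_filter, mem_univ, true_and]
      tauto
    have h7 : ((nb G v).card : ℝ) ≤ (nb G v ∩ ({v | g v ≠ a ∧ g v ≠ b} : Finset V)).card +
        (#{w ∈ nb G v | g w = a} + #{w ∈ nb G v | g w = b}) := by exact_mod_cast h6
    have h8 : u ≤ p * N / 4 := by
      refine hP.u_le.trans ?_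
      gcongr
      have : (0 : ℝ) ≤ t := Nat.cast_nonneg _
      linarith
    have := hg' v a
    have := hg' v b
    have := hlow v
    dsimp only
    linarith
  · simp only [Fintype.card_prod, Fintype.card_fin]
    push_cast
    linarith
  · rintro ⟨q, k⟩ ⟨q', k'⟩ hne
    by_cases hq : q = q'
    · subst hq
      exact h3 q k k' fun hk => hne (by rw [Fin.ext hk])
    · refine Finset.disjoint_left.2 fun e he he' => hq ?_
      obtain ⟨v, w, h6, rfl⟩ := h4 _ _ e he
      obtain ⟨v', w', h7, h8⟩ := h4 _ _ _ he'
      rw [hA] at h6 h7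
      rcases Sym2.eq_iff.1 h8 with ⟨rfl, rfl⟩ | ⟨rfl, rfl⟩
      · exact Prod.ext (h6.2.2.1.symm.trans h7.2.2.1) (h6.2.2.2.symm.trans h7.2.2.2)
      · exact absurd h6.2.1 h7.2.1.not_gt
  · rintro ⟨⟨a, b⟩, k⟩
    have h6 : N ≤ ({v | g v ≠ a ∧ g v ≠ b} : Finset V).card + (#{w | g w = a} + #{w | g w = b}) := by
      rw [hN, ← Finset.card_univ]
      refine (Finset.card_le_card ?_).trans ((Finset.card_union_le _ _).trans
        (Nat.add_le_add_left (Finset.card_union_le _ _) _))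
      intro x
      simp only [mem_union, mem_filter, mem_univ, true_and]
      tauto
    have h7 : (N : ℝ) ≤ ({v | g v ≠ a ∧ g v ≠ b} : Finset V).card +
        (#{w | g w = a} + #{w | g w = b}) := by exact_mod_cast h6
    have h8 := hclass a
    have h9 := hclass b
    have h10 : (N : ℝ) ≤ 2 * ({v | g v ≠ a ∧ g v ≠ b} : Finset V).card := by linarith
    exact_mod_cast h10
  · rintro ⟨⟨a, b⟩, k⟩ y hy e he hye
    obtain ⟨v, w, h6, rfl⟩ := h4 _ _ e he
    rw [hA] at h6
    have hy := (Finset.mem_filter.1 hy).2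
    rcases Sym2.mem_iff.1 hye with rfl | rfl
    · exact hy.1 h6.2.2.1
    · exact hy.2 h6.2.2.2
  · rintro c ⟨hc1, hc2, hc3, hc4⟩
    refine ⟨_, c, hc1, fun e he => ?_, fun i e he => (hc3 i e he).imp_left (hML _ _ e), hc4⟩
    have key : ∀ v w, L.Adj v w → ρ v < ρ w → ∃ i, s(v, w) ∈ cycEdges (c i) := by
      intro v w hvw hlt
      obtain ⟨k, hk, hkM⟩ := h5 (g v, g w) v w ((hA _ _ _).2 ⟨hvw, hlt, rfl, rfl⟩)
      exact ⟨((g v, g w), ⟨k, hk⟩), hc2 _ hkM⟩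
    induction e with
    | h v w =>
      rcases lt_trichotomy (ρ v) (ρ w) with h | h | h
      · exact key v w he h
      · exact absurd (ρ.injective h) (SimpleGraph.Adj.ne he)
      · rw [Sym2.eq_swap]
        exact key w v (SimpleGraph.Adj.symm he) h

/-- The combinatorial core: a regular graph `H` edge-disjoint from `R` is covered by edge-disjoint
Hamilton cycles of `H ∪ R`. -/
theorem exists_cycles_cover {G R H : SimpleGraph V} {p β u u₀ : ℝ} {t h d r B D : ℕ} {f : V → ℕ}
    (hP : Params (Fintype.card V) p β u t) (hG : EDHC.IsJumbled G p β) (hRG : R ≤ G)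
    (hV : 3 ≤ Fintype.card V) (hlow : ∀ v, 15 / 16 * (p * Fintype.card V) ≤ (nb G v).card)
    (hupp : ∀ v, ((nb G v).card : ℝ) ≤ 17 / 16 * (p * Fintype.card V))
    (hlog : 2 * Real.log (Fintype.card V * 16) ≤ p * Fintype.card V / 200)
    (hu₀ : ∀ v, ((nb G v \ nb R v).card : ℝ) ≤ u₀)
    (hu : u₀ + B + (t + 1) * D + 512 * ((t + 1) * D + d) ≤ u)
    (hHR : ∀ e ∈ H.edgeSet, e ∉ R.edgeSet) (hH : ∀ v, (nb H v).card = r)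
    (hf : ∀ v, f v < 2 * h) (hfd : ∀ v i, #{w ∈ nb H v | f w = i} ≤ d)
    (hB : 2 * (h * d) + d ≤ r + B) (hD1 : 400 * t * B + 2 ≤ D)
    (hD2 : 960 * t * (h * d : ℕ) * β ≤ p * Fintype.card V * (D - 1)) :
    ∃ (ι : Type) (c : ι → List V), (∀ i, Spans (c i)) ∧
      (∀ e ∈ H.edgeSet, ∃ i, e ∈ cycEdges (c i)) ∧
      (∀ i, ∀ e ∈ cycEdges (c i), e ∈ H.edgeSet ∨ e ∈ R.edgeSet) ∧
      ∀ i j, i ≠ j → Disjoint (cycEdges (c i)) (cycEdges (c j)) := by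
  obtain ⟨l, M, hl, hM, hMM, hMH, hcov⟩ := exists_forest_cover H f hf hfd
  have hMR : ∀ j, ∀ e ∈ M j, e ∉ R.edgeSet := fun j e he => hHR e (hMH j e he)
  have hother : ∀ v, r ≤ #{w ∈ nb H v | f w ≠ f v} + d := by
    intro v
    have h1 : nb H v ⊆ ({w ∈ nb H v | f w ≠ f v} : Finset V) ∪ {w ∈ nb H v | f w = f v} := by
      intro w hw
      by_cases h2 : f w = f v <;> simp [hw, h2]
    have h2 := (Finset.card_le_card h1).trans (Finset.card_union_le _ _)
    have h3 := hfd v (f v)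
    have h4 := hH v
    omega
  have hdeficit : ∀ v, 2 * (h * d) ≤ ∑ j ∈ range (h * d), inc (M j) v + B := by
    intro v
    have h1 : #{w ∈ nb H v | f w ≠ f v} ≤ ∑ j ∈ range (h * d), inc (M j) v := by
      have h2 : ({w ∈ nb H v | f w ≠ f v} : Finset V) ⊆
          (range (h * d)).biUnion fun j => ({w | s(v, w) ∈ M j} : Finset V) := by
        intro w hw
        obtain ⟨h3, h4⟩ := Finset.mem_filter.1 hw
        obtain ⟨j, hj, hjM⟩ := hcov v w (mem_nb.1 h3) (Ne.symm h4)
        exact Finset.mem_biUnion.2 ⟨j, Finset.mem_range.2 hj, by simpa using hjM⟩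
      exact ((Finset.card_le_card h2).trans Finset.card_biUnion_le).trans
        (Finset.sum_le_sum fun j _ => card_nbrs_le_inc _ v)
    have := hother v
    omega
  have hNpos : (0 : ℝ) < Fintype.card V := by exact_mod_cast (show 0 < Fintype.card V by omega)
  have hpN : 0 < p * Fintype.card V := mul_pos hP.p_pos hNpos
  have hsmall : u ≤ p * Fintype.card V / 16 := by
    refine hP.u_le.trans ?_
    gcongr
    have : (0 : ℝ) ≤ t := Nat.cast_nonneg _
    linarith
  obtain ⟨c, hc1, hc2, hc3, hc4, hc5⟩ := exists_cycles_of_forests hP hG hRG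
    (fun v => by linarith [hlow v]) hu₀
    (by
      have h1 : (0 : ℝ) ≤ (t + 1) * D := by positivity
      have h2 : (0 : ℝ) ≤ d := Nat.cast_nonneg _
      linarith) hl hM hMR hMM hV hdeficit hD1 hD2
  let L := H.deleteEdges {e | ∃ j ∈ range (h * d), e ∈ cycEdges (c j)}
  set R' := R.deleteEdges {e | ∃ j ∈ range (h * d), e ∈ cycEdges (c j)} with hR'
  have hL : ∀ e, e ∈ L.edgeSet ↔ e ∈ H.edgeSet ∧ ¬ ∃ j ∈ range (h * d), e ∈ cycEdges (c j) := by
    intro e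
    rw [SimpleGraph.edgeSet_deleteEdges]
    rfl
  have hR'e : ∀ e, e ∈ R'.edgeSet ↔ e ∈ R.edgeSet ∧ ¬ ∃ j ∈ range (h * d), e ∈ cycEdges (c j) := by
    intro e
    rw [hR', SimpleGraph.edgeSet_deleteEdges]
    rfl
  have hLdeg : ∀ v, (nb L v).card ≤ (t + 1) * D + d := by
    intro v
    have h1 : nb L v ⊆ ({w ∈ nb H v | f w = f v} : Finset V) ∪
        (range (h * d)).biUnion fun j => ({w | s(v, w) ∈ M j \ cycEdges (c j)} : Finset V) := by
      intro w hw
      have h2 := (hL s(v, w)).1 (mem_nb.1 hw)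
      rw [Finset.mem_union]
      by_cases h3 : f w = f v
      · exact Or.inl (Finset.mem_filter.2 ⟨mem_nb.2 h2.1, h3⟩)
      · obtain ⟨j, hj, hjM⟩ := hcov v w h2.1 (Ne.symm h3)
        refine Or.inr (Finset.mem_biUnion.2 ⟨j, Finset.mem_range.2 hj, ?_⟩)
        simp only [mem_filter, mem_univ, true_and, mem_sdiff]
        exact ⟨hjM, fun h4 => h2.2 ⟨j, Finset.mem_range.2 hj, h4⟩⟩
    have h2 := (Finset.card_le_card h1).trans (Finset.card_union_le _ _)
    have h3 := (Finset.card_biUnion_le (s := range (h * d))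
      (t := fun j => ({w | s(v, w) ∈ M j \ cycEdges (c j)} : Finset V))).trans
      (Finset.sum_le_sum fun j _ => card_nbrs_le_inc _ v)
    have h4 := hc4 v
    have h5 := hfd v (f v)
    omega
  obtain ⟨ι, c', hd1, hd2, hd3, hd4⟩ := exists_cycles_of_sparse (R := R') (L := L)
    (u₀ := u₀ + B + (t + 1) * D) (d := (t + 1) * D + d) hP hG
    ((SimpleGraph.deleteEdges_le _).trans hRG) hV hlow hupp hlog
    (fun v => by
      have h1 := card_nb_sdiff_triangle G R R' v
      have h2 := (card_nb_sdiff_deleteEdges_le (c := c) (S := range (h * d))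
        (fun j _ => hMR j) v).trans (hc5 v)
      have h3 : ((nb R v \ nb R' v).card : ℝ) ≤ B + (t + 1) * D := by exact_mod_cast h2
      linarith [hu₀ v])
    (by push_cast; linarith)
    (fun e he he' => hHR e ((hL e).1 he).1 ((hR'e e).1 he').1) hLdeg
  have hcross : ∀ i : Fin (h * d), ∀ j, Disjoint (cycEdges (c i)) (cycEdges (c' j)) := by
    intro i j
    rw [Finset.disjoint_left]
    intro e he he'
    rcases hd3 j e he' with h1 | h1
    · exact ((hL e).1 h1).2 ⟨i, Finset.mem_range.2 i.2, he⟩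
    · exact ((hR'e e).1 h1).2 ⟨i, Finset.mem_range.2 i.2, he⟩
  refine ⟨Fin (h * d) ⊕ ι, Sum.elim (fun i => c i) c', ?_, fun e he => ?_, ?_, ?_⟩
  · rintro (i | i)
    exacts [hc1 i i.2, hd1 i]
  · by_cases h1 : ∃ j ∈ range (h * d), e ∈ cycEdges (c j)
    · obtain ⟨j, hj, he⟩ := h1
      exact ⟨Sum.inl ⟨j, Finset.mem_range.1 hj⟩, he⟩
    · obtain ⟨i, hi⟩ := hd2 e ((hL e).2 ⟨he, h1⟩)
      exact ⟨Sum.inr i, hi⟩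
  · rintro (i | i) e he
    · exact (hc2 i i.2 e he).imp_left (hMH i e)
    · exact (hd3 i e he).imp (fun h => ((hL e).1 h).1) fun h => ((hR'e e).1 h).1
  · rintro (i | i) (j | j) hij
    · have hij' : (i : ℕ) ≠ j := fun h => hij (by rw [Fin.ext h])
      rcases lt_or_gt_of_ne hij' with h1 | h1
      · exact (hc3 j j.2 i h1).symm
      · exact hc3 i i.2 j h1
    · exact hcross i j
    · exact (hcross j i).symm
    · exact hd4 i j fun h => hij (by rw [h])

end AvoidingForests

section Parameters

/-- The number `2 * h` of colours, the bound `d` on the monochromatic degrees and the bound `B` on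
the deficit of the forests. -/
theorem exists_colour_parameters {N r : ℕ} {b μ : ℝ} (hμ : 10 ^ 13 ≤ μ)
    (hN : Real.log N = μ ^ 4) (hb : μ ^ 14 ≤ b) (hbN : b ^ 4 ≤ 2 * N) (hr : (r : ℝ) ≤ 2 * b ^ 4) :
    ∃ h d B : ℕ, 0 < h ∧
      (1 + 1 / (2 * h : ℝ)) * r / (2 * h : ℝ) + 2 * Real.log (N * (2 * h : ℝ)) / (1 / (2 * h : ℝ))
        < d + 1 ∧
      2 * (h * d) + d ≤ r + B ∧ (B : ℝ) ≤ 9 * (b ^ 3 / μ ^ 3) ∧ (d : ℝ) ≤ 5 * (b ^ 3 / μ ^ 3) ∧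
      (h * d : ℝ) ≤ 2 * b ^ 4 := by
  have hμ0 : 0 < μ := by linarith [show (0 : ℝ) < 10 ^ 13 by norm_num]
  have hμ1 : 1 ≤ μ := by linarith [show (1 : ℝ) ≤ 10 ^ 13 by norm_num]
  have hb1 : μ ≤ b := (le_self_pow₀ hμ1 (by norm_num)).trans hb
  have hb0 : 0 < b := hμ0.trans_le hb1
  have hμ3 : 1 ≤ μ ^ 3 := one_le_pow₀ hμ1
  have hbμ : 10 ^ 13 ≤ b * μ ^ 3 := by nlinarith
  set h := ⌈b * μ ^ 3 / 2⌉₊ with hh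
  have hs1 : b * μ ^ 3 ≤ 2 * h := by linarith [Nat.le_ceil (b * μ ^ 3 / 2)]
  have hs2 : (2 * h : ℝ) ≤ 2 * (b * μ ^ 3) := by
    have := Nat.ceil_lt_add_one (show 0 ≤ b * μ ^ 3 / 2 by positivity)
    rw [← hh] at this
    linarith
  have hs0 : (1 : ℝ) ≤ 2 * h := by linarith
  obtain ⟨s, hs⟩ : ∃ s : ℝ, s = 2 * h := ⟨_, rfl⟩
  rw [← hs] at hs0 hs1 hs2
  have hspos : 0 < s := by linarith
  obtain ⟨w, hw⟩ : ∃ w, w = b ^ 3 / μ ^ 3 := ⟨_, rfl⟩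
  rw [← hw]
  have hwμ : w * μ ^ 3 = b ^ 3 := by rw [hw]; field_simp
  have hrs : (r : ℝ) / s ≤ 2 * w := by
    rw [div_le_iff₀ hspos]
    calc (r : ℝ) ≤ 2 * b ^ 4 := hr
      _ = 2 * w * (b * μ ^ 3) := by linear_combination -2 * b * hwμ
      _ ≤ 2 * w * s := by
        have : 0 ≤ w := by rw [hw]; positivity
        gcongr
  have hμs : 4 * μ ^ 4 * s ^ 2 ≤ w := by
    rw [hw, le_div_iff₀ (by positivity)]
    have h1 : s ^ 2 ≤ (2 * (b * μ ^ 3)) ^ 2 := by gcongr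
    calc 4 * μ ^ 4 * s ^ 2 * μ ^ 3 ≤ 4 * μ ^ 4 * (2 * (b * μ ^ 3)) ^ 2 * μ ^ 3 := by gcongr
      _ = b ^ 2 * (16 * μ ^ 13) := by ring
      _ ≤ b ^ 2 * (μ * μ ^ 13) := by gcongr; linarith
      _ = b ^ 2 * μ ^ 14 := by ring
      _ ≤ b ^ 2 * b := by gcongr
      _ = b ^ 3 := by ring
  have hw1 : 1 ≤ w := by
    refine le_trans ?_ hμs
    have : 1 ≤ μ ^ 4 := one_le_pow₀ hμ1
    have : 1 ≤ s ^ 2 := one_le_pow₀ hs0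
    nlinarith
  have hμs1 : 4 * μ ^ 4 * s ≤ 4 * μ ^ 4 * s ^ 2 := by
    gcongr
    nlinarith
  have hlog : Real.log (N * s) ≤ 2 * μ ^ 4 := by
    have hN0 : (0 : ℝ) < N := by
      have : 0 < b ^ 4 := by positivity
      linarith
    have h1 : s ≤ N := by
      have h2 : 2 * μ ^ 3 ≤ b := by
        refine le_trans ?_ hb
        have : μ * μ ^ 3 ≤ μ ^ 14 := by
          rw [← pow_succ']
          exact pow_le_pow_right₀ hμ1 (by norm_num)
        nlinarith
      have h3 : s ≤ b ^ 2 := by nlinarith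
      have h4 : 2 ≤ b ^ 2 := by nlinarith
      nlinarith
    rw [Real.log_mul hN0.ne' hspos.ne', hN]
    have := Real.log_le_log hspos h1
    linarith
  have hrs0 : 0 ≤ (r : ℝ) / s := by positivity
  have hrss : (r : ℝ) / s / s ≤ r / s := div_le_self hrs0 hs0
  have hexp : (1 + 1 / s) * r / s + 2 * Real.log (N * s) / (1 / s) ≤
      r / s + r / s / s + 4 * μ ^ 4 * s := by
    have h1 : (1 + 1 / s) * r / s + 2 * Real.log (N * s) / (1 / s) =
        r / s + r / s / s + 2 * Real.log (N * s) * s := by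
      field_simp
    rw [h1]
    have : 2 * Real.log (N * s) * s ≤ 2 * (2 * μ ^ 4) * s := by gcongr
    linarith
  set y := r / s + r / s / s + 4 * μ ^ 4 * s with hy
  have hy0 : 0 ≤ y := by positivity
  have hdy : (⌊y⌋₊ : ℝ) ≤ y := Nat.floor_le hy0
  have hsd : s * ⌊y⌋₊ ≤ r + r / s + 4 * μ ^ 4 * s ^ 2 := by
    calc s * ⌊y⌋₊ ≤ s * y := by gcongr
      _ = _ := by rw [hy]; field_simp
  have hB := Nat.le_ceil (r / s + 4 * μ ^ 4 * s ^ 2)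
  have hB' := Nat.ceil_lt_add_one (show 0 ≤ r / s + 4 * μ ^ 4 * s ^ 2 by positivity)
  refine ⟨h, ⌊y⌋₊, ⌈r / s + 4 * μ ^ 4 * s ^ 2⌉₊ + ⌊y⌋₊, ?_, ?_, ?_, ?_, ?_, ?_⟩
  · exact Nat.ceil_pos.2 (by positivity)
  · rw [← hs]
    exact hexp.trans_lt (Nat.lt_floor_add_one y)
  · have : (2 * (h * ⌊y⌋₊) + ⌊y⌋₊ : ℝ) ≤ r + (⌈r / s + 4 * μ ^ 4 * s ^ 2⌉₊ + ⌊y⌋₊) := by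
      rw [hs] at hsd hB ⊢
      linarith
    exact_mod_cast this
  · push_cast
    linarith
  · linarith
  · have : w ≤ b ^ 4 := by
      have h1 : w ≤ w * μ ^ 3 := le_mul_of_one_le_right (by linarith) hμ3
      have h2 : b ^ 3 ≤ b ^ 4 := pow_le_pow_right₀ (hμ1.trans hb1) (by norm_num)
      linarith
    rw [hs] at hsd
    have h3 : (r : ℝ) / (2 * h) ≤ 2 * w := by rwa [← hs]
    rw [hs] at hμs
    nlinarith

/-- The choice of parameters in the main argument. -/
theorem exists_parameters {N r : ℕ} {b μ σ p : ℝ} (hμ : 10 ^ 13 ≤ μ)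
    (hN : Real.log N = μ ^ 4) (hb : μ ^ 14 ≤ b) (hbN : b ^ 4 ≤ 2 * N) (hr : (r : ℝ) ≤ 2 * b ^ 4)
    (hσ0 : 0 ≤ σ) (hσ : b ^ 3 * μ ^ 10 ≤ σ ^ 2) (hp : p * N = σ ^ 2) (hp2 : p ≤ 2) :
    ∃ (h d B D t : ℕ) (u : ℝ), 0 < h ∧ Params N p (2 * σ) u t ∧
      (1 + 1 / (2 * h : ℝ)) * r / (2 * h : ℝ) + 2 * Real.log (N * (2 * h : ℝ)) / (1 / (2 * h : ℝ))
        < d + 1 ∧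
      2 * (h * d) + d ≤ r + B ∧ 400 * t * B + 2 ≤ D ∧
      960 * t * (h * d : ℕ) * (2 * σ) ≤ p * N * (D - 1) ∧
      4 * (σ * μ ^ 2) + 1 + B + (t + 1) * D + 512 * ((t + 1) * D + d) ≤ u := by
  have hμ0 : 0 < μ := by linarith [show (0 : ℝ) < 10 ^ 13 by norm_num]
  have hμ1 : 1 ≤ μ := by linarith [show (1 : ℝ) ≤ 10 ^ 13 by norm_num]
  have hb1 : μ ≤ b := (le_self_pow₀ hμ1 (by norm_num)).trans hb
  have hb0 : 0 < b := hμ0.trans_le hb1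
  obtain ⟨h, d, B, hh, hd, hB, hB9, hd5, hhd⟩ := exists_colour_parameters hμ hN hb hbN hr
  have hN0 : (0 : ℝ) < N := by
    have : 0 < b ^ 4 := by positivity
    linarith
  have hNne : N ≠ 0 := by
    rintro rfl
    simp at hN0
  obtain ⟨z, hz⟩ : ∃ z, z = σ ^ 2 / μ ^ 13 := ⟨_, rfl⟩
  have hzμ : z * μ ^ 13 = σ ^ 2 := by rw [hz]; field_simp
  have hbz : b ^ 3 / μ ^ 3 ≤ z := by
    rw [hz, div_le_div_iff₀ (by positivity) (by positivity)]
    calc b ^ 3 * μ ^ 13 = b ^ 3 * μ ^ 10 * μ ^ 3 := by ring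
      _ ≤ _ := by gcongr
  have hσb : b * μ ^ 12 ≤ σ := by
    refine le_of_sq_le_sq ?_ hσ0 
    calc (b * μ ^ 12) ^ 2 = b ^ 2 * μ ^ 14 * μ ^ 10 := by ring
      _ ≤ b ^ 2 * b * μ ^ 10 := by gcongr
      _ = b ^ 3 * μ ^ 10 := by ring
      _ ≤ σ ^ 2 := hσ
  have hσμ : μ ^ 26 ≤ σ := by
    calc μ ^ 26 = μ ^ 14 * μ ^ 12 := by ring
      _ ≤ b * μ ^ 12 := by gcongr
      _ ≤ σ := hσb
  have hσpos : 0 < σ := lt_of_lt_of_le (by positivity) hσμ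
  have hσz : σ * μ ^ 13 ≤ z := by
    rw [hz, le_div_iff₀ (by positivity)]
    calc σ * μ ^ 13 * μ ^ 13 = σ * μ ^ 26 := by ring
      _ ≤ σ * σ := by gcongr
      _ = σ ^ 2 := by ring
  have hμz : μ ^ 4 ≤ z := by
    refine le_trans ?_ hσz
    have h1 : 1 ≤ σ := (one_le_pow₀ hμ1).trans hσμ
    calc μ ^ 4 ≤ μ ^ 13 := pow_le_pow_right₀ hμ1 (by norm_num)
      _ ≤ σ * μ ^ 13 := le_mul_of_one_le_left (by positivity) h1
  have hμ4 : 1 ≤ μ ^ 4 := one_le_pow₀ hμ1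
  have hμ5 : 10 ^ 13 * μ ^ 4 ≤ μ ^ 5 := by
    calc 10 ^ 13 * μ ^ 4 ≤ μ * μ ^ 4 := by gcongr
      _ = μ ^ 5 := by ring
  have hμ9 : 10 ^ 13 * μ ^ 4 ≤ μ ^ 9 := hμ5.trans (pow_le_pow_right₀ hμ1 (by norm_num))
  have hz1 : 1 ≤ z := hμ4.trans hμz
  obtain ⟨t, ht⟩ : ∃ t, t = Nat.log 2 N + 1 := ⟨_, rfl⟩
  have htN : N < 2 ^ t := ht ▸ Nat.lt_pow_succ_log_self (by norm_num) N
  have ht2 : (t : ℝ) ≤ 2 * μ ^ 4 := by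
    have h1 : 2 ^ Nat.log 2 N ≤ N := Nat.pow_log_le_self 2 hNne
    have h2 : (2 : ℝ) ^ Nat.log 2 N ≤ N := by exact_mod_cast h1
    have h3 := Real.log_le_log (by positivity) h2
    rw [Real.log_pow, hN] at h3
    have h4 := Real.log_two_gt_d9
    rw [ht]
    push_cast
    have h5 : (Nat.log 2 N : ℝ) * 0.69 ≤ Nat.log 2 N * Real.log 2 := by
      gcongr
      linarith
    have h6 : 10 ^ 13 ≤ μ ^ 4 := hμ.trans (le_self_pow₀ hμ1 (by norm_num))
    linarith
  have ht0 : (0 : ℝ) ≤ t := Nat.cast_nonneg _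
  set D := ⌈z * μ ^ 5 / 10 ^ 8⌉₊ + 1 with hD
  have hD1 : z * μ ^ 5 / 10 ^ 8 ≤ (D : ℝ) - 1 := by
    rw [hD]
    push_cast
    linarith [Nat.le_ceil (z * μ ^ 5 / 10 ^ 8)]
  have hD2 : (D : ℝ) ≤ z * μ ^ 5 / 10 ^ 8 + 2 := by
    have := Nat.ceil_lt_add_one (show 0 ≤ z * μ ^ 5 / 10 ^ 8 by positivity)
    rw [hD]
    push_cast
    linarith
  have hBz : (B : ℝ) ≤ 9 * z := by linarith
  have hdz : (d : ℝ) ≤ 5 * z := by linarith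
  have hpN : 0 < p * N := by rw [hp]; positivity
  have hp0 : 0 < p := pos_of_mul_pos_left hpN hN0.le
  refine ⟨h, d, B, D, t, p * N / (2000 * (2 * t + 2)), hh,
    ⟨hp0, ?_, ?_, ?_, le_rfl, htN⟩, hd, hB, ?_, ?_, ?_⟩
  · have : 1 ≤ σ := (one_le_pow₀ hμ1).trans hσμ
    linarith
  · have : 1 ≤ σ := (one_le_pow₀ hμ1).trans hσμ
    linarith
  · rw [hp]
    have h1 : (2 * t + 2 : ℝ) ≤ 6 * μ ^ 4 := by linarith
    calc 7500 * (2 * t + 2 : ℝ) ^ 2 * (2 * σ) ≤ 7500 * (6 * μ ^ 4) ^ 2 * (2 * σ) := by gcongr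
      _ = 540000 * μ ^ 8 * σ := by ring
      _ ≤ μ * μ ^ 8 * σ := by gcongr; linarith
      _ = μ ^ 9 * σ := by ring
      _ ≤ μ ^ 26 * σ := by gcongr; norm_num
      _ ≤ σ * σ := by gcongr
      _ = σ ^ 2 := by ring
  · have h1 : (400 * t * B + 2 : ℝ) ≤ D := by
      have h2 : (400 * t * B : ℝ) ≤ 400 * (2 * μ ^ 4) * (9 * z) := by gcongr
      have h3 : 10 ^ 13 * μ ^ 4 * z ≤ μ ^ 5 * z := by gcongr
      have h4 : 1 ≤ μ ^ 4 * z := one_le_mul_of_one_le_of_one_le hμ4 hz1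
      linarith
    exact_mod_cast h1
  · rw [hp]
    push_cast
    calc 960 * t * (h * d : ℝ) * (2 * σ) ≤ 960 * (2 * μ ^ 4) * (2 * b ^ 4) * (2 * σ) := by gcongr
      _ = 7680 * μ ^ 4 * b ^ 4 * σ := by ring
      _ ≤ σ ^ 2 * (z * μ ^ 5 / 10 ^ 8) := by
        have h1 : b ^ 4 * μ ^ 9 ≤ σ * z := by
          calc b ^ 4 * μ ^ 9 = (b * μ ^ 12) * (b ^ 3 / μ ^ 3) := by field_simp
            _ ≤ σ * z := by gcongr
        have h2 : 768000000000 * μ ^ 4 ≤ μ ^ 14 := by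
          refine le_trans ?_ (hμ9.trans (pow_le_pow_right₀ hμ1 (by norm_num)))
          gcongr
          norm_num
        calc 7680 * μ ^ 4 * b ^ 4 * σ = (768000000000 * μ ^ 4) * b ^ 4 * σ / 10 ^ 8 := by ring
          _ ≤ μ ^ 14 * b ^ 4 * σ / 10 ^ 8 := by gcongr
          _ = b ^ 4 * μ ^ 9 * (μ ^ 5 * σ / 10 ^ 8) := by ring
          _ ≤ σ * z * (μ ^ 5 * σ / 10 ^ 8) := by gcongr
          _ = σ ^ 2 * (z * μ ^ 5 / 10 ^ 8) := by ring
      _ ≤ σ ^ 2 * (D - 1) := by gcongr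
  · have h1 : z * μ ^ 9 / 12000 ≤ p * N / (2000 * (2 * t + 2)) := by
      rw [hp, ← hzμ, div_le_div_iff₀ (by norm_num) (by positivity)]
      calc z * μ ^ 9 * (2000 * (2 * t + 2)) ≤ z * μ ^ 9 * (2000 * (6 * μ ^ 4)) := by
            gcongr
            linarith
        _ = z * μ ^ 13 * 12000 := by ring
    refine le_trans ?_ h1
    have h2 : (t + 1 : ℝ) * D ≤ 3 * μ ^ 4 * (z * μ ^ 5 / 10 ^ 8 + 2) := by
      gcongr
      linarith
    have h3 : 3 * μ ^ 4 * (z * μ ^ 5 / 10 ^ 8 + 2) = 3 / 10 ^ 8 * (z * μ ^ 9) + 6 * μ ^ 4 := by ring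
    have h4 : σ * μ ^ 2 ≤ z := by
      refine le_trans (mul_le_mul_of_nonneg_left ?_ hσ0) hσz
      exact pow_le_pow_right₀ hμ1 (by norm_num)
    have h5 : 10 ^ 13 * z ≤ z * μ ^ 9 := by
      calc 10 ^ 13 * z = z * (10 ^ 13 * 1) := by ring
        _ ≤ z * (10 ^ 13 * μ ^ 4) := by gcongr
        _ ≤ z * μ ^ 9 := by gcongr
    obtain ⟨v, hv⟩ : ∃ v, v = z * μ ^ 9 := ⟨_, rfl⟩
    rw [← hv] at h3 h5 ⊢
    rw [h3] at h2
    clear_value D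
    linarith

end Parameters

section HamiltonCycles
variable {V : Type} [DecidableEq V]

theorem exists_walk_of_list {C : SimpleGraph V} (l : List V) :
    ∀ a, (∀ e ∈ pathEdges (a :: l), e ∈ C.edgeSet) → ∃ (b : V) (w : C.Walk a b),
      (a :: l).getLast? = some b ∧ w.support = a :: l ∧
        ∀ e, e ∈ w.edges ↔ e ∈ pathEdges (a :: l) := by
  induction l with
  | nil => exact fun a _ => ⟨a, Walk.nil, by simp⟩
  | cons c l ih =>
    intro a h
    rw [pathEdges_cons_cons] at h
    obtain ⟨b, w, h1, h2, h3⟩ := ih c fun e he => h e (Finset.mem_insert_of_mem he)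
    have hac : C.Adj a c := h s(a, c) (Finset.mem_insert_self _ _)
    refine ⟨b, Walk.cons hac w, ?_, ?_, fun e => ?_⟩
    · rw [List.getLast?_cons_cons, h1]
    · rw [Walk.support_cons, h2]
    · rw [Walk.edges_cons, List.mem_cons, h3, pathEdges_cons_cons, Finset.mem_insert]

theorem isHamCycle_fromEdgeSet {n : ℕ} (hn : 3 ≤ n) {l : List (Fin n)} (hl : Spans l) :
    EDHC.IsHamCycle (SimpleGraph.fromEdgeSet (cycEdges l : Set (Sym2 (Fin n)))) ∧
      (SimpleGraph.fromEdgeSet (cycEdges l : Set (Sym2 (Fin n)))).edgeSet = cycEdges l := by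
  have hlen : l.length = n := by rw [hl.length, Fintype.card_fin]
  have hedge : (SimpleGraph.fromEdgeSet (cycEdges l : Set (Sym2 (Fin n)))).edgeSet =
      cycEdges l := by
    rw [SimpleGraph.edgeSet_fromEdgeSet, sdiff_eq_left, Set.disjoint_left]
    intro e he
    exact not_isDiag_of_mem_cycEdges hl.1 (by omega) (Finset.mem_coe.1 he)
  refine ⟨?_, hedge⟩
  cases l with
  | nil => simp at hlen; omega
  | cons a l =>
    obtain ⟨b, w, hb, hw, hwe⟩ := exists_walk_of_list
      (C := SimpleGraph.fromEdgeSet (cycEdges (a :: l) : Set (Sym2 (Fin n)))) l a (by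
        intro e he
        rw [hedge]
        exact pathEdges_subset_cycEdges _ he)
    have hcyc := cycEdges_eq_insert (l := a :: l) rfl hb
    have hba : s(b, a) ∉ pathEdges (a :: l) := by
      intro hmem
      rw [Finset.insert_eq_of_mem hmem] at hcyc
      have h1 := card_cycEdges hl.1 (by omega)
      have h2 := card_pathEdges hl.1
      rw [hcyc] at h1
      omega
    have hadj : (SimpleGraph.fromEdgeSet (cycEdges (a :: l) : Set (Sym2 (Fin n)))).Adj b a := by
      rw [← SimpleGraph.mem_edgeSet, hedge, hcyc]
      exact Finset.mem_coe.2 (Finset.mem_insert_self _ _)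
    refine ⟨b, Walk.cons hadj w, ?_, ?_⟩
    · rw [Walk.isHamiltonianCycle_iff_isCycle_and_length_eq, Walk.cons_isCycle_iff,
        Walk.isPath_def, hw, hwe, Walk.length_cons, ← Walk.length_support, hw, hlen,
        Fintype.card_fin]
      exact ⟨⟨hl.1, hba⟩, rfl⟩
    · ext e
      rw [hedge, Set.mem_ofPred_eq, Walk.edges_cons, List.mem_cons, hwe, hcyc, Finset.mem_coe,
        Finset.mem_insert]

end HamiltonCycles

section Degrees
variable {n : ℕ}

theorem deg_eq_card_nb (G : SimpleGraph (Fin n)) (v : Fin n) : EDHC.deg G v = (nb G v).card := by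
  rw [EDHC.deg, ← Set.ncard_coe_finset]
  congr 1
  ext w
  simp

theorem minDeg_le (G : SimpleGraph (Fin n)) (v : Fin n) : EDHC.minDeg G ≤ (nb G v).card := by
  rw [← deg_eq_card_nb]
  exact Nat.sInf_le ⟨v, rfl⟩

theorem le_maxDeg (G : SimpleGraph (Fin n)) (v : Fin n) : (nb G v).card ≤ EDHC.maxDeg G := by
  rw [← deg_eq_card_nb]
  exact le_csSup (Set.finite_range _).bddAbove ⟨v, rfl⟩

theorem isJumbled_of_isPseudorandom {G : SimpleGraph (Fin n)} {p : ℝ}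
    (hG : EDHC.IsPseudorandom n G p) : EDHC.IsJumbled G p (2 * √(p * n)) := by
  intro S
  refine (hG.1 S).trans ?_
  refine mul_le_mul_of_nonneg_right (mul_le_mul_of_nonneg_left (Real.sqrt_le_sqrt ?_) (by norm_num))
    (Nat.cast_nonneg _)
  nlinarith [mul_nonneg (Nat.cast_nonneg (α := ℝ) n) (sq_nonneg p)]

end Degrees

/-- The covering statement for one reservoir, with the parameters as in the pseudorandomness
hypotheses. -/
theorem exists_cycles_of_reservoir {n r r₁ : ℕ} (hn : 3 ≤ n) {p₁ b μ σ : ℝ}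
    {G R H : SimpleGraph (Fin n)} (hμ : 10 ^ 13 ≤ μ) (hlog : Real.log n = μ ^ 4)
    (hb : μ ^ 14 ≤ b) (hbn : b ^ 4 ≤ 2 * n) (hr : (r : ℝ) ≤ 2 * b ^ 4)
    (hσ0 : 0 ≤ σ) (hσ : b ^ 3 * μ ^ 10 ≤ σ ^ 2) (hp : p₁ * n = σ ^ 2)
    (hG : EDHC.IsPseudorandom n G p₁) (hRG : R ≤ G) (hR : ∀ v, (nb R v).card = r₁)
    (hr₁ : EDHC.minDeg G - 1 ≤ r₁) (hH : ∀ v, (nb H v).card = r)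
    (hHR : ∀ e ∈ H.edgeSet, e ∉ R.edgeSet) :
    ∃ (ι : Type) (c : ι → List (Fin n)), (∀ i, Spans (c i)) ∧
      (∀ e ∈ H.edgeSet, ∃ i, e ∈ cycEdges (c i)) ∧
      (∀ i, ∀ e ∈ cycEdges (c i), e ∈ H.edgeSet ∨ e ∈ R.edgeSet) ∧
      ∀ i j, i ≠ j → Disjoint (cycEdges (c i)) (cycEdges (c j)) := by
  have : Nonempty (Fin n) := ⟨⟨0, by omega⟩⟩
  have hμ1 : 1 ≤ μ := by linarith [show (1 : ℝ) ≤ 10 ^ 13 by norm_num]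
  have hμ0 : 0 < μ := by linarith
  have hσμ : 32 * μ ^ 2 ≤ σ := by
    refine le_of_sq_le_sq ?_ hσ0
    have hb1 : 1 ≤ b := (one_le_pow₀ hμ1).trans hb
    calc (32 * μ ^ 2) ^ 2 = 1024 * μ ^ 4 := by ring
      _ ≤ μ * μ ^ 4 := by gcongr; linarith
      _ = μ ^ 5 := by ring
      _ ≤ μ ^ 10 := pow_le_pow_right₀ hμ1 (by norm_num)
      _ ≤ b ^ 3 * μ ^ 10 := le_mul_of_one_le_left (by positivity) (one_le_pow₀ hb1)
      _ ≤ σ ^ 2 := hσ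
  have hsmall : 32 * (σ * μ ^ 2) ≤ σ ^ 2 := by nlinarith
  have hsqrt : √(n * p₁ * Real.log n) = σ * μ ^ 2 := by
    rw [mul_comm (n : ℝ), hp, hlog, show σ ^ 2 * μ ^ 4 = (σ * μ ^ 2) ^ 2 by ring]
    exact Real.sqrt_sq (by positivity)
  obtain ⟨hmin, -, hmax⟩ := hG.2.2.2.1
  rw [hsqrt, mul_comm (n : ℝ), hp] at hmin hmax
  have hlow : ∀ v, σ ^ 2 - 2 * (σ * μ ^ 2) ≤ ((nb G v).card : ℝ) := fun v =>
    hmin.trans (by exact_mod_cast minDeg_le G v)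
  have hupp : ∀ v, ((nb G v).card : ℝ) ≤ σ ^ 2 + 2 * (σ * μ ^ 2) := fun v =>
    le_trans (by exact_mod_cast le_maxDeg G v) hmax
  have hn0 : (0 : ℝ) < n := by exact_mod_cast (show 0 < n by omega)
  have hp2 : p₁ ≤ 2 := by
    have v : Fin n := ⟨0, by omega⟩
    have h1 := hlow v
    have h2 : ((nb G v).card : ℝ) ≤ n := by
      have := Finset.card_le_univ (nb G v)
      rw [Fintype.card_fin] at this
      exact_mod_cast this
    have h3 : p₁ * n ≤ 2 * n := by rw [hp]; linarith
    exact le_of_mul_le_mul_right h3 hn0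
  obtain ⟨h, d, B, D, t, u, hh, hP, hd, hB, hD1, hD2, hu⟩ :=
    exists_parameters hμ hlog hb hbn hr hσ0 hσ hp hp2
  have hh0 : (1 : ℝ) ≤ h := by exact_mod_cast hh
  obtain ⟨f, hf⟩ := exists_balanced_colouring (fun v => nb H v) (d := r) (s := 2 * h)
    (x := 1 / (2 * h : ℝ)) (by omega) (fun v => by rw [hH v]) (by positivity)
    (by rw [div_le_one (by positivity)]; linarith)
  have hjum := isJumbled_of_isPseudorandom hG
  rw [hp, Real.sqrt_sq hσ0] at hjum
  refine exists_cycles_cover (G := G) (R := R) (H := H) (p := p₁) (β := 2 * σ) (u := u)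
    (u₀ := 4 * (σ * μ ^ 2) + 1) (t := t) (h := h) (d := d) (r := r) (B := B) (D := D)
    (f := fun v => f v) ?_ hjum hRG ?_ ?_ ?_ ?_ ?_ hu hHR hH (fun v => (f v).2) ?_ hB hD1 ?_
  · rwa [Fintype.card_fin]
  · rwa [Fintype.card_fin]
  · intro v
    rw [Fintype.card_fin, hp]
    linarith [hlow v]
  · intro v
    rw [Fintype.card_fin, hp]
    linarith [hupp v]
  · rw [Fintype.card_fin, hp, Real.log_mul hn0.ne' (by norm_num), hlog]
    have h1 : Real.log 16 ≤ 16 := (Real.log_le_sub_one_of_pos (by norm_num)).trans (by norm_num)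
    have h2 : 1 ≤ μ ^ 2 := one_le_pow₀ hμ1
    have h3 : 32 * μ ^ 4 ≤ b ^ 3 * μ ^ 10 / 400 := by
      have hb1 : 1 ≤ b := (one_le_pow₀ hμ1).trans hb
      have h4 : μ ^ 10 ≤ b ^ 3 * μ ^ 10 := le_mul_of_one_le_left (by positivity) (one_le_pow₀ hb1)
      have h5 : μ * μ ^ 4 ≤ μ ^ 10 := by
        rw [← pow_succ']
        exact pow_le_pow_right₀ hμ1 (by norm_num)
      have h6 : 10 ^ 13 * μ ^ 4 ≤ μ * μ ^ 4 := by gcongr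
      have h7 : 0 ≤ μ ^ 4 := by positivity
      linarith
    have h8 : 1 ≤ μ ^ 4 := one_le_pow₀ hμ1
    linarith
  · intro v
    have h1 : nb R v ⊆ nb G v := fun w hw => mem_nb.2 (hRG (mem_nb.1 hw))
    have h2 := Finset.card_sdiff_add_card_eq_card h1
    rw [hR v] at h2
    have h3 : ((nb G v \ nb R v).card : ℝ) + r₁ = (nb G v).card := by exact_mod_cast h2
    have h4 : (EDHC.minDeg G : ℝ) ≤ r₁ + 1 := by
      exact_mod_cast (show EDHC.minDeg G ≤ r₁ + 1 by omega)
    linarith [hupp v]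
  · intro v i
    rw [← Nat.lt_succ_iff]
    by_cases hi : i < 2 * h
    · have h1 := (hf v ⟨i, hi⟩)
      push_cast at h1
      have h2 : (#{w ∈ nb H v | (f w : ℕ) = i} : ℝ) < d + 1 := by
        refine lt_of_le_of_lt ?_ hd
        rw [Fintype.card_fin] at h1
        refine le_trans ?_ h1
        have : #{w ∈ nb H v | (f w : ℕ) = i} ≤ #{w ∈ nb H v | f w = ⟨i, hi⟩} := by
          refine Finset.card_le_card fun w hw => ?_
          obtain ⟨h3, h4⟩ := Finset.mem_filter.1 hw
          exact Finset.mem_filter.2 ⟨h3, Fin.ext h4⟩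
        exact_mod_cast this
      exact_mod_cast h2
    · rw [Finset.card_eq_zero.2]
      · omega
      · refine Finset.filter_eq_empty_iff.2 fun w _ h1 => hi ?_
        rw [← h1]
        exact (f w).2
  · rwa [Fintype.card_fin]

end HamCover

open EDHC in
/-- Lemma 8.1 (MiniHamDecomp). -/
theorem stmt_2 :
    ∃ N : ℕ, ∀ n : ℕ, N ≤ n →
      ∀ (p0 p1 : ℝ) (m : ℕ) (G0 H0 : SimpleGraph (Fin n))
        (G H : ℕ → SimpleGraph (Fin n)),
      (Real.log n) ^ 14 / n ≤ p0 →
      (((n : ℝ) * p0) ^ 3 * (Real.log n) ^ 10) ^ (1 / 4 : ℝ) / n ≤ p1 →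
      (m : ℝ) = Real.log ((n : ℝ) ^ 2 * p1) / Real.log (Real.log n) →
      IsPseudorandom n G0 p0 →
      (∀ i ∈ Finset.Icc 1 (2 * m + 1), G i ≤ G0 ∧
        IsPseudorandom n (G i) (if Odd i then p1 else 10 ^ 10 * p1) ∧
        H i ≤ G i ∧
        ∃ r : ℕ, Even r ∧ (∀ v, deg (H i) v = r) ∧
          minDeg (G i) - 1 ≤ r ∧ r ≤ minDeg (G i)) →
      (∀ i ∈ Finset.Icc 1 (2 * m + 1), ∀ j ∈ Finset.Icc 1 (2 * m + 1), i ≠ j →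
        Disjoint (G i).edgeSet (G j).edgeSet) →
      H0 ≤ G0 → (∃ r : ℕ, Even r ∧ ∀ v, deg H0 v = r) →
      Disjoint H0.edgeSet (⋃ i ∈ Finset.Icc 1 (2 * m + 1), (H i).edgeSet) →
      ∃ HC : Set (SimpleGraph (Fin n)),
        (∀ C ∈ HC, IsHamCycle C) ∧
        (HC.Pairwise fun C C' => Disjoint C.edgeSet C'.edgeSet) ∧
        H0.edgeSet ⊆ (⋃ C ∈ HC, C.edgeSet) ∧
        ∀ C ∈ HC, C.edgeSet ⊆ H0.edgeSet ∪ ⋃ i ∈ Finset.Icc 1 (2 * m + 1), (H i).edgeSet := by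
  obtain ⟨N, hN⟩ := exists_nat_ge (Real.exp (10 ^ 52))
  refine ⟨max N 3, fun n hn p0 p1 m G0 H0 G H hp0 hp1 _ hG0 hGi _ hH0 hH0r hdisj => ?_⟩
  have hn3 : 3 ≤ n := (le_max_right _ _).trans hn
  have hn0 : (0 : ℝ) < n := by exact_mod_cast (show 0 < n by omega)
  have hlog : 10 ^ 52 ≤ Real.log n := by
    rw [Real.le_log_iff_exp_le hn0]
    exact hN.trans (by exact_mod_cast (le_max_left _ _).trans hn)
  have hmem : (1 : ℕ) ∈ Finset.Icc 1 (2 * m + 1) := Finset.mem_Icc.2 ⟨le_rfl, by omega⟩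
  obtain ⟨-, hG1, hHG, r₁, -, hr₁, hr₁min, -⟩ := hGi 1 hmem
  rw [if_pos odd_one] at hG1
  obtain ⟨r, -, hr⟩ := hH0r
  rw [div_le_iff₀ hn0] at hp0 hp1
  obtain ⟨μ, hμ0, hμ⟩ : ∃ μ : ℝ, 0 ≤ μ ∧ Real.log n = μ ^ 4 :=
    ⟨(Real.log n) ^ ((4 : ℕ) : ℝ)⁻¹, by positivity,
      (Real.rpow_inv_natCast_pow (by linarith) (by norm_num)).symm⟩
  rw [hμ] at hp0 hp1 hlog
  have hμ13 : 10 ^ 13 ≤ μ := by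
    refine le_of_pow_le_pow_left₀ (n := 4) (by norm_num) hμ0 (le_trans (le_of_eq ?_) hlog)
    norm_num
  have ha0 : 0 ≤ p0 * n := le_trans (by positivity) hp0
  obtain ⟨b, hb0, hb⟩ : ∃ b : ℝ, 0 ≤ b ∧ p0 * n = b ^ 4 :=
    ⟨(p0 * n) ^ ((4 : ℕ) : ℝ)⁻¹, by positivity,
      (Real.rpow_inv_natCast_pow ha0 (by norm_num)).symm⟩
  have hμb : μ ^ 14 ≤ b := by
    refine le_of_pow_le_pow_left₀ (n := 4) (by norm_num) hb0 ?_
    calc (μ ^ 14) ^ 4 = (μ ^ 4) ^ 14 := by ring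
      _ ≤ b ^ 4 := hb ▸ hp0
  have hσ : b ^ 3 * μ ^ 10 ≤ p1 * n := by
    refine le_trans (le_of_eq ?_) hp1
    rw [mul_comm (n : ℝ), hb, show (b ^ 4) ^ 3 * (μ ^ 4) ^ 10 = (b ^ 3 * μ ^ 10) ^ 4 by ring,
      show (1 / 4 : ℝ) = ((4 : ℕ) : ℝ)⁻¹ by norm_num,
      Real.pow_rpow_inv_natCast (by positivity) (by norm_num)]
  have hpn0 : 0 ≤ p1 * n := le_trans (by positivity) hσ
  have hsqrt : √(n * p0 * Real.log n) = b ^ 2 * μ ^ 2 := by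
    rw [mul_comm (n : ℝ), hb, hμ, show b ^ 4 * μ ^ 4 = (b ^ 2 * μ ^ 2) ^ 2 by ring]
    exact Real.sqrt_sq (by positivity)
  obtain ⟨hmin, -, hmax⟩ := hG0.2.2.2.1
  rw [hsqrt, mul_comm (n : ℝ), hb] at hmin hmax
  have hsmall : 4 * (b ^ 2 * μ ^ 2) ≤ b ^ 4 := by
    have h1 : 4 * μ ^ 2 ≤ b ^ 2 := by
      have h2 : μ * μ ≤ b := by
        refine le_trans ?_ hμb
        rw [← pow_two]
        exact pow_le_pow_right₀ (by linarith [show (1 : ℝ) ≤ 10 ^ 13 by norm_num]) (by norm_num)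
      have h3 : 2 * μ ≤ b := by nlinarith
      nlinarith
    nlinarith [sq_nonneg b]
  let v₀ : Fin n := ⟨0, by omega⟩
  have hbn : b ^ 4 ≤ 2 * n := by
    have h1 : ((HamCover.nb G0 v₀).card : ℝ) ≤ n := by
      have := Finset.card_le_univ (HamCover.nb G0 v₀)
      rw [Fintype.card_fin] at this
      exact_mod_cast this
    have h2 : (minDeg G0 : ℝ) ≤ (HamCover.nb G0 v₀).card := by
      exact_mod_cast HamCover.minDeg_le G0 v₀
    linarith
  have hrb : (r : ℝ) ≤ 2 * b ^ 4 := by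
    have h1 : r ≤ maxDeg G0 := by
      rw [← hr v₀, HamCover.deg_eq_card_nb]
      refine (Finset.card_le_card fun w hw => ?_).trans (HamCover.le_maxDeg G0 v₀)
      exact HamCover.mem_nb.2 (hH0 (HamCover.mem_nb.1 hw))
    have h2 : (r : ℝ) ≤ maxDeg G0 := by exact_mod_cast h1
    linarith
  obtain ⟨ι, c, hc1, hc2, hc3, hc4⟩ := HamCover.exists_cycles_of_reservoir (G := G 1) (R := H 1)
    (H := H0) (σ := √(p1 * n)) hn3 hμ13 hμ hμb hbn hrb (Real.sqrt_nonneg _)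
    (by rwa [Real.sq_sqrt hpn0]) (Real.sq_sqrt hpn0).symm hG1 hHG
    (fun v => (HamCover.deg_eq_card_nb _ v).symm.trans (hr₁ v)) hr₁min
    (fun v => (HamCover.deg_eq_card_nb _ v).symm.trans (hr v))
    (fun e he he' => Set.disjoint_left.1 hdisj he (Set.mem_biUnion hmem he'))
  have hham := fun i => HamCover.isHamCycle_fromEdgeSet hn3 (hc1 i)
  refine ⟨Set.range fun i => SimpleGraph.fromEdgeSet (HamCover.cycEdges (c i) : Set (Sym2 (Fin n))),
    ?_, ?_, fun e he => ?_, ?_⟩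
  · rintro _ ⟨i, rfl⟩
    exact (hham i).1
  · rintro _ ⟨i, rfl⟩ _ ⟨j, rfl⟩ hij
    dsimp only
    rw [(hham i).2, (hham j).2, Finset.disjoint_coe]
    exact hc4 i j fun h => hij (by rw [h])
  · obtain ⟨i, hi⟩ := hc2 e he
    refine Set.mem_biUnion ⟨i, rfl⟩ ?_
    rw [(hham i).2]
    exact hi
  · rintro _ ⟨i, rfl⟩ e he
    dsimp only at he
    rw [(hham i).2] at he
    exact (hc3 i e he).imp_right fun h => Set.mem_biUnion hmem h
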